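/- Let k be an integer with k ≥ 129, and set (ρ,θ) = (3.21432, 2.3291) if k ≥ 200, (ρ,θ) = (3.21734, 2.3849) if 150 ≤ k ≤ 199, and (ρ,θ) = (3.22313, 2.4183) if 129 ≤ k ≤ 149. Then there exists a positive integer s with s ≤ ρk² such that for every real P ≥ 1, J_{s,k}(P) ≤ k^{θk³} · P^{2s − k(k+1)/2 + 0.001k²}. -/

import Mathlib

/-- `Jv s k P` is Vinogradov's integral `J_{s,k}(P)`: the number of `2s`-tuples of integers
`(x₁,…,x_s,y₁,…,y_s)` with `1 ≤ xᵢ, yᵢ ≤ P` satisfying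
`∑ᵢ (xᵢ^j − yᵢ^j) = 0` for every `1 ≤ j ≤ k`. -/
noncomputable def Jv (s k : ℕ) (P : ℝ) : ℕ :=
  Nat.card {xy : (Fin s → ℤ) × (Fin s → ℤ) //
    (∀ i, 1 ≤ xy.1 i ∧ (xy.1 i : ℝ) ≤ P ∧ 1 ≤ xy.2 i ∧ (xy.2 i : ℝ) ≤ P) ∧
    ∀ j, 1 ≤ j → j ≤ k → (∑ i, (xy.1 i ^ j - xy.2 i ^ j)) = 0}

set_option linter.unusedSectionVars false

namespace Vino

open Finset

section Mean
variable {G : Type*} [AddCommGroup G] [Fintype G] [DecidableEq G]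

/-- The average of a real function over the dual group. -/
noncomputable def mean (φ : AddChar G ℂ → ℝ) : ℝ :=
  (Fintype.card G : ℝ)⁻¹ * ∑ ψ, φ ψ

/-- The exponential sum with frequencies `F i`, `i ∈ A`. -/
noncomputable def esum {ι : Type*} (A : Finset ι) (F : ι → G) (ψ : AddChar G ℂ) : ℂ :=
  ∑ i ∈ A, ψ (F i)

lemma mean_mono {φ φ' : AddChar G ℂ → ℝ} (h : ∀ ψ, φ ψ ≤ φ' ψ) : mean φ ≤ mean φ' := by
  unfold mean
  gcongr with ψ _
  exact h ψ

lemma sum_esum_mul_conj {ι κ : Type*} (A : Finset ι) (B : Finset κ) (F : ι → G) (F' : κ → G) :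
    ∑ ψ : AddChar G ℂ, esum A F ψ * (starRingEnd ℂ) (esum B F' ψ) =
      (Fintype.card G : ℂ) * ((A ×ˢ B).filter (fun x => F x.1 = F' x.2)).card := by
  have h : ∀ ψ : AddChar G ℂ, esum A F ψ * (starRingEnd ℂ) (esum B F' ψ) =
      ∑ x ∈ A ×ˢ B, ψ (F x.1 - F' x.2) := by
    intro ψ
    unfold esum
    rw [map_sum, Finset.sum_mul_sum, Finset.sum_product]
    refine Finset.sum_congr rfl fun i _ => Finset.sum_congr rfl fun j _ => ?_
    rw [AddChar.map_sub_eq_div, div_eq_mul_inv, ← AddChar.inv_apply_eq_conj]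
  simp_rw [h]
  rw [Finset.sum_comm]
  simp_rw [AddChar.sum_apply_eq_ite, sub_eq_zero]
  rw [Finset.card_filter]
  push_cast
  rw [Finset.mul_sum]
  simp

lemma esum_mul {ι κ : Type*} (A : Finset ι) (B : Finset κ) (F : ι → G) (F' : κ → G)
    (ψ : AddChar G ℂ) :
    esum A F ψ * esum B F' ψ = esum (A ×ˢ B) (fun x => F x.1 + F' x.2) ψ := by
  unfold esum
  rw [Finset.sum_mul_sum, Finset.sum_product]
  simp [AddChar.map_add_eq_mul]

lemma prod_esum {ι : Type*} {r : ℕ} (I : Fin r → Finset ι) (F : ι → G) (ψ : AddChar G ℂ) :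
    ∏ i, esum (I i) F ψ = esum (Fintype.piFinset I) (fun z => ∑ i, F (z i)) ψ := by
  unfold esum
  rw [Finset.prod_univ_sum]
  exact Finset.sum_congr rfl fun z _ => (map_prod ψ.toMonoidHom (fun i => Multiplicative.ofAdd (F (z i))) _).symm

lemma esum_pow {ι : Type*} (r : ℕ) (I : Finset ι) (F : ι → G) (ψ : AddChar G ℂ) :
    esum I F ψ ^ r = esum (Fintype.piFinset fun _ : Fin r => I) (fun z => ∑ i, F (z i)) ψ := by
  rw [← prod_esum]
  simp

lemma norm_esum_le {ι : Type*} (I : Finset ι) (F : ι → G) (ψ : AddChar G ℂ) :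
    ‖esum I F ψ‖ ≤ I.card := by
  unfold esum
  refine (norm_sum_le _ _).trans ?_
  simp

lemma mean_norm_sq {ι : Type*} (A : Finset ι) (F : ι → G) :
    mean (fun ψ => ‖esum A F ψ‖ ^ 2) =
      (((A ×ˢ A).filter (fun x => F x.1 = F x.2)).card : ℝ) := by
  have h := sum_esum_mul_conj A A F F
  have h2 : ((∑ ψ : AddChar G ℂ, ‖esum A F ψ‖ ^ 2 : ℝ) : ℂ) =
      (((Fintype.card G : ℝ) * ((A ×ˢ A).filter (fun x => F x.1 = F x.2)).card : ℝ) : ℂ) := by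
    push_cast
    rw [← h]
    refine Finset.sum_congr rfl fun ψ _ => ?_
    rw [Complex.mul_conj, Complex.normSq_eq_norm_sq]
    push_cast; rfl
  have h3 := Complex.ofReal_injective h2
  unfold mean
  rw [h3, ← mul_assoc, inv_mul_cancel₀, one_mul]
  exact_mod_cast Fintype.card_ne_zero

/-- The number of solutions of `F i + F' b = F i' + F' b'`, as a mean value. -/
noncomputable def wm {ι κ : Type*} (A : Finset ι) (F : ι → G) (B : Finset κ) (F' : κ → G) : ℝ :=
  mean fun ψ => ‖esum A F ψ‖ ^ 2 * ‖esum B F' ψ‖ ^ 2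

/-- The finset of solutions counted by `wm`. -/
def sols {ι κ : Type*} (A : Finset ι) (F : ι → G) (B : Finset κ) (F' : κ → G) :
    Finset ((ι × κ) × (ι × κ)) :=
  ((A ×ˢ B) ×ˢ (A ×ˢ B)).filter (fun x => F x.1.1 + F' x.1.2 = F x.2.1 + F' x.2.2)

lemma wm_eq_card {ι κ : Type*} (A : Finset ι) (F : ι → G) (B : Finset κ) (F' : κ → G) :
    wm A F B F' = ((sols A F B F').card : ℝ) := by
  unfold wm sols
  rw [← mean_norm_sq (A ×ˢ B) (fun x : ι × κ => F x.1 + F' x.2)]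
  congr 1
  ext ψ
  rw [← esum_mul, norm_mul, mul_pow]

lemma mem_sols {ι κ : Type*} {A : Finset ι} {F : ι → G} {B : Finset κ} {F' : κ → G}
    {x : (ι × κ) × (ι × κ)} : x ∈ sols A F B F' ↔
      ((x.1.1 ∈ A ∧ x.1.2 ∈ B) ∧ (x.2.1 ∈ A ∧ x.2.2 ∈ B)) ∧
        F x.1.1 + F' x.1.2 = F x.2.1 + F' x.2.2 := by
  simp [sols]

lemma wm_mono {ι κ : Type*} {A A' : Finset ι} {B B' : Finset κ} (F : ι → G) (F' : κ → G)
    (hA : A ⊆ A') (hB : B ⊆ B') : wm A F B F' ≤ wm A' F B' F' := by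
  rw [wm_eq_card, wm_eq_card]
  norm_cast
  apply Finset.card_le_card
  intro x hx
  rw [mem_sols] at hx ⊢
  exact ⟨⟨⟨hA hx.1.1.1, hB hx.1.1.2⟩, ⟨hA hx.1.2.1, hB hx.1.2.2⟩⟩, hx.2⟩

lemma wm_nonneg {ι κ : Type*} (A : Finset ι) (F : ι → G) (B : Finset κ) (F' : κ → G) :
    0 ≤ wm A F B F' := by
  rw [wm_eq_card]; positivity

lemma card_nsmul_le_sum_sq {β : Type*} (T : Finset β) (g : β → ℂ) :
    ‖∑ b ∈ T, g b‖ ^ 2 ≤ (T.card : ℝ) * ∑ b ∈ T, ‖g b‖ ^ 2 := by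
  calc ‖∑ b ∈ T, g b‖ ^ 2 ≤ (∑ b ∈ T, ‖g b‖) ^ 2 := by
        gcongr; exact norm_sum_le _ _
    _ ≤ _ := sq_sum_le_card_mul_sum_sq

lemma esum_fiberwise {ι γ : Type*} [DecidableEq γ] (A : Finset ι) (F : ι → G) (cl : ι → γ)
    (T : Finset γ) (hT : ∀ i ∈ A, cl i ∈ T) (ψ : AddChar G ℂ) :
    esum A F ψ = ∑ ξ ∈ T, esum (A.filter (fun i => cl i = ξ)) F ψ := by
  unfold esum
  rw [Finset.sum_fiberwise_of_maps_to hT]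

lemma mean_sum {β : Type*} (T : Finset β) (φ : β → AddChar G ℂ → ℝ) :
    mean (fun ψ => ∑ b ∈ T, φ b ψ) = ∑ b ∈ T, mean (φ b) := by
  unfold mean
  rw [Finset.sum_comm, Finset.mul_sum]

lemma mean_const_mul (c : ℝ) (φ : AddChar G ℂ → ℝ) :
    mean (fun ψ => c * φ ψ) = c * mean φ := by
  unfold mean
  rw [← Finset.mul_sum]; ring

/-- Cauchy's inequality over classes. -/
lemma wm_le_card_mul_sum {ι κ γ : Type*} [DecidableEq γ] (A : Finset ι) (F : ι → G)
    (B : Finset κ) (F' : κ → G) (cl : ι → γ) (T : Finset γ) (hT : ∀ i ∈ A, cl i ∈ T) :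
    wm A F B F' ≤ T.card * ∑ ξ ∈ T, wm (A.filter (fun i => cl i = ξ)) F B F' := by
  unfold wm
  rw [← mean_sum, ← mean_const_mul]
  apply mean_mono
  intro ψ
  rw [esum_fiberwise A F cl T hT, ← Finset.sum_mul, ← mul_assoc]
  gcongr
  exact card_nsmul_le_sum_sq _ _

/-- If solutions have equal keys then the count splits over the keys. -/
lemma wm_eq_sum_of_key {ι κ β : Type*} [DecidableEq β] (A : Finset ι) (F : ι → G)
    (B : Finset κ) (F' : κ → G) (key : ι → β) (T : Finset β) (hT : ∀ i ∈ A, key i ∈ T)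
    (h : ∀ x ∈ sols A F B F', key x.1.1 = key x.2.1) :
    wm A F B F' = ∑ b ∈ T, wm (A.filter (fun i => key i = b)) F B F' := by
  simp_rw [wm_eq_card]
  rw [Finset.card_eq_sum_card_fiberwise (f := fun x => key x.1.1) (t := T)]
  · push_cast
    refine Finset.sum_congr rfl fun b _ => ?_
    congr 2
    ext x
    simp only [Finset.mem_filter, mem_sols]
    constructor
    · rintro ⟨hx, hb⟩
      have := h x (mem_sols.2 hx)
      exact ⟨⟨⟨⟨hx.1.1.1, hb⟩, hx.1.1.2⟩, ⟨⟨hx.1.2.1, this ▸ hb⟩, hx.1.2.2⟩⟩, hx.2⟩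
    · rintro ⟨⟨⟨⟨h1, h2⟩, h3⟩, ⟨⟨h4, h5⟩, h6⟩⟩, h7⟩
      exact ⟨⟨⟨⟨h1, h3⟩, ⟨h4, h6⟩⟩, h7⟩, h2⟩
  · intro x hx
    have hx' : x ∈ sols A F B F' := hx
    rw [mem_sols] at hx'
    exact hT _ hx'.1.1.1

/-- If solutions have equal keys and each key comes from at most `N` classes, then the count is
at most `N` times the sum of the counts over the classes. -/
lemma wm_le_of_key_class {ι κ β γ : Type*} [DecidableEq β] [DecidableEq γ] (A : Finset ι)
    (F : ι → G) (B : Finset κ) (F' : κ → G) (cl : ι → γ) (key : γ → β) (T : Finset γ)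
    (hT : ∀ i ∈ A, cl i ∈ T) (N : ℕ)
    (hN : ∀ b, (T.filter (fun ξ => key ξ = b)).card ≤ N)
    (h : ∀ x ∈ sols A F B F', key (cl x.1.1) = key (cl x.2.1)) :
    wm A F B F' ≤ N * ∑ ξ ∈ T, wm (A.filter (fun i => cl i = ξ)) F B F' := by
  rw [wm_eq_sum_of_key A F B F' (fun i => key (cl i)) (T.image key)
    (fun i hi => Finset.mem_image_of_mem _ (hT i hi)) h, Finset.mul_sum]
  rw [← Finset.sum_fiberwise_of_maps_to (s := T) (t := T.image key) (g := key)
    (fun ξ hξ => Finset.mem_image_of_mem _ hξ)]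
  refine Finset.sum_le_sum fun b _ => ?_
  rw [← Finset.mul_sum]
  refine (wm_le_card_mul_sum _ F B F' cl (T.filter (fun ξ => key ξ = b)) ?_).trans ?_
  · intro i hi
    rw [Finset.mem_filter] at hi ⊢
    exact ⟨hT i hi.1, hi.2⟩
  · gcongr with ξ hξ
    · exact Finset.sum_nonneg fun _ _ => wm_nonneg _ _ _ _
    · exact hN b
    · exact wm_mono _ _ (Finset.filter_subset_filter _ (Finset.filter_subset _ _)) subset_rfl

end Mean

section Coincidence
variable {G : Type*} [AddCommGroup G] [Fintype G] [DecidableEq G]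

lemma mean_nonneg {φ : AddChar G ℂ → ℝ} (h : ∀ ψ, 0 ≤ φ ψ) : 0 ≤ mean φ := by
  unfold mean
  have := Finset.sum_nonneg fun ψ (_ : ψ ∈ (univ : Finset (AddChar G ℂ))) => h ψ
  positivity

/-- Hölder's inequality between moments with a weight. -/
lemma mean_holder {g w : AddChar G ℂ → ℝ} (hg : ∀ ψ, 0 ≤ g ψ) (hw : ∀ ψ, 0 ≤ w ψ) {a b : ℕ}
    (ha : 0 < a) (hab : a ≤ b) :
    mean (fun ψ => g ψ ^ a * w ψ) ≤
      (mean w) ^ (1 - (a : ℝ) / b) * (mean fun ψ => g ψ ^ b * w ψ) ^ ((a : ℝ) / b) := by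
  have ha' : (0 : ℝ) < a := by exact_mod_cast ha
  have hab' : (a : ℝ) ≤ b := by exact_mod_cast hab
  have hp : (1 : ℝ) ≤ (b : ℝ) / a := by rwa [le_div_iff₀ ha', one_mul]
  have h := Real.inner_le_weight_mul_Lp_of_nonneg (univ : Finset (AddChar G ℂ)) hp
    (fun ψ => (Fintype.card G : ℝ)⁻¹ * w ψ) (fun ψ => g ψ ^ a)
    (fun ψ => mul_nonneg (by positivity) (hw ψ)) (fun ψ => pow_nonneg (hg ψ) _)
  rw [inv_div] at h
  have e : ∀ ψ : AddChar G ℂ, (g ψ ^ a) ^ ((b : ℝ) / a) = g ψ ^ b := by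
    intro ψ
    rw [← Real.rpow_natCast, ← Real.rpow_mul (hg ψ), mul_div_cancel₀ _ ha'.ne', Real.rpow_natCast]
  simp_rw [e, mul_assoc, ← Finset.mul_sum] at h
  unfold mean
  simpa only [mul_comm (w _)] using h

/-- The number of solutions with coinciding first variables is controlled by a lower moment. -/
lemma card_coincidence_le {ι κ : Type*} [DecidableEq ι] {r : ℕ} (I : Finset ι) (F : ι → G)
    (B : Finset κ) (F' : κ → G) {i l : Fin r} (hil : i ≠ l) :
    (((sols (Fintype.piFinset fun _ : Fin r => I) (fun z => ∑ i, F (z i)) B F').filter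
      (fun x => x.1.1 i = x.1.1 l)).card : ℝ) ≤
      I.card * mean (fun ψ => ‖esum I F ψ‖ ^ (2 * r - 2) * ‖esum B F' ψ‖ ^ 2) := by
  set A := Fintype.piFinset fun _ : Fin r => I with hA
  set S : (Fin r → ι) → G := fun z => ∑ i, F (z i) with hS
  set A' := A.filter (fun z => z i = z l) with hA'
  have hcard : ((sols A S B F').filter (fun x => x.1.1 i = x.1.1 l)).card =
      (((A' ×ˢ B) ×ˢ (A ×ˢ B)).filter
        (fun x => S x.1.1 + F' x.1.2 = S x.2.1 + F' x.2.2)).card := by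
    congr 1
    ext x
    simp only [Finset.mem_filter, mem_sols, Finset.mem_product, hA']
    tauto
  have h := sum_esum_mul_conj (A' ×ˢ B) (A ×ˢ B) (fun x => S x.1 + F' x.2)
    (fun x => S x.1 + F' x.2)
  have hG : (0 : ℝ) < Fintype.card G := by exact_mod_cast Fintype.card_pos
  have hbound : ∀ ψ : AddChar G ℂ, ‖esum A' S ψ‖ ≤ I.card * ‖esum I F ψ‖ ^ (r - 2) := by
    intro ψ
    rw [esum_fiberwise A' S (fun z => z i) I
      (fun z hz => by
        rw [hA', Finset.mem_filter, hA, Fintype.mem_piFinset] at hz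
        exact hz.1 i)]
    refine (norm_sum_le _ _).trans ?_
    rw [← nsmul_eq_mul]
    refine Finset.sum_le_card_nsmul _ _ _ fun x hx => ?_
    have hset : A'.filter (fun z => z i = x) =
        Fintype.piFinset (fun m : Fin r => if m = i ∨ m = l then {x} else I) := by
      ext z
      simp only [hA', hA, Finset.mem_filter, Fintype.mem_piFinset]
      constructor
      · rintro ⟨⟨h1, h2⟩, h3⟩ m
        split_ifs with hm
        · rcases hm with rfl | rfl
          · simp [h3]
          · simp [← h2, h3]
        · exact h1 m
      · intro h1
        have hi := h1 i
        have hl := h1 l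
        simp only [true_or, or_true, if_true, Finset.mem_singleton] at hi hl
        refine ⟨⟨fun m => ?_, by rw [hi, hl]⟩, hi⟩
        have := h1 m
        split_ifs at this with hm
        · rw [Finset.mem_singleton] at this; rwa [this]
        · exact this
    rw [hset, ← prod_esum, norm_prod]
    have hle : ∀ m ∈ (univ : Finset (Fin r)),
        ‖esum (if m = i ∨ m = l then {x} else I) F ψ‖ ≤
          if m = i ∨ m = l then 1 else ‖esum I F ψ‖ := by
      intro m _
      split_ifs
      · simpa using norm_esum_le {x} F ψ
      · exact le_rfl
    refine (Finset.prod_le_prod (fun m _ => norm_nonneg _) hle).trans ?_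
    rw [Finset.prod_ite]
    simp only [Finset.prod_const_one, one_mul, Finset.prod_const]
    apply le_of_eq
    congr 1
    have : (univ.filter (fun m : Fin r => ¬(m = i ∨ m = l))) = univ \ {i, l} := by
      ext m; simp
    rw [this, Finset.card_sdiff_of_subset (Finset.subset_univ _), Finset.card_pair hil]
    simp
  rw [hcard]
  have hr : 2 ≤ r := by
    have h1 := i.2
    have h2 := l.2
    have h3 : (i : ℕ) ≠ l := fun h => hil (Fin.ext h)
    omega
  have h' : (Fintype.card G : ℝ) * (((A' ×ˢ B) ×ˢ (A ×ˢ B)).filter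
        (fun x => S x.1.1 + F' x.1.2 = S x.2.1 + F' x.2.2)).card ≤
      ∑ ψ : AddChar G ℂ, I.card * (‖esum I F ψ‖ ^ (2 * r - 2) * ‖esum B F' ψ‖ ^ 2) := by
    have e : (Fintype.card G : ℝ) * (((A' ×ˢ B) ×ˢ (A ×ˢ B)).filter
        (fun x => S x.1.1 + F' x.1.2 = S x.2.1 + F' x.2.2)).card =
        ‖∑ ψ : AddChar G ℂ, esum (A' ×ˢ B) (fun x => S x.1 + F' x.2) ψ *
          (starRingEnd ℂ) (esum (A ×ˢ B) (fun x => S x.1 + F' x.2) ψ)‖ := by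
      rw [h, norm_mul, Complex.norm_natCast, Complex.norm_natCast]
    rw [e]
    refine (norm_sum_le _ _).trans (Finset.sum_le_sum fun ψ _ => ?_)
    rw [← esum_mul, ← esum_mul, norm_mul, RCLike.norm_conj, norm_mul, norm_mul, ← esum_pow, norm_pow]
    calc ‖esum A' S ψ‖ * ‖esum B F' ψ‖ * (‖esum I F ψ‖ ^ r * ‖esum B F' ψ‖)
        ≤ (I.card * ‖esum I F ψ‖ ^ (r - 2)) * ‖esum B F' ψ‖ *
          (‖esum I F ψ‖ ^ r * ‖esum B F' ψ‖) := by gcongr; exact hbound ψ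
      _ = _ := by
        rw [show 2 * r - 2 = (r - 2) + r by omega, pow_add]; ring
  rw [← Finset.mul_sum] at h'
  unfold mean
  calc _ = (Fintype.card G : ℝ)⁻¹ * ((Fintype.card G : ℝ) * (((A' ×ˢ B) ×ˢ (A ×ˢ B)).filter
        (fun x => S x.1.1 + F' x.1.2 = S x.2.1 + F' x.2.2)).card) := by
        field_simp
    _ ≤ _ := by
        rw [mul_left_comm (I.card : ℝ)]
        exact mul_le_mul_of_nonneg_left h' (by positivity)

/-- Either the injective tuples dominate or there is a trivial estimate. -/
lemma wm_le_injective_or {ι κ : Type*} [DecidableEq ι] [DecidableEq κ] {r : ℕ} (hr : 0 < r) (I : Finset ι)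
    (F : ι → G) (B : Finset κ) (F' : κ → G) :
    wm (Fintype.piFinset fun _ : Fin r => I) (fun z => ∑ i, F (z i)) B F' ≤
      max (2 * wm ((Fintype.piFinset fun _ : Fin r => I).filter Function.Injective)
        (fun z => ∑ i, F (z i)) B F')
        ((4 * r ^ 2 * I.card : ℝ) ^ r * mean (fun ψ => ‖esum B F' ψ‖ ^ 2)) := by
  set A := Fintype.piFinset fun _ : Fin r => I with hA
  set S : (Fin r → ι) → G := fun z => ∑ i, F (z i) with hS
  set A₁ := A.filter Function.Injective with hA₁
  set M := mean (fun ψ => ‖esum I F ψ‖ ^ (2 * r - 2) * ‖esum B F' ψ‖ ^ 2) with hM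
  set J := mean (fun ψ => ‖esum B F' ψ‖ ^ 2) with hJ
  have hM0 : 0 ≤ M := mean_nonneg fun ψ => by positivity
  have hJ0 : 0 ≤ J := mean_nonneg fun ψ => by positivity
  have hT0 : 0 ≤ wm A S B F' := wm_nonneg _ _ _ _
  have hT : wm A S B F' = mean (fun ψ => ‖esum I F ψ‖ ^ (2 * r) * ‖esum B F' ψ‖ ^ 2) := by
    unfold wm
    congr 1
    ext ψ
    rw [hA, hS, ← esum_pow, norm_pow, ← pow_mul, mul_comm r 2]
  have key : wm A S B F' ≤ wm A₁ S B F' + 2 * r ^ 2 * I.card * M := by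
    set U := (univ : Finset (Fin r × Fin r)).filter (fun q => q.1 ≠ q.2) with hU
    have hUc : (U.card : ℝ) ≤ (r : ℝ) ^ 2 := by
      have : U.card ≤ r * r := by
        refine (Finset.card_le_univ _).trans ?_
        simp
      rw [sq]; exact_mod_cast this
    have hsub : sols A S B F' ⊆ sols A₁ S B F' ∪
        (U.biUnion (fun q => (sols A S B F').filter (fun x => x.1.1 q.1 = x.1.1 q.2)) ∪
         U.biUnion (fun q => (sols A S B F').filter (fun x => x.2.1 q.1 = x.2.1 q.2))) := by
      intro x hx
      by_cases h1 : Function.Injective x.1.1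
      · by_cases h2 : Function.Injective x.2.1
        · apply Finset.mem_union_left
          rw [mem_sols] at hx ⊢
          simp only [hA₁, Finset.mem_filter]
          tauto
        · apply Finset.mem_union_right
          apply Finset.mem_union_right
          rw [Function.Injective] at h2
          push Not at h2
          obtain ⟨a, b, hab, hne⟩ := h2
          simp only [Finset.mem_biUnion, Finset.mem_filter]
          exact ⟨(a, b), by simpa [hU] using hne, hx, hab⟩
      · apply Finset.mem_union_right
        apply Finset.mem_union_left
        rw [Function.Injective] at h1
        push Not at h1
        obtain ⟨a, b, hab, hne⟩ := h1
        simp only [Finset.mem_biUnion, Finset.mem_filter]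
        exact ⟨(a, b), by simpa [hU] using hne, hx, hab⟩
    have hb1 : ∀ q ∈ U, (((sols A S B F').filter (fun x => x.1.1 q.1 = x.1.1 q.2)).card : ℝ) ≤
        I.card * M := fun q hq => card_coincidence_le I F B F' (by simpa [hU] using hq)
    have hb2 : ∀ q ∈ U, (((sols A S B F').filter (fun x => x.2.1 q.1 = x.2.1 q.2)).card : ℝ) ≤
        I.card * M := by
      intro q hq
      refine le_trans (le_of_eq ?_) (hb1 q hq)
      norm_cast
      refine Finset.card_bij (fun x _ => (x.2, x.1)) ?_ ?_ ?_
      · intro x hx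
        simp only [Finset.mem_filter, mem_sols] at hx ⊢
        exact ⟨⟨⟨hx.1.1.2, hx.1.1.1⟩, hx.1.2.symm⟩, hx.2⟩
      · rintro ⟨x, y⟩ _ ⟨x', y'⟩ _ h
        simp only [Prod.mk.injEq] at h ⊢
        exact ⟨h.2, h.1⟩
      · rintro ⟨x, y⟩ hx
        refine ⟨(y, x), ?_, rfl⟩
        simp only [Finset.mem_filter, mem_sols] at hx ⊢
        exact ⟨⟨⟨hx.1.1.2, hx.1.1.1⟩, hx.1.2.symm⟩, hx.2⟩
    have hc := Finset.card_le_card hsub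
    have hc1 := (hc.trans (Finset.card_union_le _ _)).trans
      (Nat.add_le_add_left (Finset.card_union_le _ _) _)
    have hc2 := hc1.trans (Nat.add_le_add_left
      (Nat.add_le_add Finset.card_biUnion_le Finset.card_biUnion_le) _)
    have hs1 := (Finset.sum_le_sum hb1)
    have hs2 := (Finset.sum_le_sum hb2)
    rw [Finset.sum_const, nsmul_eq_mul] at hs1 hs2
    rw [wm_eq_card, wm_eq_card]
    have hc3 : ((sols A S B F').card : ℝ) ≤ (sols A₁ S B F').card +
      (∑ q ∈ U, (((sols A S B F').filter (fun x => x.1.1 q.1 = x.1.1 q.2)).card : ℝ) +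
       ∑ q ∈ U, (((sols A S B F').filter (fun x => x.2.1 q.1 = x.2.1 q.2)).card : ℝ)) := by
      exact_mod_cast hc2
    have h3 : (U.card : ℝ) * (I.card * M) ≤ r ^ 2 * (I.card * M) := by gcongr
    nlinarith
  by_cases hle : wm A S B F' ≤ 2 * wm A₁ S B F'
  · exact le_max_of_le_left hle
  apply le_max_of_le_right
  push Not at hle
  have h2 : wm A S B F' ≤ 4 * r ^ 2 * I.card * M := by linarith
  rcases Nat.lt_or_ge 1 r with hr1 | hr1
  · have hH := mean_holder (g := fun ψ => ‖esum I F ψ‖) (w := fun ψ => ‖esum B F' ψ‖ ^ 2)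
      (fun ψ => norm_nonneg _) (fun ψ => by positivity) (a := 2 * r - 2) (b := 2 * r)
      (by omega) (by omega)
    rw [← hT] at hH
    have hr' : (0 : ℝ) < r := by exact_mod_cast hr
    have e1 : ((2 * r - 2 : ℕ) : ℝ) / ((2 * r : ℕ) : ℝ) = 1 - 1 / r := by
      rw [Nat.cast_sub (by omega)]; push_cast; field_simp
    rw [e1, ← hJ, ← hM] at hH
    set T := wm A S B F' with hTdef
    rcases hT0.eq_or_lt with h0 | hpos
    · rw [← h0]; positivity
    have e2 : (1 : ℝ) - (1 - 1 / r) = 1 / r := by ring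
    rw [e2] at hH
    have h4 : T ≤ 4 * r ^ 2 * I.card * (J ^ (1 / (r : ℝ)) * T ^ (1 - 1 / (r : ℝ))) :=
      h2.trans (by gcongr)
    have h5 : T ^ (1 / (r : ℝ)) ≤ 4 * r ^ 2 * I.card * J ^ (1 / (r : ℝ)) := by
      have e3 : T = T ^ (1 / (r : ℝ)) * T ^ (1 - 1 / (r : ℝ)) := by
        rw [← Real.rpow_add hpos]; simp
      have hp : 0 < T ^ (1 - 1 / (r : ℝ)) := Real.rpow_pos_of_pos hpos _
      refine le_of_mul_le_mul_right ?_ hp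
      rw [← e3]
      linarith [h4]
    have h6 := pow_le_pow_left₀ (by positivity) h5 r
    rw [mul_pow, ← Real.rpow_natCast (T ^ _), ← Real.rpow_natCast (J ^ _), ← Real.rpow_mul hT0,
      ← Real.rpow_mul hJ0, one_div, inv_mul_cancel₀ hr'.ne', Real.rpow_one, Real.rpow_one] at h6
    exact h6
  · have hr1' : r = 1 := by omega
    exfalso
    subst hr1'
    have : A₁ = A := by
      rw [hA₁, Finset.filter_true_of_mem]
      intro z _
      exact Function.injective_of_subsingleton z
    rw [this] at hle
    linarith

end Coincidence

section Step
variable {G : Type*} [AddCommGroup G] [Fintype G] [DecidableEq G]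

/-- Sums over `r`-tuples. -/
def tsum {ι : Type*} (r : ℕ) (F : ι → G) (z : Fin r → ι) : G := ∑ i, F (z i)

/-- The box of `r`-tuples with entries in `I`. -/
abbrev box {ι : Type*} (r : ℕ) (I : Finset ι) : Finset (Fin r → ι) :=
  Fintype.piFinset fun _ : Fin r => I

lemma norm_esum_box {ι : Type*} (r : ℕ) (I : Finset ι) (F : ι → G) (ψ : AddChar G ℂ) :
    ‖esum (box r I) (tsum r F) ψ‖ = ‖esum I F ψ‖ ^ r := by
  rw [← norm_pow, esum_pow]; rfl

/-- The mean value of `|D|^{2r} |f|^{2s}`. -/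
noncomputable def mv {ι κ : Type*} (r : ℕ) (I : Finset ι) (F : ι → G) (s : ℕ) (S : Finset κ)
    (v : κ → G) : ℝ := wm (box r I) (tsum r F) (box s S) (tsum s v)

/-- The mean value of `|f|^{2s}`. -/
noncomputable def mv₁ {κ : Type*} (s : ℕ) (S : Finset κ) (v : κ → G) : ℝ :=
  mean fun ψ => ‖esum S v ψ‖ ^ (2 * s)

lemma mv₁_nonneg {κ : Type*} (s : ℕ) (S : Finset κ) (v : κ → G) : 0 ≤ mv₁ s S v :=
  mean_nonneg fun _ => by positivity

lemma mv₁_eq {κ : Type*} (s : ℕ) (S : Finset κ) (v : κ → G) :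
    mv₁ s S v = mean fun ψ => ‖esum (box s S) (tsum s v) ψ‖ ^ 2 := by
  unfold mv₁
  congr 1; ext ψ
  rw [norm_esum_box, ← pow_mul, mul_comm]

lemma mv_eq {ι κ : Type*} (r : ℕ) (I : Finset ι) (F : ι → G) (s : ℕ) (S : Finset κ)
    (v : κ → G) :
    mv r I F s S v = mean fun ψ => ‖esum I F ψ‖ ^ (2 * r) * ‖esum (box s S) (tsum s v) ψ‖ ^ 2 := by
  unfold mv wm
  congr 1; ext ψ
  rw [norm_esum_box, ← pow_mul, mul_comm r]

lemma mv_le_trivial {ι κ : Type*} (r : ℕ) (I : Finset ι) (F : ι → G) (s : ℕ) (S : Finset κ)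
    (v : κ → G) : mv r I F s S v ≤ (I.card : ℝ) ^ (2 * r) * mv₁ s S v := by
  rw [mv_eq, mv₁_eq, ← mean_const_mul]
  apply mean_mono
  intro ψ
  gcongr
  exact norm_esum_le _ _ _

lemma wm_le_sum_classes {ι κ γ : Type*} [DecidableEq γ] (A : Finset ι) (F : ι → G) {s : ℕ}
    (hs : 0 < s) (S : Finset κ) (v : κ → G) (cl : κ → γ) (T : Finset γ)
    (hT : ∀ y ∈ S, cl y ∈ T) :
    wm A F (box s S) (tsum s v) ≤ (T.card : ℝ) ^ (2 * s - 1) *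
      ∑ η ∈ T, wm A F (box s (S.filter (fun y => cl y = η))) (tsum s v) := by
  unfold wm
  rw [← mean_sum, ← mean_const_mul]
  apply mean_mono
  intro ψ
  simp_rw [norm_esum_box]
  rw [← Finset.mul_sum, mul_left_comm]
  gcongr
  simp_rw [← pow_mul]
  have h1 : ‖esum S v ψ‖ ≤ ∑ η ∈ T, ‖esum (S.filter (fun y => cl y = η)) v ψ‖ := by
    rw [esum_fiberwise S v cl T hT]
    exact norm_sum_le _ _
  have h2 := pow_sum_le_card_mul_sum_pow (s := T)
    (f := fun η => ‖esum (S.filter (fun y => cl y = η)) v ψ‖) (fun _ _ => norm_nonneg _)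
    (2 * s - 1)
  rw [show 2 * s - 1 + 1 = s * 2 by omega] at h2
  exact (pow_le_pow_left₀ (norm_nonneg _) h1 _).trans h2

lemma sum_wm_residue_le {κ : Type*} {m : ℕ} [NeZero m] {r : ℕ} (I : Finset ℤ) (F : ℤ → G)
    (B : Finset κ) (F' : κ → G) (A : Finset (Fin r → ℤ)) (hA : A ⊆ box r I)
    (T : Finset (Fin r → ZMod m)) :
    ∑ ξ ∈ T, wm (A.filter (fun z => (fun i => (z i : ZMod m)) = ξ)) (tsum r F) B F' ≤
      mean fun ψ => (∑ ξ : ZMod m, ‖esum (I.filter (fun z : ℤ => (z : ZMod m) = ξ)) F ψ‖ ^ 2) ^ r *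
        ‖esum B F' ψ‖ ^ 2 := by
  refine (Finset.sum_le_sum_of_subset_of_nonneg (Finset.subset_univ T)
    (fun _ _ _ => wm_nonneg _ _ _ _)).trans ?_
  have h : ∀ ξ ∈ (univ : Finset (Fin r → ZMod m)),
      wm (A.filter (fun z => (fun i => (z i : ZMod m)) = ξ)) (tsum r F) B F' ≤
      wm (Fintype.piFinset fun i => I.filter (fun z : ℤ => (z : ZMod m) = ξ i)) (tsum r F) B F' := by
    intro ξ _
    apply wm_mono _ _ _ subset_rfl
    intro z hz
    rw [Finset.mem_filter] at hz
    rw [Fintype.mem_piFinset]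
    intro i
    rw [Finset.mem_filter]
    exact ⟨Fintype.mem_piFinset.1 (hA hz.1) i, congrFun hz.2 i⟩
  refine (Finset.sum_le_sum h).trans (le_of_eq ?_)
  unfold wm
  rw [← mean_sum]
  congr 1; ext ψ
  rw [← Finset.sum_mul]
  congr 1
  rw [Finset.sum_pow', Fintype.piFinset_univ]
  refine Finset.sum_congr rfl fun ξ _ => ?_
  have := prod_esum (fun i => I.filter (fun z : ℤ => (z : ZMod m) = ξ i)) F ψ
  unfold tsum
  rw [← this, norm_prod, Finset.prod_pow]

/-- Nonzero shifts divisible by `m`. -/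
noncomputable def shifts (X m : ℕ) : Finset ℤ :=
  (Finset.Icc (-(X : ℤ)) X).filter (fun h => h ≠ 0 ∧ (m : ℤ) ∣ h)

lemma card_shifts_le {X m : ℕ} (hm : 0 < m) : ((shifts X m).card : ℝ) ≤ 2 * X / m := by
  have hsub : shifts X m ⊆ ((Finset.Icc (-((X / m : ℕ) : ℤ)) ((X / m : ℕ) : ℤ)).erase 0).image
      (fun t : ℤ => (m : ℤ) * t) := by
    intro h hh
    simp only [shifts, Finset.mem_filter, Finset.mem_Icc] at hh
    obtain ⟨⟨h1, h2⟩, h3, t, rfl⟩ := hh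
    rw [Finset.mem_image]
    refine ⟨t, ?_, rfl⟩
    rw [Finset.mem_erase, Finset.mem_Icc]
    have hm' : (0 : ℤ) < m := by exact_mod_cast hm
    refine ⟨by rintro rfl; simp at h3, ?_, ?_⟩
    · have : -t ≤ (X : ℤ) / m := by
        rw [Int.le_ediv_iff_mul_le hm']; linarith
      push_cast; linarith
    · push_cast
      rw [Int.le_ediv_iff_mul_le hm']; linarith
  have hc := (Finset.card_le_card hsub).trans Finset.card_image_le
  have : ((Finset.Icc (-((X / m : ℕ) : ℤ)) ((X / m : ℕ) : ℤ)).erase 0).card = 2 * (X / m) := by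
    rw [Finset.card_erase_of_mem (by generalize X / m = n; simp), Int.card_Icc]
    omega
  rw [this] at hc
  calc ((shifts X m).card : ℝ) ≤ ((2 * (X / m) : ℕ) : ℝ) := by exact_mod_cast hc
    _ ≤ 2 * X / m := by
      push_cast
      rw [mul_div_assoc]
      exact mul_le_mul_of_nonneg_left Nat.cast_div_le (by norm_num)

/-- The difference of a function. -/
def dif (h : ℤ) (F : ℤ → G) (z : ℤ) : G := F (z + h) - F z

lemma sum_residue_sq_le {X m : ℕ} [NeZero m] (I : Finset ℤ) (hI : I ⊆ Finset.Icc 1 (X : ℤ))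
    (F : ℤ → G) (ψ : AddChar G ℂ) :
    ∑ ξ : ZMod m, ‖esum (I.filter (fun z : ℤ => (z : ZMod m) = ξ)) F ψ‖ ^ 2 ≤
      I.card + ∑ h ∈ shifts X m, ‖esum (I.filter (fun z => z + h ∈ I)) (dif h F) ψ‖ := by
  set Q := (I ×ˢ I).filter (fun x => (x.1 : ZMod m) = x.2) with hQ
  have e1 : ((∑ ξ : ZMod m, ‖esum (I.filter (fun z : ℤ => (z : ZMod m) = ξ)) F ψ‖ ^ 2 : ℝ) : ℂ) =
      ∑ x ∈ Q, ψ (F x.1 - F x.2) := by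
    rw [hQ, Finset.sum_filter, Finset.sum_product]
    push_cast
    have : ∀ ξ : ZMod m, ((‖esum (I.filter (fun z : ℤ => (z : ZMod m) = ξ)) F ψ‖ : ℂ)) ^ 2 =
        ∑ z ∈ I, ∑ w ∈ I, if (z : ZMod m) = ξ ∧ (w : ZMod m) = ξ then ψ (F z - F w) else 0 := by
      intro ξ
      rw [← Complex.ofReal_pow, ← Complex.normSq_eq_norm_sq, ← Complex.mul_conj]
      unfold esum
      rw [map_sum, Finset.sum_mul_sum, Finset.sum_filter]
      refine Finset.sum_congr rfl fun z _ => ?_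
      rw [Finset.sum_filter]
      split_ifs with hz
      · refine Finset.sum_congr rfl fun w _ => ?_
        simp only [hz, true_and]
        split_ifs
        · rw [AddChar.map_sub_eq_div, div_eq_mul_inv, ← AddChar.inv_apply_eq_conj]
        · rfl
      · simp [hz]
    simp_rw [this]
    rw [Finset.sum_comm]
    refine Finset.sum_congr rfl fun z _ => ?_
    rw [Finset.sum_comm]
    refine Finset.sum_congr rfl fun w _ => ?_
    by_cases hzw : (z : ZMod m) = w
    · rw [if_pos hzw, Finset.sum_eq_single (z : ZMod m)]
      · simp [hzw]
      · intro b _ hb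
        rw [if_neg]
        rintro ⟨h1, _⟩
        exact hb h1.symm
      · simp
    · rw [if_neg hzw]
      refine Finset.sum_eq_zero fun ξ _ => ?_
      rw [if_neg]
      rintro ⟨h1, h2⟩
      exact hzw (h1.trans h2.symm)
  have e2 : ∑ x ∈ Q, ψ (F x.1 - F x.2) =
      ∑ h ∈ insert 0 (shifts X m), ∑ x ∈ Q.filter (fun x => x.1 - x.2 = h), ψ (F x.1 - F x.2) := by
    rw [Finset.sum_fiberwise_of_maps_to]
    intro x hx
    simp only [hQ, Finset.mem_filter, Finset.mem_product] at hx
    have h1 := Finset.mem_Icc.1 (hI hx.1.1)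
    have h2 := Finset.mem_Icc.1 (hI hx.1.2)
    by_cases h0 : x.1 - x.2 = 0
    · rw [h0]; exact Finset.mem_insert_self _ _
    · apply Finset.mem_insert_of_mem
      simp only [shifts, Finset.mem_filter, Finset.mem_Icc]
      refine ⟨⟨by linarith, by linarith⟩, h0, ?_⟩
      rw [← ZMod.intCast_zmod_eq_zero_iff_dvd]
      push_cast
      rw [hx.2, sub_self]
  have e3 : ∀ h ∈ shifts X m, ∑ x ∈ Q.filter (fun x => x.1 - x.2 = h), ψ (F x.1 - F x.2) =
      esum (I.filter (fun z => z + h ∈ I)) (dif h F) ψ := by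
    intro h hh
    unfold esum dif
    refine Finset.sum_bij' (fun x _ => x.2) (fun z _ => (z + h, z)) ?_ ?_ ?_ ?_ ?_
    · intro x hx
      simp only [hQ, Finset.mem_filter, Finset.mem_product] at hx ⊢
      refine ⟨hx.1.1.2, ?_⟩
      rw [← hx.2, add_sub_cancel]
      exact hx.1.1.1
    · intro z hz
      simp only [hQ, Finset.mem_filter, Finset.mem_product] at hz ⊢
      refine ⟨⟨⟨hz.2, hz.1⟩, ?_⟩, by ring⟩
      simp only [shifts, Finset.mem_filter] at hh
      have := (ZMod.intCast_zmod_eq_zero_iff_dvd h m).2 hh.2.2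
      push_cast
      rw [this, add_zero]
    · intro x hx
      simp only [Finset.mem_filter] at hx
      rw [← hx.2, add_sub_cancel]
    · intro z hz; rfl
    · intro x hx
      simp only [Finset.mem_filter] at hx
      rw [← hx.2, add_sub_cancel]
  have e4 : ∑ x ∈ Q.filter (fun x => x.1 - x.2 = 0), ψ (F x.1 - F x.2) = (I.card : ℂ) := by
    rw [Finset.card_eq_sum_ones]
    push_cast
    refine Finset.sum_bij' (fun x _ => x.2) (fun z _ => (z, z)) ?_ ?_ ?_ ?_ ?_
    · intro x hx
      simp only [hQ, Finset.mem_filter, Finset.mem_product] at hx ⊢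
      exact hx.1.1.2
    · intro z hz
      simp only [hQ, Finset.mem_filter, Finset.mem_product]
      simpa using hz
    · intro x hx
      simp only [Finset.mem_filter, sub_eq_zero] at hx
      exact Prod.ext hx.2.symm rfl
    · intro z hz; rfl
    · intro x hx
      simp only [Finset.mem_filter, sub_eq_zero] at hx
      rw [hx.2]; simp
  have h0 : (0 : ℤ) ∉ shifts X m := by simp [shifts]
  rw [e2, Finset.sum_insert h0, e4, Finset.sum_congr rfl e3] at e1
  have e5 := congrArg norm e1
  rw [Complex.norm_real, Real.norm_of_nonneg (by positivity)] at e5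
  rw [e5]
  refine (norm_add_le _ _).trans ?_
  rw [Complex.norm_natCast]
  gcongr
  exact norm_sum_le _ _

end Step

section Step
variable {G : Type*} [AddCommGroup G] [Fintype G] [DecidableEq G]

lemma mean_add (φ φ' : AddChar G ℂ → ℝ) : mean (fun ψ => φ ψ + φ' ψ) = mean φ + mean φ' := by
  unfold mean
  rw [Finset.sum_add_distrib, mul_add]

lemma mean_sum_pow_le {β : Type*} (H : Finset β) (g : β → AddChar G ℂ → ℝ) {w : AddChar G ℂ → ℝ}
    (hg : ∀ h ψ, 0 ≤ g h ψ) (hw : ∀ ψ, 0 ≤ w ψ) {a b : ℕ} (ha : 0 < a) (hab : a ≤ b) {W U : ℝ}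
    (hU : 0 ≤ U) (hW : mean w ≤ W) (hD : ∀ h ∈ H, mean (fun ψ => g h ψ ^ b * w ψ) ≤ W * U) :
    mean (fun ψ => (∑ h ∈ H, g h ψ) ^ a * w ψ) ≤
      (H.card : ℝ) ^ a * (W * U ^ ((a : ℝ) / b)) := by
  have hW0 : 0 ≤ W := (mean_nonneg hw).trans hW
  have ha' : (0 : ℝ) < a := by exact_mod_cast ha
  have hb' : (0 : ℝ) < b := by exact_mod_cast (ha.trans_le hab)
  have hab' : (a : ℝ) ≤ b := by exact_mod_cast hab
  have hθ : 0 ≤ 1 - (a : ℝ) / b := by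
    rw [sub_nonneg, div_le_one hb']; exact hab'
  obtain ⟨a', rfl⟩ : ∃ a', a = a' + 1 := ⟨a - 1, by omega⟩
  have key : ∀ h ∈ H, mean (fun ψ => g h ψ ^ (a' + 1) * w ψ) ≤
      W * U ^ (((a' + 1 : ℕ) : ℝ) / b) := by
    intro h hh
    refine (mean_holder (hg h) hw ha hab).trans ?_
    calc _ ≤ W ^ (1 - ((a' + 1 : ℕ) : ℝ) / b) * (W * U) ^ (((a' + 1 : ℕ) : ℝ) / b) := by
          have h0 : 0 ≤ mean w := mean_nonneg hw
          have h1 : 0 ≤ mean (fun ψ => g h ψ ^ b * w ψ) :=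
            mean_nonneg fun ψ => mul_nonneg (pow_nonneg (hg h ψ) _) (hw ψ)
          gcongr
          exact hD h hh
      _ = W * U ^ (((a' + 1 : ℕ) : ℝ) / b) := by
          rw [Real.mul_rpow hW0 hU, ← mul_assoc, ← Real.rpow_add' hW0 (by simp)]
          simp
  calc mean (fun ψ => (∑ h ∈ H, g h ψ) ^ (a' + 1) * w ψ)
      ≤ mean (fun ψ => (H.card : ℝ) ^ a' * ∑ h ∈ H, g h ψ ^ (a' + 1) * w ψ) := by
        apply mean_mono
        intro ψ
        rw [← Finset.sum_mul, ← mul_assoc]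
        exact mul_le_mul_of_nonneg_right
          (pow_sum_le_card_mul_sum_pow (fun h _ => hg h ψ) a') (hw ψ)
    _ = (H.card : ℝ) ^ a' * ∑ h ∈ H, mean (fun ψ => g h ψ ^ (a' + 1) * w ψ) := by
        rw [mean_const_mul, mean_sum]
    _ ≤ (H.card : ℝ) ^ a' * ∑ h ∈ H, W * U ^ (((a' + 1 : ℕ) : ℝ) / b) := by
        gcongr with h hh
        exact key h hh
    _ = _ := by
        rw [Finset.sum_const, nsmul_eq_mul]; ring

/-- The differencing step for a single modulus. -/
lemma wm_le_of_modulus {κ γ β : Type*} [DecidableEq γ] [DecidableEq β] {X m r r' s : ℕ} [NeZero m]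
    (I : Finset ℤ) (hI : I ⊆ Finset.Icc 1 (X : ℤ)) (F : ℤ → G) (S : Finset κ) (v : κ → G)
    (A : Finset (Fin r → ℤ)) (hA : A ⊆ box r I) (hr : 0 < r) (hr' : r ≤ 2 * r') (hs : 0 < s)
    (cl : κ → γ) (Tη : Finset γ) (hTη : ∀ y ∈ S, cl y ∈ Tη)
    (T : γ → Finset (Fin r → ZMod m)) (key : γ → (Fin r → ZMod m) → β) (N : ℕ)
    (hcl : ∀ η ∈ Tη, ∀ z ∈ A, (fun i => (z i : ZMod m)) ∈ T η)
    (hN : ∀ η ∈ Tη, ∀ b, ((T η).filter (fun ξ => key η ξ = b)).card ≤ N)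
    (hkey : ∀ η ∈ Tη, ∀ x ∈ sols A (tsum r F) (box s (S.filter (fun y => cl y = η))) (tsum s v),
      key η (fun i => (x.1.1 i : ZMod m)) = key η (fun i => (x.2.1 i : ZMod m)))
    {W U : ℝ} (hU : 0 ≤ U)
    (hJ : ∀ η ∈ Tη, mv₁ s (S.filter (fun y => cl y = η)) v ≤ W)
    (hD : ∀ η ∈ Tη, ∀ h ∈ shifts X m,
      mv r' (I.filter (fun z => z + h ∈ I)) (dif h F) s (S.filter (fun y => cl y = η)) v ≤ W * U) :
    wm A (tsum r F) (box s S) (tsum s v) ≤ (Tη.card : ℝ) ^ (2 * s) * (N * (2 ^ (r - 1) * (W *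
      ((X : ℝ) ^ r + (2 * X / m) ^ r * U ^ ((r : ℝ) / (2 * r' : ℕ)))))) := by
  have hIc : (I.card : ℝ) ≤ X := by
    have := Finset.card_le_card hI
    rw [Int.card_Icc] at this
    simp only [add_sub_cancel_right, Int.toNat_natCast] at this
    exact_mod_cast this
  have one : ∀ η ∈ Tη, wm A (tsum r F) (box s (S.filter (fun y => cl y = η))) (tsum s v) ≤
      N * (2 ^ (r - 1) * (W *
      ((X : ℝ) ^ r + (2 * X / m) ^ r * U ^ ((r : ℝ) / (2 * r' : ℕ))))) := by
    intro η hη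
    set B := box s (S.filter (fun y => cl y = η)) with hB
    set w : AddChar G ℂ → ℝ := fun ψ => ‖esum B (tsum s v) ψ‖ ^ 2 with hw
    have hw0 : ∀ ψ, 0 ≤ w ψ := fun ψ => by positivity
    have hwW : mean w ≤ W := by
      rw [hw, hB, ← mv₁_eq]; exact hJ η hη
    have hW0 : 0 ≤ W := (mean_nonneg hw0).trans hwW
    refine (wm_le_of_key_class A (tsum r F) B (tsum s v) (fun z i => (z i : ZMod m)) (key η) (T η)
      (hcl η hη) N (hN η hη) (hkey η hη)).trans ?_
    apply mul_le_mul_of_nonneg_left _ (Nat.cast_nonneg N)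
    refine (sum_wm_residue_le I F B (tsum s v) A hA (T η)).trans ?_
    set g : ℤ → AddChar G ℂ → ℝ := fun h ψ => ‖esum (I.filter (fun z => z + h ∈ I)) (dif h F) ψ‖
      with hg
    have hg0 : ∀ h ψ, 0 ≤ g h ψ := fun h ψ => norm_nonneg _
    have hmean := mean_sum_pow_le (shifts X m) g (w := w) hg0 hw0 hr hr' hU hwW (by
      intro h hh
      have := hD η hη h hh
      rw [mv_eq] at this
      exact this)
    calc _ ≤ mean (fun ψ => 2 ^ (r - 1) * ((X : ℝ) ^ r * w ψ +
          (∑ h ∈ shifts X m, g h ψ) ^ r * w ψ)) := by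
          apply mean_mono
          intro ψ
          rw [← add_mul, ← mul_assoc]
          refine mul_le_mul_of_nonneg_right ?_ (hw0 ψ)
          have hs0 : 0 ≤ ∑ h ∈ shifts X m, g h ψ := Finset.sum_nonneg fun h _ => hg0 h ψ
          refine le_trans (pow_le_pow_left₀ (Finset.sum_nonneg fun _ _ => by positivity)
            ((sum_residue_sq_le I hI F ψ).trans (add_le_add_left hIc _)) r) ?_
          exact add_pow_le (Nat.cast_nonneg X) hs0 r
      _ = 2 ^ (r - 1) * ((X : ℝ) ^ r * mean w +
          mean fun ψ => (∑ h ∈ shifts X m, g h ψ) ^ r * w ψ) := by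
          rw [mean_const_mul, mean_add, mean_const_mul]
      _ ≤ 2 ^ (r - 1) * ((X : ℝ) ^ r * W +
          (2 * X / m) ^ r * (W * U ^ ((r : ℝ) / (2 * r' : ℕ)))) := by
          have hX0 : (0 : ℝ) ≤ (X : ℝ) ^ r := by positivity
          have hU0 : 0 ≤ U ^ ((r : ℝ) / (2 * r' : ℕ)) := Real.rpow_nonneg hU _
          have hc := card_shifts_le (X := X) (m := m) (Nat.pos_of_ne_zero (NeZero.ne m))
          have h2 := hmean.trans (mul_le_mul_of_nonneg_right
            (pow_le_pow_left₀ (Nat.cast_nonneg _) hc r) (mul_nonneg hW0 hU0))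
          have h3 := mul_le_mul_of_nonneg_left hwW hX0
          exact mul_le_mul_of_nonneg_left (add_le_add h3 h2) (by positivity)
      _ = _ := by ring
  refine (wm_le_sum_classes A (tsum r F) hs S v cl Tη hTη).trans ?_
  refine (mul_le_mul_of_nonneg_left (Finset.sum_le_sum one) (by positivity)).trans (le_of_eq ?_)
  rw [Finset.sum_const, nsmul_eq_mul, ← mul_assoc, ← pow_succ]
  congr 2
  omega

/-- Reduction to the tuples which are distinct modulo a suitable prime. -/
lemma mv_le_of_primes {κ : Type*} [DecidableEq κ] {r s X : ℕ} (hr : 0 < r) (I : Finset ℤ)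
    (hI : I ⊆ Finset.Icc 1 (X : ℤ)) (F : ℤ → G) (S : Finset κ) (v : κ → G) (Q : Finset ℕ)
    (A : ℕ → Finset (Fin r → ℤ))
    (hQ : ∀ z ∈ box r I, Function.Injective z → ∃ p ∈ Q, z ∈ A p) {K : ℝ}
    (hK : ∀ p ∈ Q, wm (A p) (tsum r F) (box s S) (tsum s v) ≤ K) :
    mv r I F s S v ≤ max (2 * ((Q.card : ℝ) ^ 2 * K)) ((4 * r ^ 2 * X : ℝ) ^ r * mv₁ s S v) := by
  classical
  have hIc : (I.card : ℝ) ≤ X := by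
    have := Finset.card_le_card hI
    rw [Int.card_Icc] at this
    simp only [add_sub_cancel_right, Int.toNat_natCast] at this
    exact_mod_cast this
  refine (wm_le_injective_or hr I F (box s S) (tsum s v)).trans ?_
  apply max_le_max
  · refine mul_le_mul_of_nonneg_left ?_ (by norm_num)
    set A₁ := (box r I).filter Function.Injective with hA₁
    have hch : ∀ z : Fin r → ℤ, ∃ p, z ∈ A₁ → p ∈ Q ∧ z ∈ A p := by
      intro z
      by_cases hz : z ∈ A₁
      · obtain ⟨p, hp, hp'⟩ := hQ z (Finset.mem_filter.1 hz).1 (Finset.mem_filter.1 hz).2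
        exact ⟨p, fun _ => ⟨hp, hp'⟩⟩
      · exact ⟨0, fun h => absurd h hz⟩
    choose π hπ using hch
    refine (wm_le_card_mul_sum A₁ (tsum r F) (box s S) (tsum s v) π Q
      (fun z hz => (hπ z hz).1)).trans ?_
    rw [sq, mul_assoc]
    refine mul_le_mul_of_nonneg_left ?_ (by positivity)
    rw [← nsmul_eq_mul]
    refine Finset.sum_le_card_nsmul _ _ _ fun p hp => ?_
    refine le_trans (wm_mono _ _ ?_ subset_rfl) (hK p hp)
    intro z hz
    obtain ⟨h1, rfl⟩ := Finset.mem_filter.1 hz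
    exact (hπ z h1).2
  · rw [mv₁_eq]
    refine mul_le_mul_of_nonneg_right ?_ (mean_nonneg fun _ => by positivity)
    gcongr

end Step

section Algebra
open Polynomial

/-- Power sums determine elementary symmetric functions. -/
lemma esymm_eq_of_psum {R : Type*} [CommRing R] {r : ℕ} (hu : ∀ n : ℕ, 0 < n → n ≤ r → IsUnit (n : R))
    (x y : Fin r → R) (h : ∀ j, 1 ≤ j → j ≤ r → ∑ i, x i ^ j = ∑ i, y i ^ j) (n : ℕ) (hn : n ≤ r) :
    MvPolynomial.aeval x (MvPolynomial.esymm (Fin r) R n) =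
      MvPolynomial.aeval y (MvPolynomial.esymm (Fin r) R n) := by
  induction n using Nat.strong_induction_on with
  | _ n ih =>
    rcases Nat.eq_zero_or_pos n with rfl | hpos
    · simp
    · have e := MvPolynomial.mul_esymm_eq_sum (Fin r) R n
      have ex := congrArg (MvPolynomial.aeval x) e
      have ey := congrArg (MvPolynomial.aeval y) e
      simp only [map_mul, map_sum, map_pow, map_neg, map_one, map_natCast] at ex ey
      apply (hu n hpos hn).mul_left_cancel
      rw [ex, ey]
      congr 1
      refine Finset.sum_congr rfl fun a ha => ?_
      rw [Finset.mem_filter, Finset.HasAntidiagonal.mem_antidiagonal] at ha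
      rw [ih a.1 ha.2 (by omega)]
      congr 1
      simp only [MvPolynomial.psum, map_sum, map_pow, MvPolynomial.aeval_X]
      exact h _ (by omega) (by omega)

lemma prod_sub_eq_of_psum {R : Type*} [CommRing R] {r : ℕ}
    (hu : ∀ n : ℕ, 0 < n → n ≤ r → IsUnit (n : R))
    (x y : Fin r → R) (h : ∀ j, 1 ≤ j → j ≤ r → ∑ i, x i ^ j = ∑ i, y i ^ j) (t : R) :
    ∏ i, (t - x i) = ∏ i, (t - y i) := by
  have key : ∀ w : Fin r → R, ∏ i, (t - w i) = ∑ j ∈ Finset.range (r + 1),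
      (-1) ^ j * (MvPolynomial.aeval w (MvPolynomial.esymm (Fin r) R j) * t ^ (r - j)) := by
    intro w
    have := congrArg (Polynomial.eval t)
      (Multiset.prod_X_sub_X_eq_sum_esymm ((univ : Finset (Fin r)).val.map w))
    simp only [Multiset.map_map, Multiset.card_map, Finset.card_val, Finset.card_univ,
      Fintype.card_fin, Function.comp_def] at this
    rw [← Finset.prod_eq_multiset_prod, Polynomial.eval_prod, Polynomial.eval_finsetSum] at this
    simp only [Polynomial.eval_sub, Polynomial.eval_X, Polynomial.eval_C, Polynomial.eval_mul,
      Polynomial.eval_pow, Polynomial.eval_neg, Polynomial.eval_one] at this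
    rw [this]
    refine Finset.sum_congr rfl fun j _ => ?_
    rw [MvPolynomial.aeval_esymm_eq_multiset_esymm]
  rw [key, key]
  refine Finset.sum_congr rfl fun j hj => ?_
  rw [esymm_eq_of_psum hu x y h j (by simpa [Nat.lt_succ_iff] using hj)]

/-- Tuples distinct modulo the maximal ideal are determined by power sums up to order. -/
lemma exists_perm_of_psum {R k : Type*} [CommRing R] [Field k] (φ : R →+* k) [IsLocalHom φ]
    {r : ℕ} (hu : ∀ n : ℕ, 0 < n → n ≤ r → IsUnit (n : R)) (x y : Fin r → R)
    (hx : Function.Injective (φ ∘ x)) (hy : Function.Injective (φ ∘ y))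
    (h : ∀ j, 1 ≤ j → j ≤ r → ∑ i, x i ^ j = ∑ i, y i ^ j) :
    ∃ σ : Equiv.Perm (Fin r), y = x ∘ σ := by
  have hmem : ∀ l, ∃ i, y l = x i := by
    intro l
    have h0 : ∏ i, (y l - x i) = 0 := by
      rw [prod_sub_eq_of_psum hu x y h]
      exact Finset.prod_eq_zero (Finset.mem_univ l) (sub_self _)
    have h1 : ∏ i, (φ (y l) - φ (x i)) = 0 := by
      have := congrArg φ h0
      simpa using this
    obtain ⟨i, _, hi⟩ := Finset.prod_eq_zero_iff.1 h1
    refine ⟨i, ?_⟩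
    rw [← Finset.mul_prod_erase _ _ (Finset.mem_univ i)] at h0
    have hunit : IsUnit (∏ i' ∈ univ.erase i, (y l - x i')) := by
      rw [IsUnit.prod_iff]
      intro i' hi'
      apply isUnit_of_map_unit φ
      rw [isUnit_iff_ne_zero, map_sub]
      intro h2
      rw [sub_eq_zero] at h2 hi
      exact (Finset.ne_of_mem_erase hi') (hx (h2.symm.trans hi))
    rw [hunit.mul_left_eq_zero, sub_eq_zero] at h0
    exact h0
  choose σ hσ using hmem
  have hinj : Function.Injective σ := by
    intro a b hab
    apply hy
    simp [hσ, hab]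
  refine ⟨Equiv.ofBijective σ (Finite.injective_iff_bijective.1 hinj), ?_⟩
  ext l
  simp [hσ]

/-- Power sums to consecutive large exponents determine tuples with given distinct nonzero
residues. -/
lemma eq_of_psum_of_residue {R k : Type*} [CommRing R] [Field k] (φ : R →+* k) [IsLocalHom φ]
    {r a : ℕ} (hu : ∀ n : ℕ, a < n → n ≤ a + r → (n : k) ≠ 0) (x y : Fin r → R)
    (hx : Function.Injective (φ ∘ x)) (hx0 : ∀ i, φ (x i) ≠ 0) (hxy : ∀ i, φ (x i) = φ (y i))
    (h : ∀ j, a < j → j ≤ a + r → ∑ i, x i ^ j = ∑ i, y i ^ j) : x = y := by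
  set M : Matrix (Fin r) (Fin r) R :=
    Matrix.of fun j i => ∑ n ∈ Finset.range (a + 1 + j), x i ^ n * y i ^ (a + 1 + j - 1 - n) with hM
  have hmul : M.mulVec (fun i => x i - y i) = 0 := by
    ext j
    simp only [Matrix.mulVec, dotProduct, hM, Matrix.of_apply, Pi.zero_apply]
    have : ∀ i, (∑ n ∈ Finset.range (a + 1 + j), x i ^ n * y i ^ (a + 1 + (j : ℕ) - 1 - n)) *
        (x i - y i) = x i ^ (a + 1 + (j : ℕ)) - y i ^ (a + 1 + (j : ℕ)) := fun i =>
      (Commute.all (x i) (y i)).geom_sum₂_mul _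
    simp_rw [this]
    rw [Finset.sum_sub_distrib, h _ (by omega) (by omega), sub_self]
  have hdet : IsUnit M.det := by
    apply isUnit_of_map_unit φ
    rw [isUnit_iff_ne_zero, RingHom.map_det]
    have : φ.mapMatrix M = Matrix.diagonal (fun j : Fin r => ((a + 1 + j : ℕ) : k)) *
        (Matrix.vandermonde (φ ∘ x)).transpose * Matrix.diagonal (fun i => φ (x i) ^ a) := by
      ext j i
      rw [Matrix.mul_diagonal, Matrix.diagonal_mul]
      simp only [RingHom.mapMatrix_apply, Matrix.map_apply, hM, Matrix.of_apply, map_sum, map_mul, map_pow, ← hxy,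
        Matrix.transpose_apply, Matrix.vandermonde_apply, Function.comp_apply]
      rw [Finset.sum_congr rfl (g := fun _ => φ (x i) ^ (a + j))]
      · rw [Finset.sum_const, Finset.card_range, nsmul_eq_mul]; ring
      · intro n hn
        rw [Finset.mem_range] at hn
        rw [← pow_add]; congr 1; omega
    rw [this, Matrix.det_mul, Matrix.det_mul, Matrix.det_diagonal, Matrix.det_diagonal,
      Matrix.det_transpose]
    refine mul_ne_zero (mul_ne_zero ?_ (Matrix.det_vandermonde_ne_zero_iff.2 hx)) ?_
    · exact Finset.prod_ne_zero_iff.2 fun j _ => hu _ (by omega) (by omega)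
    · exact Finset.prod_ne_zero_iff.2 fun i _ => pow_ne_zero _ (hx0 i)
  have hinj := Matrix.mulVec_injective_of_isUnit ((Matrix.isUnit_iff_isUnit_det M).2 hdet)
  have := hinj (a₁ := fun i => x i - y i) (a₂ := 0) (by rw [hmul, Matrix.mulVec_zero])
  ext i
  exact sub_eq_zero.1 (congrFun this i)

instance isLocalHom_castHom {p c : ℕ} [Fact p.Prime] (hc : c ≠ 0) :
    IsLocalHom (ZMod.castHom (dvd_pow_self p hc) (ZMod p)) := by
  constructor
  intro x hx
  rw [isUnit_iff_ne_zero] at hx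
  have : NeZero (p ^ c) := ⟨pow_ne_zero _ (Fact.out (p := p.Prime)).ne_zero⟩
  rw [← ZMod.natCast_zmod_val x] at hx ⊢
  rw [map_natCast, Ne, ZMod.natCast_eq_zero_iff] at hx
  rw [ZMod.isUnit_iff_coprime]
  exact Nat.Coprime.pow_right _ (((Nat.Prime.coprime_iff_not_dvd Fact.out).2 hx).symm)

lemma card_castHom_fiber_le {m n : ℕ} [NeZero m] (hn : 0 < n) (h : n ∣ m) (b : ZMod n) :
    ((univ : Finset (ZMod m)).filter (fun x => ZMod.castHom h (ZMod n) x = b)).card ≤ m / n := by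
  have : NeZero n := ⟨hn.ne'⟩
  rw [← Finset.card_range (m / n)]
  apply Finset.card_le_card_of_injOn (fun x => x.val / n)
  · intro x _
    rw [Finset.coe_range, Set.mem_Iio]
    exact Nat.div_lt_div_of_lt_of_dvd h (ZMod.val_lt x)
  · intro x hx y hy hxy
    simp only [Finset.coe_filter, Finset.mem_univ, true_and, Set.mem_ofPred_eq] at hx hy
    have e : ZMod.castHom h (ZMod n) x = ZMod.castHom h (ZMod n) y := hx.trans hy.symm
    rw [← ZMod.natCast_zmod_val x, ← ZMod.natCast_zmod_val y, map_natCast, map_natCast,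
      ZMod.natCast_eq_natCast_iff'] at e
    apply ZMod.val_injective
    rw [← Nat.div_add_mod x.val n, ← Nat.div_add_mod y.val n, e]
    simp only at hxy
    rw [hxy]

lemma card_filter_reduction_le {α ι : Type*} [DecidableEq ι] [Fintype ι] {p c : ℕ} (hp : 0 < p)
    (e : ι → ℕ) (he : ∀ i, e i ≤ c) (T : Finset α) (full : α → ι → ZMod (p ^ c)) (M : ℕ)
    (hM : ∀ v, (T.filter (fun x => full x = v)).card ≤ M) (b : ∀ i, ZMod (p ^ e i)) :
    (T.filter (fun x => (fun i => ZMod.castHom (pow_dvd_pow p (he i)) (ZMod (p ^ e i)) (full x i))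
      = b)).card ≤ M * ∏ i, p ^ (c - e i) := by
  have : NeZero (p ^ c) := ⟨pow_ne_zero _ hp.ne'⟩
  set V : Finset (ι → ZMod (p ^ c)) := Fintype.piFinset fun i => univ.filter
    (fun x => ZMod.castHom (pow_dvd_pow p (he i)) (ZMod (p ^ e i)) x = b i) with hV
  have hVc : V.card ≤ ∏ i, p ^ (c - e i) := by
    rw [hV, Fintype.card_piFinset]
    refine Finset.prod_le_prod' fun i _ => ?_
    refine (card_castHom_fiber_le (pow_pos hp _) _ _).trans (le_of_eq ?_)
    exact Nat.pow_div (he i) hp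
  refine le_trans ?_ (Nat.mul_le_mul_left M hVc)
  refine Finset.card_le_mul_card_image_of_maps_to (f := full) ?_ M ?_
  · intro x hx
    rw [hV, Fintype.mem_piFinset]
    intro i
    simp only [Finset.mem_filter, Finset.mem_univ, true_and]
    exact congrFun (Finset.mem_filter.1 hx).2 i
  · intro v _
    refine le_trans (Finset.card_le_card ?_) (hM v)
    exact Finset.filter_subset_filter _ (Finset.filter_subset _ _)

end Algebra

section Diff
open Polynomial

/-- Iterated differences of a function. -/
def difs {G : Type*} [AddCommGroup G] (l : List ℤ) (F : ℤ → G) : ℤ → G := l.foldr dif F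

/-- Iterated differences of a polynomial. -/
noncomputable def pdifs (l : List ℤ) (Q : ℤ[X]) : ℤ[X] :=
  l.foldr (fun h Q => taylor h Q - Q) Q

lemma pdifs_cons (h : ℤ) (l : List ℤ) (Q : ℤ[X]) :
    pdifs (h :: l) Q = taylor h (pdifs l Q) - pdifs l Q := rfl

lemma pdifs_add (l : List ℤ) (Q Q' : ℤ[X]) : pdifs l (Q + Q') = pdifs l Q + pdifs l Q' := by
  induction l with
  | nil => rfl
  | cons h l ih => rw [pdifs_cons, pdifs_cons, pdifs_cons, ih, map_add]; ring

lemma pdifs_C_mul (l : List ℤ) (a : ℤ) (Q : ℤ[X]) : pdifs l (C a * Q) = C a * pdifs l Q := by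
  induction l with
  | nil => rfl
  | cons h l ih =>
    rw [pdifs_cons, pdifs_cons, ih, taylor_mul, taylor_C]; ring

lemma pdifs_sum (l : List ℤ) {ι : Type*} (T : Finset ι) (Q : ι → ℤ[X]) :
    pdifs l (∑ i ∈ T, Q i) = ∑ i ∈ T, pdifs l (Q i) := by
  have h0 : pdifs l 0 = 0 := by
    have := pdifs_C_mul l 0 0
    simpa using this
  exact map_sum (⟨⟨pdifs l, h0⟩, pdifs_add l⟩ : ℤ[X] →+ ℤ[X]) Q T

lemma taylor_sub_natDegree {h : ℤ} {Q : ℤ[X]} {n : ℕ} (hQ : Q.natDegree ≤ n + 1) :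
    (taylor h Q - Q).natDegree ≤ n ∧ (taylor h Q - Q).coeff n = (n + 1) * h * Q.coeff (n + 1) := by
  have hz : ∀ m, n + 1 < m → Q.coeff m = 0 := fun m hm =>
    coeff_eq_zero_of_natDegree_lt (by omega)
  constructor
  · rw [natDegree_le_iff_coeff_eq_zero]
    intro m hm
    rw [coeff_sub]
    rcases Nat.lt_or_ge (n + 1) m with h1 | h1
    · rw [hz m h1, coeff_eq_zero_of_natDegree_lt (by rw [natDegree_taylor]; omega), sub_zero]
    · obtain rfl : m = n + 1 := by omega
      rw [taylor_coeff, eval_eq_sum_range' (n := 1)]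
      · simp [hasseDeriv_coeff]
      · rw [Nat.lt_one_iff, ← Nat.le_zero, natDegree_le_iff_coeff_eq_zero]
        intro j hj
        rw [hasseDeriv_coeff, hz _ (by omega), mul_zero]
  · rw [coeff_sub, taylor_coeff, eval_eq_sum_range' (n := 2)]
    · simp [Finset.sum_range_succ, hasseDeriv_coeff, Nat.add_comm 1 n]; ring
    · rw [Nat.lt_succ_iff, natDegree_le_iff_coeff_eq_zero]
      intro j hj
      rw [hasseDeriv_coeff, hz _ (by omega), mul_zero]

lemma pdifs_natDegree (l : List ℤ) {Q : ℤ[X]} {n : ℕ} (hQ : Q.natDegree ≤ n + l.length) :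
    (pdifs l Q).natDegree ≤ n ∧
      (pdifs l Q).coeff n = (n + l.length).descFactorial l.length * l.prod *
        Q.coeff (n + l.length) := by
  induction l generalizing n with
  | nil => simpa [pdifs] using hQ
  | cons h l ih =>
    rw [List.length_cons] at hQ ⊢
    obtain ⟨h1, h2⟩ := ih (n := n + 1) (by omega)
    obtain ⟨h3, h4⟩ := taylor_sub_natDegree (h := h) h1
    refine ⟨h3, ?_⟩
    rw [pdifs_cons, h4, h2, List.prod_cons, show n + 1 + l.length = n + (l.length + 1) by ring,
      Nat.descFactorial_succ, show n + (l.length + 1) - l.length = n + 1 by omega]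
    push_cast
    ring

/-- The moment curve modulo `N`. -/
def curve (k N : ℕ) (z : ℤ) : Fin k → ZMod N := fun j => ((z ^ (j + 1 : ℕ) : ℤ) : ZMod N)

lemma difs_curve (k N : ℕ) (l : List ℤ) (z : ℤ) (j : Fin k) :
    difs l (curve k N) z j = (((pdifs l (X ^ (j + 1 : ℕ))).eval z : ℤ) : ZMod N) := by
  induction l generalizing z with
  | nil => simp [difs, pdifs, curve]
  | cons h l ih =>
    have : difs (h :: l) (curve k N) z = difs l (curve k N) (z + h) - difs l (curve k N) z := rfl
    rw [this, Pi.sub_apply, ih, ih, pdifs_cons, eval_sub, taylor_eval]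
    push_cast; rfl

/-- Solutions satisfy all polynomial relations. -/
lemma sum_eval_eq_of_curve {k N m r s : ℕ} (hm : m ∣ N) (l : List ℤ) (z z' : Fin r → ℤ)
    (y y' : Fin s → ℤ)
    (h : tsum r (difs l (curve k N)) z + tsum s (curve k N) y =
      tsum r (difs l (curve k N)) z' + tsum s (curve k N) y')
    (Q : ℤ[X]) (hQ : Q.natDegree ≤ k) :
    (((∑ i, (pdifs l Q).eval (z i) + ∑ i, Q.eval (y i) : ℤ)) : ZMod m) =
      ((∑ i, (pdifs l Q).eval (z' i) + ∑ i, Q.eval (y' i) : ℤ) : ZMod m) := by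
  have base : ∀ j ∈ Finset.range (k + 1),
      (((∑ i, (pdifs l (X ^ j)).eval (z i) + ∑ i, (X ^ j : ℤ[X]).eval (y i) : ℤ)) : ZMod m) =
      ((∑ i, (pdifs l (X ^ j)).eval (z' i) + ∑ i, (X ^ j : ℤ[X]).eval (y' i) : ℤ) : ZMod m) := by
    intro j hj
    rcases Nat.eq_zero_or_pos j with rfl | hpos
    · have h0 := (pdifs_natDegree l (Q := (X ^ 0 : ℤ[X])) (n := 0) (by simp)).1
      rw [Nat.le_zero, natDegree_eq_zero] at h0
      obtain ⟨a, ha⟩ := h0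
      rw [← ha]
      simp
    · have hj' : j - 1 < k := by have := Finset.mem_range.1 hj; omega
      have h1 := congrFun h ⟨j - 1, hj'⟩
      simp only [tsum, Pi.add_apply, Finset.sum_apply, difs_curve] at h1
      rw [show j - 1 + 1 = j by omega] at h1
      have h2 := congrArg (ZMod.castHom hm (ZMod m)) h1
      simp only [curve, map_add, map_sum, map_intCast] at h2
      rw [show j - 1 + 1 = j by omega] at h2
      push_cast at h2 ⊢
      simpa using h2
  rw [Q.as_sum_range_C_mul_X_pow' (Nat.lt_succ_of_le hQ)]
  simp_rw [pdifs_sum, pdifs_C_mul, eval_finsetSum, eval_mul, eval_C]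
  rw [Finset.sum_comm, Finset.sum_comm (s := univ) (t := Finset.range k.succ),
    Finset.sum_comm (s := univ) (t := Finset.range k.succ),
    Finset.sum_comm (s := univ) (t := Finset.range k.succ), ← Finset.sum_add_distrib,
    ← Finset.sum_add_distrib]
  simp_rw [← Finset.mul_sum, ← mul_add]
  push_cast
  refine Finset.sum_congr rfl fun j hj => ?_
  congr 1
  have := base j hj
  push_cast at this
  exact this

/-- Solutions satisfy congruences in which the variables `y` disappear. -/
lemma sum_eval_pow_eq_of_curve {k N p c e j r s : ℕ} (hN : p ^ c ∣ N) (hec : e ≤ c) (hej : e ≤ j)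
    (hjk : j ≤ k) (l : List ℤ) (η : ℤ) (z z' : Fin r → ℤ)
    (y y' : Fin s → ℤ) (hy : ∀ i, (p : ℤ) ∣ y i - η) (hy' : ∀ i, (p : ℤ) ∣ y' i - η)
    (h : tsum r (difs l (curve k N)) z + tsum s (curve k N) y =
      tsum r (difs l (curve k N)) z' + tsum s (curve k N) y') :
    ((∑ i, (pdifs l ((X - C η) ^ j)).eval (z i) : ℤ) : ZMod (p ^ e)) =
      ((∑ i, (pdifs l ((X - C η) ^ j)).eval (z' i) : ℤ) : ZMod (p ^ e)) := by
  have h1 := sum_eval_eq_of_curve ((pow_dvd_pow p hec).trans hN) l z z' y y' h ((X - C η) ^ j)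
    ((natDegree_pow_le_of_le j (natDegree_X_sub_C_le η)).trans (by omega))
  have hzero : ∀ w : Fin s → ℤ, (∀ i, (p : ℤ) ∣ w i - η) →
      ((∑ i, ((X - C η) ^ j).eval (w i) : ℤ) : ZMod (p ^ e)) = 0 := by
    intro w hw
    rw [ZMod.intCast_zmod_eq_zero_iff_dvd]
    refine Finset.dvd_sum fun i _ => ?_
    simp only [eval_pow, eval_sub, eval_X, eval_C]
    push_cast
    exact (pow_dvd_pow _ hej).trans (pow_dvd_pow_of_dvd (hw i) j)
  rw [Int.cast_add, Int.cast_add, hzero y hy, hzero y' hy', add_zero, add_zero] at h1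
  exact h1

end Diff

section Lift
open Polynomial

variable {p : ℕ} [hp : Fact p.Prime]

instance neZero_pow (c : ℕ) : NeZero (p ^ c) := ⟨pow_ne_zero _ hp.out.ne_zero⟩

/-- Reduction modulo `p`. -/
noncomputable def res (p : ℕ) {c : ℕ} (hc : c ≠ 0) : ZMod (p ^ c) →+* ZMod p :=
  ZMod.castHom (dvd_pow_self p hc) (ZMod p)

instance isLocalHom_res {c : ℕ} (hc : c ≠ 0) : IsLocalHom (res p hc) := isLocalHom_castHom hc

open Classical in
/-- Residue tuples with entries distinct modulo `p`. -/
noncomputable def distinctRes (p : ℕ) [Fact p.Prime] {c : ℕ} (hc : c ≠ 0) (r : ℕ) :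
    Finset (Fin r → ZMod (p ^ c)) :=
  univ.filter fun ξ => Function.Injective (res p hc ∘ ξ)

/-- The system of differenced power sums modulo `p ^ c`. -/
noncomputable def full (p c n : ℕ) (l : List ℤ) (η : ℤ) {r : ℕ} (ξ : Fin r → ZMod (p ^ c))
    (i : Fin n) : ZMod (p ^ c) :=
  ∑ a, ((pdifs l ((X - C η) ^ (l.length + 1 + i : ℕ))).map (Int.castRingHom (ZMod (p ^ c)))).eval
    (ξ a)

/-- The part of the system which is determined by the congruences. -/
noncomputable def liftKey (p c n : ℕ) (l : List ℤ) (η : ℤ) {r : ℕ} (ξ : Fin r → ZMod (p ^ c))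
    (i : Fin n) : ZMod (p ^ (min (l.length + 1 + i : ℕ) c)) :=
  ZMod.castHom (pow_dvd_pow p (min_le_right _ _)) _ (full p c n l η ξ i)

lemma liftKey_eq_of_curve {k N c r s : ℕ} (hN : p ^ c ∣ N) (l : List ℤ) (η : ℤ)
    (z z' : Fin r → ℤ) (y y' : Fin s → ℤ) (hy : ∀ i, (p : ℤ) ∣ y i - η)
    (hy' : ∀ i, (p : ℤ) ∣ y' i - η)
    (h : tsum r (difs l (curve k N)) z + tsum s (curve k N) y =
      tsum r (difs l (curve k N)) z' + tsum s (curve k N) y') :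
    liftKey p c (k - l.length) l η (fun i => (z i : ZMod (p ^ c))) =
      liftKey p c (k - l.length) l η (fun i => (z' i : ZMod (p ^ c))) := by
  ext i
  have := sum_eval_pow_eq_of_curve hN (min_le_right (l.length + 1 + i : ℕ) c) (min_le_left _ _)
    (by omega) l η z z' y y' hy hy' h
  unfold liftKey full
  simp_rw [Polynomial.eval_intCast_map]
  simp only [map_sum, eq_intCast, map_intCast]
  push_cast at this
  exact this

lemma psum_eq_of_full {c n : ℕ} (hc : c ≠ 0) (l : List ℤ) (hl : ∀ h ∈ l, ¬ (p : ℤ) ∣ h)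
    (hn : n + l.length < p) (η : ℤ) {r : ℕ} (ξ ξ' : Fin r → ZMod (p ^ c))
    (h : full p c n l η ξ = full p c n l η ξ') (j : ℕ) (hj : j ≤ n) :
    ∑ a, ξ a ^ j = ∑ a, ξ' a ^ j := by
  induction j using Nat.strong_induction_on with
  | _ j ih =>
    rcases Nat.eq_zero_or_pos j with rfl | hpos
    · simp
    · have h1 := congrFun h ⟨j - 1, by omega⟩
      simp only [full] at h1
      rw [show l.length + 1 + (j - 1) = j + l.length by omega] at h1
      set Q : ℤ[X] := (X - C η) ^ (j + l.length) with hQ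
      have hmon : Q.Monic := (monic_X_sub_C η).pow _
      have hdeg : Q.natDegree = j + l.length := by
        rw [hQ, (monic_X_sub_C η).natDegree_pow, natDegree_X_sub_C, mul_one]
      obtain ⟨h2, h3⟩ := pdifs_natDegree l hdeg.le
      rw [← hdeg, hmon.coeff_natDegree, mul_one, hdeg] at h3
      set R := (pdifs l Q).map (Int.castRingHom (ZMod (p ^ c))) with hR
      have hRdeg : R.natDegree < j + 1 := Nat.lt_succ_of_le ((natDegree_map_le).trans h2)
      simp_rw [eval_eq_sum_range' hRdeg] at h1
      rw [Finset.sum_comm, Finset.sum_comm (s := univ) (t := Finset.range (j + 1)),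
        Finset.sum_range_succ, Finset.sum_range_succ] at h1
      simp_rw [← Finset.mul_sum] at h1
      rw [Finset.sum_congr rfl (fun i hi => by
        rw [ih i (Finset.mem_range.1 hi) (by have := Finset.mem_range.1 hi; omega)])] at h1
      have h4 := add_left_cancel h1
      have hunit : IsUnit (R.coeff j) := by
        apply isUnit_of_map_unit (res p hc)
        rw [isUnit_iff_ne_zero, hR, coeff_map, h3]
        simp only [eq_intCast, map_intCast]
        rw [Ne, ZMod.intCast_zmod_eq_zero_iff_dvd]
        have hpp : Prime (p : ℤ) := Nat.prime_iff_prime_int.1 hp.out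
        intro hd
        rcases hpp.dvd_or_dvd hd with hd | hd
        · have hd' : p ∣ (j + l.length).descFactorial l.length := by exact_mod_cast hd
          have h5 : p ∣ (j + l.length).factorial := by
            rw [← Nat.factorial_mul_descFactorial (show l.length ≤ j + l.length by omega)]
            exact hd'.mul_left _
          rw [hp.out.dvd_factorial] at h5
          omega
        · rw [hpp.dvd_prod_iff] at hd
          obtain ⟨a, ha, hd⟩ := hd
          exact hl a ha hd
      exact hunit.mul_left_cancel h4

lemma isUnit_natCast_of_lt {c : ℕ} (hc : c ≠ 0) (n : ℕ) (h0 : 0 < n) (h : n < p) :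
    IsUnit (n : ZMod (p ^ c)) := by
  apply isUnit_of_map_unit (res p hc)
  rw [isUnit_iff_ne_zero, map_natCast, Ne, ZMod.natCast_eq_zero_iff]
  exact Nat.not_dvd_of_pos_of_lt h0 h

lemma card_le_factorial_of_perm {α : Type*} {r : ℕ} (S : Finset (Fin r → α))
    (h : ∀ x ∈ S, ∀ y ∈ S, ∃ σ : Equiv.Perm (Fin r), y = x ∘ σ) : S.card ≤ r.factorial := by
  classical
  rcases S.eq_empty_or_nonempty with rfl | ⟨x, hx⟩
  · simp
  · have hsub : S ⊆ (univ : Finset (Equiv.Perm (Fin r))).image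
        (fun σ : Equiv.Perm (Fin r) => x ∘ σ) := by
      intro y hy
      obtain ⟨σ, rfl⟩ := h x hx y hy
      exact Finset.mem_image_of_mem _ (Finset.mem_univ _)
    refine (Finset.card_le_card hsub).trans (Finset.card_image_le.trans ?_)
    rw [Finset.card_univ, Fintype.card_perm, Fintype.card_fin]

lemma sum_range_tsub {n a : ℕ} (h : a ≤ n + 1) :
    ∑ i ∈ Finset.range n, (a - (i + 1)) = a * (a - 1) / 2 := by
  rcases Nat.eq_zero_or_pos a with rfl | ha
  · simp
  · rw [← Finset.sum_range_id_mul_two a, Nat.mul_div_cancel _ (by norm_num)]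
    obtain ⟨a, rfl⟩ : ∃ b, a = b + 1 := ⟨a - 1, by omega⟩
    obtain ⟨m, rfl⟩ : ∃ m, n = a + m := ⟨n - a, by omega⟩
    rw [Finset.sum_range_add, Finset.sum_eq_zero (s := Finset.range m) (fun i _ => by omega),
      add_zero, Finset.sum_range_succ', ← Finset.sum_range_reflect]
    rw [add_zero]
    refine Finset.sum_congr rfl fun i hi => ?_
    have := Finset.mem_range.1 hi
    omega

lemma card_liftKey_le {k c : ℕ} (hc : c ≠ 0) (l : List ℤ) (hl : ∀ h ∈ l, ¬ (p : ℤ) ∣ h)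
    (hlc : l.length < c) (hck : c ≤ k) (hkp : k < p) (η : ℤ)
    (b : ∀ i : Fin (k - l.length), ZMod (p ^ (min (l.length + 1 + i : ℕ) c))) :
    ((distinctRes p hc (k - l.length)).filter
      (fun ξ => liftKey p c (k - l.length) l η ξ = b)).card ≤
      (k - l.length).factorial * p ^ ((c - l.length) * (c - l.length - 1) / 2) := by
  classical
  have h := card_filter_reduction_le (p := p) (c := c) hp.out.pos
    (fun i : Fin (k - l.length) => min (l.length + 1 + i : ℕ) c) (fun _ => min_le_right _ _)
    (distinctRes p hc (k - l.length)) (full p c (k - l.length) l η)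
    (k - l.length).factorial ?_ b
  · refine h.trans (le_of_eq ?_)
    rw [Finset.prod_pow_eq_pow_sum, Finset.sum_fin_eq_sum_range]
    congr 2
    rw [← sum_range_tsub (n := k - l.length) (a := c - l.length) (by omega)]
    refine Finset.sum_congr rfl fun i hi => ?_
    rw [dif_pos (Finset.mem_range.1 hi)]
    simp only
    omega
  · intro v
    apply card_le_factorial_of_perm
    intro x hx y hy
    rw [Finset.mem_filter] at hx hy
    have hx1 := hx.1
    have hy1 := hy.1
    simp only [distinctRes, Finset.mem_filter, Finset.mem_univ, true_and] at hx1 hy1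
    refine exists_perm_of_psum (res p hc) (fun n h0 h1 => isUnit_natCast_of_lt hc n h0 (by omega))
      x y hx1 hy1 (fun j h1 h2 => ?_)
    exact psum_eq_of_full hc l hl (by omega) η x y (hx.2.trans hy.2.symm) j h2

lemma full_nil (p c n : ℕ) (η : ℤ) {r : ℕ} (ξ : Fin r → ZMod (p ^ c)) (i : Fin n) :
    full p c n [] η ξ i = ∑ a, (ξ a - (η : ZMod (p ^ c))) ^ (i + 1 : ℕ) := by
  simp [full, pdifs, add_comm]

lemma card_liftKey_nil_le {k r : ℕ} (hr : r ≠ 0) (hrk : r ≤ k) (hkr : k < 2 * r) (hkp : k < p)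
    (η : ℤ) (b : ∀ i : Fin k, ZMod (p ^ (min (([] : List ℤ).length + 1 + i : ℕ) r))) :
    ((distinctRes p hr r).filter (fun ξ => liftKey p r k [] η ξ = b)).card ≤
      p ^ ((2 * r - k) * (2 * r - k - 1) / 2 + (k - r)) * r.factorial := by
  classical
  set U := (distinctRes p hr r).filter (fun ξ => liftKey p r k [] η ξ = b) with hU
  have hUd : ∀ ξ ∈ U, Function.Injective (res p hr ∘ ξ) := by
    intro ξ hξ
    have := (Finset.mem_filter.1 hξ).1
    simpa [distinctRes] using this
  have hUk : ∀ ξ ∈ U, ∀ i : Fin k, ZMod.castHom (pow_dvd_pow p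
      (min_le_right (([] : List ℤ).length + 1 + i : ℕ) r)) _
      (∑ a, (ξ a - (η : ZMod (p ^ r))) ^ (i + 1 : ℕ)) = b i := by
    intro ξ hξ i
    rw [← full_nil]
    exact congrFun (Finset.mem_filter.1 hξ).2 i
  have himg : (U.image fun ξ => res p hr ∘ ξ).card ≤ r.factorial := by
    apply card_le_factorial_of_perm
    intro x hx y hy
    obtain ⟨ξ, hξ, rfl⟩ := Finset.mem_image.1 hx
    obtain ⟨ξ', hξ', rfl⟩ := Finset.mem_image.1 hy
    have : IsLocalHom (RingHom.id (ZMod p)) := ⟨fun a ha => ha⟩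
    obtain ⟨σ, hσ⟩ := exists_perm_of_psum (RingHom.id (ZMod p)) (r := r)
      (fun n h0 h1 => by
        rw [isUnit_iff_ne_zero, Ne, ZMod.natCast_eq_zero_iff]
        exact Nat.not_dvd_of_pos_of_lt h0 (by omega))
      (fun i => res p hr (ξ i) - η) (fun i => res p hr (ξ' i) - η)
      (fun i j hij => hUd ξ hξ (by simpa using hij)) (fun i j hij => hUd ξ' hξ' (by simpa using hij))
      (fun j h1 h2 => by
        have e1 := (hUk ξ hξ ⟨j - 1, by omega⟩).trans (hUk ξ' hξ' ⟨j - 1, by omega⟩).symm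
        have hd : p ∣ p ^ (min (([] : List ℤ).length + 1 + (j - 1)) r) :=
          dvd_pow_self p (by rw [List.length_nil]; omega)
        have e2 := congrArg (ZMod.castHom hd (ZMod p)) e1
        rw [← RingHom.comp_apply, ← RingHom.comp_apply] at e2
        have e3 : (ZMod.castHom hd (ZMod p)).comp (ZMod.castHom (pow_dvd_pow p
            (min_le_right (([] : List ℤ).length + 1 + (j - 1)) r)) _) = res p hr :=
          Subsingleton.elim _ _
        rw [e3] at e2
        simp only [map_sum, map_pow, map_sub, map_intCast] at e2
        rw [show j - 1 + 1 = j by omega] at e2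
        exact e2)
    refine ⟨σ, ?_⟩
    ext i
    have := congrFun hσ i
    simpa using this
  refine le_trans ?_ (Nat.mul_le_mul_left _ himg)
  refine Finset.card_le_mul_card_image_of_maps_to (f := fun ξ => res p hr ∘ ξ)
    (fun a ha => Finset.mem_image_of_mem _ ha) _ ?_
  intro ρ hρ
  obtain ⟨ξ₁, hξ₁, hρ₁⟩ := Finset.mem_image.1 hρ
  have hρinj : Function.Injective ρ := by rw [← hρ₁]; exact hUd ξ₁ hξ₁
  obtain ⟨r₀, rfl⟩ : ∃ r₀, r = r₀ + 1 := ⟨r - 1, by omega⟩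
  obtain ⟨i₀, hi₀⟩ : ∃ i₀ : Fin (r₀ + 1), ∀ i, i ≠ i₀ → ρ i - (η : ZMod p) ≠ 0 := by
    by_cases hex : ∃ i, ρ i = η
    · obtain ⟨i₀, h0⟩ := hex
      refine ⟨i₀, fun i hi h1 => hi (hρinj ?_)⟩
      rw [h0, ← sub_eq_zero, h1]
    · push Not at hex
      exact ⟨0, fun i _ => sub_ne_zero.2 (hex i)⟩
  set e : Option (Fin r₀) → ℕ := fun o => o.elim 1 fun i => min (k - r₀ + 1 + i) (r₀ + 1) with he
  have hec : ∀ o, e o ≤ r₀ + 1 := by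
    intro o
    rcases o with _ | i
    · simp [he]
    · simp [he]
  set fl : (Fin (r₀ + 1) → ZMod (p ^ (r₀ + 1))) → Option (Fin r₀) → ZMod (p ^ (r₀ + 1)) :=
    fun ξ o => o.elim (ξ i₀) fun i => ∑ a, (ξ a - (η : ZMod (p ^ (r₀ + 1)))) ^ (k - r₀ + 1 + i : ℕ)
    with hfl
  have hcard := card_filter_reduction_le (p := p) hp.out.pos e hec
    ((U.filter fun ξ => res p hr ∘ ξ = ρ)) fl 1 (by
      intro v
      rw [Finset.card_le_one]
      intro ξ hξ ξ' hξ'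
      simp only [Finset.mem_filter] at hξ hξ'
      obtain ⟨⟨hξU, hξρ⟩, hξv⟩ := hξ
      obtain ⟨⟨hξU', hξρ'⟩, hξv'⟩ := hξ'
      have hff := hξv.trans hξv'.symm
      have h0 : ξ i₀ = ξ' i₀ := congrFun hff none
      have hres : ∀ i, res p hr (ξ i) = ρ i := fun i => congrFun hξρ i
      have hres' : ∀ i, res p hr (ξ' i) = ρ i := fun i => congrFun hξρ' i
      have hrest := eq_of_psum_of_residue (res p hr) (r := r₀) (a := k - r₀)
        (fun n h0 h1 => by
          rw [Ne, ZMod.natCast_eq_zero_iff]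
          exact Nat.not_dvd_of_pos_of_lt (by omega) (by omega))
        (fun i => ξ (i₀.succAbove i) - η) (fun i => ξ' (i₀.succAbove i) - η)
        (fun i j hij => by
          have : ρ (i₀.succAbove i) = ρ (i₀.succAbove j) := by
            rw [← hres, ← hres]; simpa using hij
          exact Fin.succAbove_right_injective (hρinj this))
        (fun i => by
          rw [map_sub, map_intCast, hres]
          exact hi₀ _ (Fin.succAbove_ne _ _))
        (fun i => by rw [map_sub, map_sub, hres, hres'])
        (fun j h1 h2 => by
          have h3 := congrFun hff (some ⟨j - (k - r₀) - 1, by omega⟩)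
          simp only [hfl, Option.elim] at h3
          rw [show k - r₀ + 1 + (j - (k - r₀) - 1) = j by omega, Fin.sum_univ_succAbove _ i₀,
            Fin.sum_univ_succAbove _ i₀, h0] at h3
          exact add_left_cancel h3)
      ext i
      rcases eq_or_ne i i₀ with rfl | hi
      · exact h0
      · obtain ⟨i', rfl⟩ := Fin.exists_succAbove_eq hi
        simpa using congrFun hrest i')
    (fun o => ZMod.castHom (pow_dvd_pow p (hec o)) (ZMod (p ^ e o)) (fl ξ₁ o))
  have hall : (U.filter fun ξ => res p hr ∘ ξ = ρ) ⊆ ((U.filter fun ξ => res p hr ∘ ξ = ρ).filter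
      (fun ξ => (fun o => ZMod.castHom (pow_dvd_pow p (hec o)) (ZMod (p ^ e o)) (fl ξ o)) =
        (fun o => ZMod.castHom (pow_dvd_pow p (hec o)) (ZMod (p ^ e o)) (fl ξ₁ o)))) := by
    intro ξ hξ
    refine Finset.mem_filter.2 ⟨hξ, ?_⟩
    obtain ⟨hξU, hξρ⟩ := Finset.mem_filter.1 hξ
    funext o
    rcases o with _ | i
    · have h1 : res p hr (ξ i₀) = res p hr (ξ₁ i₀) := by
        have := congrFun (hξρ.trans hρ₁.symm) i₀
        exact this
      have hd : p ^ e none ∣ p := by simp [he]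
      have h2 : ∀ w, ZMod.castHom (pow_dvd_pow p (hec none)) (ZMod (p ^ e none)) w =
          ZMod.castHom hd (ZMod (p ^ e none)) (res p hr w) := by
        intro w
        rw [← RingHom.comp_apply]
        congr 1
        exact Subsingleton.elim _ _
      simp only [hfl, Option.elim]
      rw [h2, h2, h1]
    · have h1 := (hUk ξ hξU ⟨k - r₀ + i, by omega⟩).trans
        (hUk ξ₁ hξ₁ ⟨k - r₀ + i, by omega⟩).symm
      have hd : p ^ e (some i) ∣
          p ^ (min (([] : List ℤ).length + 1 + (k - r₀ + i)) (r₀ + 1)) := by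
        apply pow_dvd_pow
        simp only [he, Option.elim, List.length_nil]
        omega
      have h2 : ∀ w, ZMod.castHom (pow_dvd_pow p (hec (some i))) (ZMod (p ^ e (some i))) w =
          ZMod.castHom hd (ZMod (p ^ e (some i))) (ZMod.castHom (pow_dvd_pow p
            (min_le_right (([] : List ℤ).length + 1 + (k - r₀ + i)) (r₀ + 1))) _ w) := by
        intro w
        rw [← RingHom.comp_apply]
        congr 1
        exact Subsingleton.elim _ _
      simp only [hfl, Option.elim]
      rw [h2, h2]
      have h3 := congrArg (ZMod.castHom hd (ZMod (p ^ e (some i)))) h1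
      simp only at h3
      rw [show k - r₀ + i + 1 = k - r₀ + 1 + i by omega] at h3
      exact h3
  refine (Finset.card_le_card hall).trans (hcard.trans (le_of_eq ?_))
  rw [one_mul, Finset.prod_pow_eq_pow_sum, Fintype.sum_option]
  congr 1
  simp only [he, Option.elim]
  rw [Fin.sum_univ_eq_sum_range (fun i => r₀ + 1 - min (k - r₀ + 1 + i) (r₀ + 1)) r₀,
    Finset.sum_congr rfl (g := fun i => (2 * r₀ + 1 - k) - (i + 1)) (fun i _ => by omega),
    sum_range_tsub (by omega)]
  obtain ⟨t, ht⟩ : ∃ t, 2 * r₀ + 1 = k + t := ⟨2 * r₀ + 1 - k, by omega⟩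
  rw [show 2 * r₀ + 1 - k = t by omega, show 2 * (r₀ + 1) - k = t + 1 by omega]
  have h1 := Nat.triangle_succ t
  rw [Nat.add_sub_cancel, h1]
  omega

end Lift

section Level
open Polynomial

/-- The points of `[1, X]` in a residue class. -/
noncomputable def progr (q : ℕ) (a : ℤ) (X : ℕ) : Finset ℤ :=
  (Finset.Icc 1 (X : ℤ)).filter fun y => (q : ℤ) ∣ y - a

lemma filter_progr {q p : ℕ} [Fact p.Prime] (hq : 0 < q) (a : ℤ) (X : ℕ) (η : ZMod p) :
    (progr q a X).filter (fun y => (((y - a) / q : ℤ) : ZMod p) = η) =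
      progr (q * p) (a + q * (η.val : ℤ)) X := by
  have hq' : (q : ℤ) ≠ 0 := by exact_mod_cast hq.ne'
  have hη : ((η.val : ℤ) : ZMod p) = η := by simp
  ext y
  simp only [progr, Finset.mem_filter, and_assoc]
  refine and_congr_right fun _ => ?_
  constructor
  · rintro ⟨⟨t, ht⟩, h2⟩
    rw [ht, Int.mul_ediv_cancel_left _ hq', ← hη, ZMod.intCast_eq_intCast_iff_dvd_sub] at h2
    obtain ⟨u, hu⟩ := h2
    refine ⟨-u, ?_⟩
    push_cast
    linear_combination ht - q * hu
  · rintro ⟨u, hu⟩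
    push_cast at hu
    have h1 : y - a = q * (η.val + p * u) := by linear_combination hu
    refine ⟨⟨_, h1⟩, ?_⟩
    rw [h1, Int.mul_ediv_cancel_left _ hq']
    push_cast
    simp

lemma mod_of_mem_progr {q p : ℕ} {a : ℤ} {X : ℕ} {y : ℤ} (h : y ∈ progr (q * p) a X) :
    (p : ℤ) ∣ y - a := by
  have := (Finset.mem_filter.1 h).2
  push_cast at this
  exact (dvd_mul_left _ _).trans this

lemma card_lt_pairs_le (r : ℕ) :
    ((univ : Finset (Fin r × Fin r)).filter (fun x => x.1 < x.2)).card ≤ r * r / 2 := by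
  have h1 : ((univ : Finset (Fin r × Fin r)).filter (fun x => x.1 < x.2)).card =
      ((univ : Finset (Fin r × Fin r)).filter (fun x => x.2 < x.1)).card :=
    Finset.card_bij (fun x _ => (x.2, x.1)) (by simp) (by simp; tauto)
      (fun x hx => ⟨(x.2, x.1), by simpa using hx, rfl⟩)
  have h2 := Finset.card_union_of_disjoint
    (s := (univ : Finset (Fin r × Fin r)).filter (fun x => x.1 < x.2))
    (t := (univ : Finset (Fin r × Fin r)).filter (fun x => x.2 < x.1))
    (Finset.disjoint_filter.2 fun x _ h h' => lt_asymm h h')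
  have h3 := Finset.card_le_univ (((univ : Finset (Fin r × Fin r)).filter (fun x => x.1 < x.2)) ∪
    ((univ : Finset (Fin r × Fin r)).filter (fun x => x.2 < x.1)))
  rw [Fintype.card_prod, Fintype.card_fin] at h3
  omega

lemma exists_good_prime {r v X : ℕ} (Q : Finset ℕ) (z : Fin r → ℤ) (hz : Function.Injective z)
    (hzX : ∀ i, z i ∈ Finset.Icc 1 (X : ℤ)) (l : List ℤ) (hl : ∀ h ∈ l, h ≠ 0 ∧ |h| ≤ X)
    (hv : ∀ w : ℤ, w ≠ 0 → |w| ≤ X → (Q.filter (fun p : ℕ => (p : ℤ) ∣ w)).card ≤ v)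
    (hQ : (r * r / 2 + l.length) * v < Q.card) :
    ∃ p ∈ Q, (∀ i j, i ≠ j → ¬ (p : ℤ) ∣ z i - z j) ∧ ∀ h ∈ l, ¬ (p : ℤ) ∣ h := by
  classical
  set bad : Finset ℕ := (((univ : Finset (Fin r × Fin r)).filter (fun x => x.1 < x.2)).biUnion
    fun x => Q.filter (fun p : ℕ => (p : ℤ) ∣ z x.1 - z x.2)) ∪
      (l.toFinset.biUnion fun h => Q.filter (fun p : ℕ => (p : ℤ) ∣ h)) with hbad
  have hc : bad.card ≤ (r * r / 2 + l.length) * v := by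
    refine (Finset.card_union_le _ _).trans ?_
    rw [add_mul]
    refine add_le_add ?_ ?_
    · refine (Finset.card_biUnion_le_card_mul _ _ v ?_).trans ?_
      · rintro ⟨i, j⟩ hij
        simp only [Finset.mem_filter, Finset.mem_univ, true_and] at hij
        apply hv
        · exact sub_ne_zero.2 fun h => hij.ne (hz h)
        · have h1 := Finset.mem_Icc.1 (hzX i)
          have h2 := Finset.mem_Icc.1 (hzX j)
          rw [abs_le]; constructor <;> linarith
      · exact Nat.mul_le_mul_right _ (card_lt_pairs_le r)
    · refine (Finset.card_biUnion_le_card_mul _ _ v ?_).trans ?_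
      · intro h hh
        rw [List.mem_toFinset] at hh
        exact hv h (hl h hh).1 (hl h hh).2
      · exact Nat.mul_le_mul_right _ (List.toFinset_card_le l)
  obtain ⟨p, hp, hpb⟩ := Finset.exists_mem_notMem_of_card_lt_card (hc.trans_lt hQ)
  refine ⟨p, hp, fun i j hij hd => hpb ?_, fun h hh hd => hpb ?_⟩
  · rw [hbad, Finset.mem_union]
    left
    rw [Finset.mem_biUnion]
    rcases lt_or_gt_of_ne hij with hij | hij
    · exact ⟨(i, j), by simpa using hij, Finset.mem_filter.2 ⟨hp, hd⟩⟩
    · exact ⟨(j, i), by simpa using hij, Finset.mem_filter.2 ⟨hp, (dvd_sub_comm).1 hd⟩⟩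
  · rw [hbad, Finset.mem_union]
    right
    rw [Finset.mem_biUnion]
    exact ⟨h, List.mem_toFinset.2 hh, Finset.mem_filter.2 ⟨hp, hd⟩⟩

/-- One step of the differencing iteration for all primes of a set. -/
lemma mv_le_of_level {k N X r r' s c q v : ℕ} [NeZero N] (hr : 0 < r) (hr' : r ≤ 2 * r')
    (hs : 0 < s) (hc : c ≠ 0) (hq : 0 < q) (l : List ℤ) (hl : ∀ h ∈ l, h ≠ 0 ∧ |h| ≤ X)
    (I : Finset ℤ) (hI : I ⊆ Finset.Icc 1 (X : ℤ)) (a : ℤ) (Q : Finset ℕ)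
    (hQp : ∀ p ∈ Q, p.Prime) (hQN : ∀ p ∈ Q, p ^ c ∣ N)
    (hv : ∀ w : ℤ, w ≠ 0 → |w| ≤ X → (Q.filter (fun p : ℕ => (p : ℤ) ∣ w)).card ≤ v)
    (hQ : (r * r / 2 + l.length) * v < Q.card) (Nb : ℕ → ℕ)
    (hlift : ∀ (p : ℕ) [Fact p.Prime], p ∈ Q → (∀ h ∈ l, ¬ (p : ℤ) ∣ h) → ∀ η b,
      ((distinctRes p hc r).filter (fun ξ => liftKey p c (k - l.length) l η ξ = b)).card ≤ Nb p)
    (W U : ℕ → ℝ) (hU : ∀ p, 0 ≤ U p)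
    (hJ : ∀ p ∈ Q, ∀ a', mv₁ s (progr (q * p) a' X) (curve k N) ≤ W p)
    (hD : ∀ p ∈ Q, ∀ a', ∀ h ∈ shifts X (p ^ c), ∀ I' ⊆ Finset.Icc 1 (X : ℤ),
      mv r' I' (difs (h :: l) (curve k N)) s (progr (q * p) a' X) (curve k N) ≤ W p * U p)
    {K : ℝ} (hK : ∀ p ∈ Q, (p : ℝ) ^ (2 * s) * (Nb p * (2 ^ (r - 1) * (W p *
      ((X : ℝ) ^ r + (2 * X / (p ^ c : ℕ)) ^ r * U p ^ ((r : ℝ) / (2 * r' : ℕ)))))) ≤ K) :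
    mv r I (difs l (curve k N)) s (progr q a X) (curve k N) ≤
      max (2 * ((Q.card : ℝ) ^ 2 * K)) ((4 * r ^ 2 * X : ℝ) ^ r *
        mv₁ s (progr q a X) (curve k N)) := by
  classical
  set A : ℕ → Finset (Fin r → ℤ) := fun p => (box r I).filter fun z =>
    (∀ i j, i ≠ j → ¬ (p : ℤ) ∣ z i - z j) ∧ ∀ h ∈ l, ¬ (p : ℤ) ∣ h with hA
  refine mv_le_of_primes hr I hI _ _ _ Q A ?_ ?_
  · intro z hz hinj
    obtain ⟨p, hp, h⟩ := exists_good_prime Q z hinj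
      (fun i => hI (Fintype.mem_piFinset.1 hz i)) l hl hv hQ
    exact ⟨p, hp, Finset.mem_filter.2 ⟨hz, h⟩⟩
  · intro p hp
    have : Fact p.Prime := ⟨hQp p hp⟩
    by_cases hbad : ∀ h ∈ l, ¬ (p : ℤ) ∣ h
    swap
    · have hempty : A p = ∅ := by
        rw [hA]
        exact Finset.filter_eq_empty_iff.2 fun z _ h => hbad h.2
      have h0 : wm (A p) (tsum r (difs l (curve k N))) (box s (progr q a X))
          (tsum s (curve k N)) = 0 := by
        rw [hempty, wm_eq_card]
        simp [sols]
      rw [h0]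
      refine le_trans ?_ (hK p hp)
      have hW : 0 ≤ W p := (mv₁_nonneg _ _ _).trans (hJ p hp 0)
      have := Real.rpow_nonneg (hU p) ((r : ℝ) / (2 * r' : ℕ))
      positivity
    refine le_trans (wm_le_of_modulus (m := p ^ c) (r' := r') I hI _ _ _ (A p)
      (Finset.filter_subset _ _) hr hr' hs (fun y => (((y - a) / q : ℤ) : ZMod p)) univ
      (fun _ _ => Finset.mem_univ _) (fun _ => distinctRes p hc r)
      (fun η => liftKey p c (k - l.length) l (a + q * (η.val : ℤ))) (Nb p) ?_ ?_ ?_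
      (W := W p) (U := U p) (hU p) ?_ ?_) ?_
    · intro η _ z hz
      simp only [distinctRes, Finset.mem_filter, Finset.mem_univ, true_and]
      intro i j hij
      by_contra hne
      refine (Finset.mem_filter.1 hz).2.1 i j hne ?_
      simp only [Function.comp_apply, map_intCast] at hij
      rw [← ZMod.intCast_zmod_eq_zero_iff_dvd]
      push_cast
      rw [hij, sub_self]
    · intro η _ b
      exact hlift p hp hbad _ b
    · intro η _ x hx
      rw [filter_progr hq] at hx
      obtain ⟨⟨⟨_, h1⟩, ⟨_, h2⟩⟩, h3⟩ := mem_sols.1 hx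
      exact liftKey_eq_of_curve (hQN p hp) l _ _ _ x.1.2 x.2.2
        (fun i => mod_of_mem_progr (Fintype.mem_piFinset.1 h1 i))
        (fun i => mod_of_mem_progr (Fintype.mem_piFinset.1 h2 i)) h3
    · intro η _
      rw [filter_progr hq]
      exact hJ p hp _
    · intro η _ h hh
      rw [filter_progr hq]
      exact hD p hp _ h hh _ ((Finset.filter_subset _ _).trans hI)
    · rw [Finset.card_univ, ZMod.card]
      exact hK p hp

end Level

section Count

/-- The counting function of the Vinogradov system. -/
noncomputable def vin (s k X : ℕ) : ℕ :=
  ((box s (Finset.Icc 1 (X : ℤ)) ×ˢ box s (Finset.Icc 1 (X : ℤ))).filter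
    (fun x => ∀ j, 1 ≤ j → j ≤ k → ∑ i, x.1 i ^ j = ∑ i, x.2 i ^ j)).card

lemma mv₁_eq_card (s k N : ℕ) [NeZero N] (S : Finset ℤ) :
    mv₁ s S (curve k N) = (((box s S ×ˢ box s S).filter
      (fun x => tsum s (curve k N) x.1 = tsum s (curve k N) x.2)).card : ℝ) := by
  rw [mv₁_eq, mean_norm_sq]

lemma tsum_curve_eq_of_eq {s k N : ℕ} {x y : Fin s → ℤ}
    (h : ∀ j, 1 ≤ j → j ≤ k → ∑ i, x i ^ j = ∑ i, y i ^ j) :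
    tsum s (curve k N) x = tsum s (curve k N) y := by
  ext j
  simp only [tsum, Finset.sum_apply, curve]
  have := congrArg (Int.cast : ℤ → ZMod N) (h (j + 1) (by omega) (by omega))
  push_cast at this ⊢
  exact this

lemma vin_le_mv₁ (s k X N : ℕ) [NeZero N] :
    (vin s k X : ℝ) ≤ mv₁ s (Finset.Icc 1 (X : ℤ)) (curve k N) := by
  rw [mv₁_eq_card]
  unfold vin
  norm_cast
  apply Finset.card_le_card
  intro x hx
  rw [Finset.mem_filter] at hx ⊢
  exact ⟨hx.1, tsum_curve_eq_of_eq hx.2⟩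

lemma psum_eq_of_tsum_curve {s k N X : ℕ} (hX : 0 < X) (hN : s * X ^ k < N) {x y : Fin s → ℤ}
    (hx : ∀ i, x i ∈ Finset.Icc 1 (X : ℤ)) (hy : ∀ i, y i ∈ Finset.Icc 1 (X : ℤ))
    (h : tsum s (curve k N) x = tsum s (curve k N) y) (j : ℕ) (hj : 1 ≤ j) (hjk : j ≤ k) :
    ∑ i, x i ^ j = ∑ i, y i ^ j := by
  have h1 := congrFun h ⟨j - 1, by omega⟩
  simp only [tsum, Finset.sum_apply, curve] at h1
  rw [show j - 1 + 1 = j by omega] at h1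
  have h2 : ((∑ i, x i ^ j : ℤ) : ZMod N) = ((∑ i, y i ^ j : ℤ) : ZMod N) := by
    push_cast at h1 ⊢
    exact h1
  rw [ZMod.intCast_eq_intCast_iff_dvd_sub] at h2
  have hb : ∀ w : Fin s → ℤ, (∀ i, w i ∈ Finset.Icc 1 (X : ℤ)) →
      0 ≤ ∑ i, w i ^ j ∧ ∑ i, w i ^ j ≤ (s * X ^ k : ℕ) := by
    intro w hw
    have hw' := fun i => Finset.mem_Icc.1 (hw i)
    constructor
    · exact Finset.sum_nonneg fun i _ => pow_nonneg (by linarith [(hw' i).1]) j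
    · have h3 : ∑ i, w i ^ j ≤ ∑ _i : Fin s, (X : ℤ) ^ k := by
        refine Finset.sum_le_sum fun i _ => ?_
        calc w i ^ j ≤ (X : ℤ) ^ j := pow_le_pow_left₀ (by linarith [(hw' i).1]) (hw' i).2 j
          _ ≤ (X : ℤ) ^ k := pow_le_pow_right₀ (by exact_mod_cast hX) hjk
      rw [Finset.sum_const, Finset.card_univ, Fintype.card_fin, nsmul_eq_mul] at h3
      push_cast
      exact h3
  have hbx := hb x hx
  have hby := hb y hy
  have hN' : ((s * X ^ k : ℕ) : ℤ) < N := by exact_mod_cast hN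
  have := Int.eq_zero_of_abs_lt_dvd h2 (by rw [abs_lt]; constructor <;> linarith [hbx.1, hby.1])
  linarith

lemma psum_shift_eq {s k : ℕ} {x y : Fin s → ℤ}
    (h : ∀ j, 1 ≤ j → j ≤ k → ∑ i, x i ^ j = ∑ i, y i ^ j) (b : ℤ) (j : ℕ) (hjk : j ≤ k) :
    ∑ i, (x i + b) ^ j = ∑ i, (y i + b) ^ j := by
  simp_rw [add_pow]
  rw [Finset.sum_comm, Finset.sum_comm (s := univ)]
  refine Finset.sum_congr rfl fun n hn => ?_
  rw [← Finset.sum_mul, ← Finset.sum_mul, ← Finset.sum_mul, ← Finset.sum_mul]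
  rcases Nat.eq_zero_or_pos n with rfl | hpos
  · simp
  · rw [h n hpos (by have := Finset.mem_range.1 hn; omega)]

/-- Translation-dilation invariance. -/
lemma mv₁_progr_le {s k N X q : ℕ} [NeZero N] (hX : 0 < X) (hN : s * X ^ k < N) (hq : 0 < q)
    (a : ℤ) : mv₁ s (progr q a X) (curve k N) ≤ vin s k (X / q + 1) := by
  have hq' : (0 : ℤ) < q := by exact_mod_cast hq
  set b : ℤ := (a - 1) % q + 1 - q with hb
  set τ : ℤ → ℤ := fun y => (y - b) / q with hτ
  have hτ1 : ∀ y ∈ progr q a X, y = b + q * τ y ∧ τ y ∈ Finset.Icc 1 (((X / q + 1 : ℕ)) : ℤ) := by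
    intro y hy
    obtain ⟨h1, h2⟩ := Finset.mem_filter.1 hy
    have h1 := Finset.mem_Icc.1 h1
    have hd : (q : ℤ) ∣ y - b := by
      have : y - b = (y - a) + q * ((a - 1) / q + 1) := by
        have := Int.emod_add_mul_ediv (a - 1) q
        rw [hb]; linarith
      rw [this]
      exact dvd_add h2 (dvd_mul_right _ _)
    obtain ⟨u, hu⟩ := hd
    have hτu : τ y = u := by rw [hτ]; simp only; rw [hu, Int.mul_ediv_cancel_left _ hq'.ne']
    rw [hτu]
    refine ⟨by linarith, ?_⟩
    have hm0 := Int.emod_nonneg (a - 1) hq'.ne'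
    have hm1 := Int.emod_lt_of_pos (a - 1) hq'
    rw [Finset.mem_Icc]
    constructor
    · by_contra hlt
      have : u ≤ 0 := by omega
      have : q * u ≤ 0 := mul_nonpos_of_nonneg_of_nonpos hq'.le this
      linarith [h1.1]
    · push_cast
      have : u - 1 ≤ (X : ℤ) / q := by
        rw [Int.le_ediv_iff_mul_le hq']
        linarith [h1.2]
      linarith
  rw [mv₁_eq_card]
  unfold vin
  norm_cast
  apply Finset.card_le_card_of_injOn (fun x => (fun i => τ (x.1 i), fun i => τ (x.2 i)))
  · intro x hx
    simp only [Finset.coe_filter, Finset.mem_product, Set.mem_ofPred_eq, Fintype.mem_piFinset]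
      at hx ⊢
    obtain ⟨⟨hx1, hx2⟩, hx3⟩ := hx
    refine ⟨⟨fun i => (hτ1 _ (hx1 i)).2, fun i => (hτ1 _ (hx2 i)).2⟩, fun j hj hjk => ?_⟩
    have h4 := psum_eq_of_tsum_curve hX hN (fun i => (Finset.mem_filter.1 (hx1 i)).1)
      (fun i => (Finset.mem_filter.1 (hx2 i)).1) hx3
    have h5 := psum_shift_eq h4 (-b) j hjk
    have e : ∀ y ∈ progr q a X, (y + -b) ^ j = (q : ℤ) ^ j * τ y ^ j := by
      intro y hy
      rw [← mul_pow]; congr 1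
      linarith [(hτ1 y hy).1]
    rw [Finset.sum_congr rfl fun i _ => e _ (hx1 i), Finset.sum_congr rfl fun i _ => e _ (hx2 i),
      ← Finset.mul_sum, ← Finset.mul_sum] at h5
    exact mul_left_cancel₀ (pow_ne_zero _ hq'.ne') h5
  · intro x hx y hy hxy
    simp only [Finset.coe_filter, Finset.mem_product, Set.mem_ofPred_eq, Fintype.mem_piFinset]
      at hx hy
    rw [Prod.mk.injEq] at hxy
    refine Prod.ext (funext fun i => ?_) (funext fun i => ?_)
    · rw [(hτ1 _ (hx.1.1 i)).1, (hτ1 _ (hy.1.1 i)).1, congrFun hxy.1 i]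
    · rw [(hτ1 _ (hx.1.2 i)).1, (hτ1 _ (hy.1.2 i)).1, congrFun hxy.2 i]

lemma progr_one (X : ℕ) : progr 1 0 X = Finset.Icc 1 (X : ℤ) := by
  simp [progr]

lemma mv_nil_eq (r s k N X : ℕ) [NeZero N] :
    mv r (Finset.Icc 1 (X : ℤ)) (difs [] (curve k N)) s (progr 1 0 X) (curve k N) =
      mv₁ (s + r) (Finset.Icc 1 (X : ℤ)) (curve k N) := by
  rw [mv_eq, progr_one, mv₁]
  congr 1
  ext ψ
  rw [norm_esum_box, ← pow_mul, show difs [] (curve k N) = curve k N from rfl, ← pow_add]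
  congr 1
  ring

lemma vin_le_trivial (s k X : ℕ) : (vin s k X : ℝ) ≤ (X : ℝ) ^ (2 * s) := by
  have : vin s k X ≤ (box s (Finset.Icc 1 (X : ℤ)) ×ˢ box s (Finset.Icc 1 (X : ℤ))).card := by
    unfold vin
    exact Finset.card_filter_le _ _
  rw [Finset.card_product, Fintype.card_piFinset] at this
  simp only [Int.card_Icc, add_sub_cancel_right, Int.toNat_natCast, Finset.prod_const,
    Finset.card_univ, Fintype.card_fin] at this
  rw [← pow_add, ← two_mul] at this
  exact_mod_cast this

lemma vin_self_le (k X : ℕ) : (vin k k X : ℝ) ≤ (k : ℝ) ^ k * (X : ℝ) ^ k := by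
  classical
  have h : vin k k X ≤ k ^ k * (box k (Finset.Icc 1 (X : ℤ))).card := by
    unfold vin
    refine Finset.card_le_mul_card_image_of_maps_to (f := Prod.fst)
      (fun x hx => (Finset.mem_product.1 (Finset.mem_filter.1 hx).1).1) _ ?_
    intro x _
    calc _ ≤ ((univ : Finset (Fin k → Fin k)).image fun σ : Fin k → Fin k => (x, x ∘ σ)).card := by
          apply Finset.card_le_card
          intro w hw
          simp only [Finset.mem_filter] at hw
          obtain ⟨⟨_, hw⟩, rfl⟩ := hw
          have hmem : ∀ l, ∃ i, w.2 l = w.1 i := by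
            intro l
            have h0 := prod_sub_eq_of_psum (R := ℚ) (r := k)
              (fun n h0 _ => by
                rw [isUnit_iff_ne_zero]
                exact_mod_cast h0.ne')
              (fun i => (w.1 i : ℚ)) (fun i => (w.2 i : ℚ))
              (fun j h1 h2 => by exact_mod_cast hw j h1 h2) (w.2 l)
            rw [Finset.prod_eq_zero (f := fun i => ((w.2 l : ℚ) - w.2 i)) (Finset.mem_univ l)
              (sub_self _)] at h0
            obtain ⟨i, _, hi⟩ := Finset.prod_eq_zero_iff.1 h0
            exact ⟨i, by exact_mod_cast sub_eq_zero.1 hi⟩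
          choose σ hσ using hmem
          exact Finset.mem_image.2 ⟨σ, Finset.mem_univ _,
            Prod.ext rfl (funext fun l => (hσ l).symm)⟩
      _ ≤ k ^ k := by
          refine Finset.card_image_le.trans (le_of_eq ?_)
          simp
  rw [Fintype.card_piFinset] at h
  simp only [Int.card_Icc, add_sub_cancel_right, Int.toNat_natCast, Finset.prod_const,
    Finset.card_univ, Fintype.card_fin] at h
  exact_mod_cast h

end Count
section Primes

lemma centralBinom_le_card_primes (n : ℕ) (hn : 2 < n) :
    n.centralBinom ≤ (2 * n) ^ (Nat.sqrt (2 * n) + ((Finset.Ioc n (2 * n)).filter Nat.Prime).card)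
      * 4 ^ (2 * n / 3) := by
  have n2_pos : 1 ≤ 2 * n := by omega
  set f : ℕ → ℕ := fun x => x ^ n.centralBinom.factorization x
  set S := (Finset.range (2 * n + 1)).filter Nat.Prime
  have hS : n.centralBinom = ∏ x ∈ S, f x := by
    rw [← n.prod_pow_factorization_centralBinom]
    symm
    refine Finset.prod_filter_of_ne fun p _ h => ?_
    contrapose h
    dsimp only [f]
    rw [Nat.factorization_eq_zero_of_not_prime n.centralBinom h, _root_.pow_zero]
  set S₁ := S.filter (fun p => p ≤ Nat.sqrt (2 * n) ∨ n < p)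
  have h₁ : ∏ x ∈ S₁, f x ≤
      (2 * n) ^ (Nat.sqrt (2 * n) + ((Finset.Ioc n (2 * n)).filter Nat.Prime).card) := by
    refine (Finset.prod_le_prod' fun p _ => (?_ : f p ≤ 2 * n)).trans ?_
    · exact Nat.pow_factorization_choose_le (by omega)
    rw [Finset.prod_const]
    refine pow_right_mono₀ n2_pos ?_
    have hsub : S₁ ⊆ Finset.Icc 1 (Nat.sqrt (2 * n)) ∪ (Finset.Ioc n (2 * n)).filter Nat.Prime := by
      intro p hp
      simp only [S₁, S, Finset.mem_filter, Finset.mem_range] at hp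
      simp only [Finset.mem_union, Finset.mem_Icc, Finset.mem_filter, Finset.mem_Ioc]
      rcases hp.2 with h | h
      · exact Or.inl ⟨hp.1.2.one_lt.le, h⟩
      · exact Or.inr ⟨⟨h, by omega⟩, hp.1.2⟩
    refine (Finset.card_le_card hsub).trans ((Finset.card_union_le _ _).trans ?_)
    simp
  have h₂ : ∏ x ∈ S.filter (fun p => ¬ (p ≤ Nat.sqrt (2 * n) ∨ n < p)), f x ≤ 4 ^ (2 * n / 3) := by
    refine le_trans ?_ (primorial_le_four_pow (2 * n / 3))
    rw [← Finset.prod_filter_mul_prod_filter_not _ (fun p => p ≤ 2 * n / 3)]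
    rw [Finset.prod_eq_one (s := Finset.filter (fun p => ¬ p ≤ 2 * n / 3) _), mul_one]
    · refine (Finset.prod_le_prod' fun p hp => (?_ : f p ≤ p)).trans ?_
      · simp only [S, Finset.mem_filter, not_or, not_le, not_lt] at hp
        refine (pow_right_mono₀ hp.1.1.2.one_lt.le ?_).trans (pow_one p).le
        exact Nat.factorization_choose_le_one (Nat.sqrt_lt'.mp hp.1.2.1)
      · refine Finset.prod_le_prod_of_subset_of_one_le' ?_ ?_
        · intro p hp
          simp only [S, Finset.mem_filter, not_or, not_le, not_lt, Finset.mem_range] at hp ⊢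
          exact ⟨by omega, hp.1.1.2⟩
        · intro p hp _
          exact (Finset.mem_filter.1 hp).2.one_lt.le
    · intro p hp
      simp only [S, Finset.mem_filter, not_or, not_le, not_lt, Finset.mem_range] at hp
      dsimp only [f]
      rw [Nat.factorization_centralBinom_of_two_mul_self_lt_three_mul hn hp.1.2.2 (by omega),
        pow_zero]
  rw [hS, ← Finset.prod_filter_mul_prod_filter_not S (fun p => p ≤ Nat.sqrt (2 * n) ∨ n < p)]
  exact Nat.mul_le_mul h₁ h₂

lemma four_pow_le_of_card_primes (n : ℕ) (hn : 4 ≤ n) :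
    (4 : ℝ) ^ ((n : ℝ) / 3) ≤ (2 * n : ℝ) ^
      (√(2 * n) + (((Finset.Ioc n (2 * n)).filter Nat.Prime).card : ℝ) + 1) := by
  set m := ((Finset.Ioc n (2 * n)).filter Nat.Prime).card
  have h₁ := (Nat.four_pow_lt_mul_centralBinom n hn).le
  have h₂ := centralBinom_le_card_primes n (by omega)
  have h₃ : (4 : ℝ) ^ n ≤ (2 * n : ℝ) ^ (√(2 * n) + (m : ℝ) + 1) * (4 : ℝ) ^ (2 * (n : ℝ) / 3) := by
    have h2n : (1 : ℝ) ≤ 2 * n := by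
      have : (4 : ℝ) ≤ n := by exact_mod_cast hn
      linarith
    calc (4 : ℝ) ^ n ≤ (n : ℝ) * (((2 * n) ^ (Nat.sqrt (2 * n) + m) * 4 ^ (2 * n / 3) : ℕ) : ℝ) := by
          exact_mod_cast h₁.trans (Nat.mul_le_mul le_rfl h₂)
      _ ≤ (2 * n : ℝ) * ((2 * n : ℝ) ^ (√(2 * n) + (m : ℝ)) * (4 : ℝ) ^ (2 * (n : ℝ) / 3)) := by
          push_cast
          gcongr ?_ * (?_ * ?_)
          · linarith
          · rw [← Real.rpow_natCast]
            refine Real.rpow_le_rpow_of_exponent_le h2n ?_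
            push_cast
            have := Real.nat_sqrt_le_real_sqrt (a := 2 * n)
            push_cast at this
            linarith
          · rw [← Real.rpow_natCast]
            refine Real.rpow_le_rpow_of_exponent_le (by norm_num) ?_
            have := Nat.cast_div_le (m := 2 * n) (n := 3) (α := ℝ)
            push_cast at this
            exact this
      _ = _ := by
          rw [Real.rpow_add (by linarith) _ 1, Real.rpow_one]
          ring
  rw [← Real.rpow_natCast] at h₃
  have h₄ : (4 : ℝ) ^ (n : ℝ) = (4 : ℝ) ^ ((n : ℝ) / 3) * (4 : ℝ) ^ (2 * (n : ℝ) / 3) := by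
    rw [← Real.rpow_add (by norm_num)]
    congr 1; ring
  rw [h₄] at h₃
  exact le_of_mul_le_mul_right h₃ (by positivity)

lemma card_primes_dvd_le {n v : ℕ} {X : ℝ} {Q : Finset ℕ} (hQ : ∀ p ∈ Q, p.Prime ∧ n < p)
    (hX : X < ((n : ℝ) + 1) ^ (v + 1)) {w : ℤ} (hw : w ≠ 0)
    (hwX : ((|w| : ℤ) : ℝ) ≤ X) : (Q.filter (fun p : ℕ => (p : ℤ) ∣ w)).card ≤ v := by
  by_contra! hlt
  set R := Q.filter (fun p : ℕ => (p : ℤ) ∣ w)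
  have h₁ : ∏ p ∈ R, p ∣ w.natAbs := by
    apply Finset.prod_primes_dvd
    · intro p hp
      exact (hQ p (Finset.mem_filter.1 hp).1).1.prime
    · intro p hp
      exact Int.natCast_dvd.1 (Finset.mem_filter.1 hp).2
  have h₂ : (n + 1) ^ R.card ≤ ∏ p ∈ R, p := by
    rw [← Finset.prod_const]
    exact Finset.prod_le_prod' fun p hp => (hQ p (Finset.mem_filter.1 hp).1).2
  have h₃ : (n + 1) ^ R.card ≤ w.natAbs :=
    h₂.trans (Nat.le_of_dvd (Int.natAbs_pos.2 hw) h₁)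
  have h₄ : ((n : ℝ) + 1) ^ R.card ≤ X := by
    refine le_trans ?_ hwX
    have : (((n + 1) ^ R.card : ℕ) : ℝ) ≤ ((w.natAbs : ℕ) : ℝ) := by exact_mod_cast h₃
    rw [Nat.cast_natAbs] at this
    push_cast at this ⊢
    exact this
  have h₅ : ((n : ℝ) + 1) ^ (v + 1) ≤ ((n : ℝ) + 1) ^ R.card :=
    pow_le_pow_right₀ (by have : (0 : ℝ) ≤ n := n.cast_nonneg
                          linarith) hlt
  linarith

/-- The number of primes used in the sieving argument. -/
def numPrimes (k : ℕ) : ℕ := (k * k / 2) * (53 * k / 50) + 1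

lemma numPrimes_le (k : ℕ) : (numPrimes k : ℝ) ≤ 0.53 * (k : ℝ) ^ 3 + 1 := by
  have h₁ : ((k * k / 2 : ℕ) : ℝ) ≤ (k : ℝ) * k / 2 := by
    have := Nat.cast_div_le (m := k * k) (n := 2) (α := ℝ)
    push_cast at this
    exact this
  have h₂ : ((53 * k / 50 : ℕ) : ℝ) ≤ 53 * (k : ℝ) / 50 := by
    have := Nat.cast_div_le (m := 53 * k) (n := 50) (α := ℝ)
    push_cast at this
    exact this
  unfold numPrimes
  rw [Nat.cast_add, Nat.cast_mul, Nat.cast_one]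
  have := mul_le_mul h₁ h₂ (Nat.cast_nonneg _) (by positivity)
  nlinarith

lemma log_ge {k : ℕ} (hk : 129 ≤ k) : (4.852 : ℝ) ≤ Real.log k := by
  have h₁ : (7 : ℝ) * Real.log 2 ≤ Real.log k := by
    rw [← Real.log_rpow (by norm_num)]
    apply Real.log_le_log (by positivity)
    have : (129 : ℝ) ≤ k := by exact_mod_cast hk
    norm_num
    linarith
  have := Real.log_two_gt_d9
  linarith

lemma exists_primes {k : ℕ} (hk : 129 ≤ k) {P : ℝ} (hP : (k : ℝ) ^ (3.85 : ℝ) ≤ P) :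
    ∃ Q : Finset ℕ, Q.card = numPrimes k ∧
      ∀ p ∈ Q, p.Prime ∧ ⌊P / 2⌋₊ < p ∧ p ≤ 2 * ⌊P / 2⌋₊ := by
  have hk0 : (0 : ℝ) < k := by positivity
  have hP0 : 0 < P := lt_of_lt_of_le (by positivity) hP
  set n := ⌊P / 2⌋₊ with hn
  set u := Real.log P with hu
  have hPu : P = Real.exp u := (Real.exp_log hP0).symm
  have hku : 3.85 * Real.log k ≤ u := by
    rw [hu, ← Real.log_rpow hk0]
    exact Real.log_le_log (by positivity) hP
  have hu1 : 18.68 ≤ u := by linarith [log_ge hk]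
  set T := Real.exp (60 / 77 * u) with hT
  have hkT : (k : ℝ) ^ 3 ≤ T := by
    rw [← Real.exp_log hk0, ← Real.exp_nat_mul, hT]
    apply Real.exp_le_exp.2
    push_cast
    linarith
  have he : (2.718 : ℝ) ≤ Real.exp 1 := by linarith [Real.exp_one_gt_d9]
  have he4 : (54.5 : ℝ) ≤ Real.exp 4 := by
    have : Real.exp 4 = Real.exp 1 ^ 4 := by rw [← Real.exp_nat_mul]; norm_num
    rw [this]
    exact le_trans (by norm_num) (pow_le_pow_left₀ (by norm_num) he 4)
  have he5 : (148 : ℝ) ≤ Real.exp 5 := by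
    have : Real.exp 5 = Real.exp 1 ^ 5 := by rw [← Real.exp_nat_mul]; norm_num
    rw [this]
    exact le_trans (by norm_num) (pow_le_pow_left₀ (by norm_num) he 5)
  have hP1 : T * (54.5 * (17 / 77 * u - 3)) ≤ P := by
    have h₁ : P = T * (Real.exp 4 * Real.exp (17 / 77 * u - 4)) := by
      rw [hPu, hT, ← Real.exp_add, ← Real.exp_add]
      congr 1; ring
    have h₂ := Real.add_one_le_exp (17 / 77 * u - 4)
    rw [h₁]
    gcongr
    · linarith
    · linarith
  have hP2 : √P * u ≤ 0.2 * T := by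
    have h₁ : T = √P * (Real.exp 5 * Real.exp (43 / 154 * u - 5)) := by
      rw [hPu, ← Real.exp_half, hT, ← Real.exp_add, ← Real.exp_add]
      congr 1; ring
    have h₂ := Real.add_one_le_exp (43 / 154 * u - 5)
    have h₃ : u ≤ 0.2 * (148 * (43 / 154 * u - 4)) := by linarith
    have h₄ : 148 * (43 / 154 * u - 4) ≤ Real.exp 5 * Real.exp (43 / 154 * u - 5) := by
      gcongr
      · linarith
      · linarith
    rw [h₁]
    calc √P * u ≤ √P * (0.2 * (Real.exp 5 * Real.exp (43 / 154 * u - 5))) := by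
          gcongr
          linarith
      _ = _ := by ring
  have hT1 : 1 ≤ T := by
    rw [hT]; exact Real.one_le_exp (by linarith)
  have hPT : T ≤ P := by nlinarith
  have hP100 : 100 ≤ P := by
    have : (129 : ℝ) ≤ k := by exact_mod_cast hk
    have h3 : (129 : ℝ) ^ 3 ≤ (k : ℝ) ^ 3 := pow_le_pow_left₀ (by norm_num) this 3
    norm_num at h3
    linarith
  have hn1 : (n : ℝ) ≤ P / 2 := Nat.floor_le (by positivity)
  have hn2 : P / 2 < n + 1 := Nat.lt_floor_add_one _
  have hn4 : 4 ≤ n := by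
    have : (3 : ℝ) < n := by linarith
    exact_mod_cast this
  suffices h : numPrimes k ≤ ((Finset.Ioc n (2 * n)).filter Nat.Prime).card by
    obtain ⟨Q, hQ, hc⟩ := Finset.exists_subset_card_eq h
    refine ⟨Q, hc, fun p hp => ?_⟩
    have := Finset.mem_filter.1 (hQ hp)
    exact ⟨this.2, (Finset.mem_Ioc.1 this.1).1, (Finset.mem_Ioc.1 this.1).2⟩
  by_contra! hlt
  set m := ((Finset.Ioc n (2 * n)).filter Nat.Prime).card
  have hm : (m : ℝ) ≤ 0.53 * T := by
    have h₁ : (m : ℝ) + 1 ≤ numPrimes k := by exact_mod_cast hlt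
    linarith [numPrimes_le k]
  have h := four_pow_le_of_card_primes n hn4
  have hlog := Real.log_le_log (by positivity) h
  have h2n : (0 : ℝ) < 2 * n := by linarith
  rw [Real.log_rpow (by norm_num), Real.log_rpow h2n] at hlog
  have hlog4 : Real.log 4 = 2 * Real.log 2 := by
    rw [show (4 : ℝ) = 2 ^ (2 : ℝ) by norm_num, Real.log_rpow (by norm_num)]
  have hlog2 := Real.log_two_gt_d9
  have h₅ : Real.log (2 * n) ≤ u := Real.log_le_log h2n (by linarith)
  have h₆ : √(2 * n) ≤ √P := Real.sqrt_le_sqrt (by linarith)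
  have h₇ : 1 ≤ √P := Real.one_le_sqrt.2 (by linarith)
  have h₈ : (√(2 * n) + (m : ℝ) + 1) * Real.log (2 * n) ≤ (2 * √P + 0.53 * T) * u := by
    apply mul_le_mul
    · linarith
    · exact h₅
    · exact Real.log_nonneg (by linarith)
    · positivity
  have h₉ : 0.231 * (P - 2) ≤ (n : ℝ) / 3 * Real.log 4 := by
    rw [hlog4]
    nlinarith
  have h₁₀ : 0.231 * (P - 2) ≤ 0.4 * T + 0.53 * T * u := by nlinarith
  have h₁₁ : 0 < T * (2 * u - 36) := by
    apply mul_pos <;> linarith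
  nlinarith

lemma card_primes_dvd_le_of_le {k : ℕ} (hk : 129 ≤ k) {P X : ℝ} (hP : (k : ℝ) ^ (3.85 : ℝ) ≤ P)
    (hX : X ≤ P ^ ((k : ℝ) + 2)) {Q : Finset ℕ} (hQ : ∀ p ∈ Q, p.Prime ∧ ⌊P / 2⌋₊ < p)
    {w : ℤ} (hw : w ≠ 0) (hwX : ((|w| : ℤ) : ℝ) ≤ X) :
    (Q.filter (fun p : ℕ => (p : ℤ) ∣ w)).card ≤ 53 * k / 50 := by
  refine card_primes_dvd_le hQ (lt_of_le_of_lt hX ?_) hw hwX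
  have hk0 : (0 : ℝ) < k := by positivity
  have hP0 : 0 < P := lt_of_lt_of_le (by positivity) hP
  have hku : 3.85 * Real.log k ≤ Real.log P := by
    rw [← Real.log_rpow hk0]
    exact Real.log_le_log (by positivity) hP
  have hu1 : 18.68 ≤ Real.log P := by linarith [log_ge hk]
  have hlog2 := Real.log_two_lt_d9
  have hk' : (129 : ℝ) ≤ k := by exact_mod_cast hk
  have hv : 53 * (k : ℝ) / 50 ≤ ((53 * k / 50 + 1 : ℕ) : ℝ) := by
    have : 53 * k ≤ 50 * (53 * k / 50 + 1) := by omega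
    have h' : ((53 * k : ℕ) : ℝ) ≤ ((50 * (53 * k / 50 + 1) : ℕ) : ℝ) := by exact_mod_cast this
    push_cast at h' ⊢
    linarith
  have hlogP : Real.log (P / 2) = Real.log P - Real.log 2 := Real.log_div hP0.ne' (by norm_num)
  have h₁ : P ^ ((k : ℝ) + 2) ≤ (P / 2) ^ ((53 * k / 50 + 1 : ℕ) : ℝ) := by
    rw [Real.rpow_def_of_pos hP0, Real.rpow_def_of_pos (by positivity)]
    apply Real.exp_le_exp.2
    rw [hlogP]
    calc Real.log P * (k + 2) ≤ (Real.log P - Real.log 2) * (53 * (k : ℝ) / 50) := by nlinarith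
      _ ≤ _ := by
          apply mul_le_mul_of_nonneg_left hv
          linarith
  refine lt_of_le_of_lt h₁ ?_
  rw [Real.rpow_natCast]
  exact pow_lt_pow_left₀ (Nat.lt_floor_add_one _) (by positivity) (by omega)

end Primes

section LevelReal

lemma level_real {X P p W E e β g B : ℝ} {r c s t : ℕ} (hr : 0 < r) (hc : 0 < c) (hX : 1 ≤ X)
    (hp : 0 < p) (hpP : p ≤ P) (hPp : P ≤ 2 * p) (hW : 0 ≤ W) (hPc : P = X ^ (β / c))
    (he : 2 * s - E + t = e) (he0 : 0 ≤ e) (hg : c * r - e ≤ g) (hg0 : 0 ≤ g) (hB : 1 ≤ B) :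
    p ^ (2 * s) * ((r.factorial * p ^ t) * (2 ^ (r - 1) * ((W * p ^ (-E)) *
      (X ^ r + (2 * X / p ^ c) ^ r * (B * X ^ (β * r)))))) ≤
    W * (r.factorial * (2 : ℝ) ^ (2 * r + g) * B) * X ^ (r + β * e / c) := by
  have hX0 : 0 < X := by linarith
  have hP0 : 0 < P := by linarith
  have hcr : (0 : ℝ) < c := by exact_mod_cast hc
  have hPcr : X ^ (β * r) = P ^ ((c : ℝ) * r) := by
    rw [hPc, ← Real.rpow_mul hX0.le]
    congr 1
    field_simp
  have hPe : X ^ (β * e / c) = P ^ e := by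
    rw [hPc, ← Real.rpow_mul hX0.le]
    congr 1
    field_simp
  have h₁ : p ^ (2 * s) * p ^ t * p ^ (-E) = p ^ e := by
    rw [← Real.rpow_natCast, ← Real.rpow_natCast, ← Real.rpow_add hp, ← Real.rpow_add hp, ← he]
    congr 1
    push_cast
    ring
  have h₂ : p ^ e * (X ^ r) ≤ P ^ e * X ^ r := by gcongr
  have h₃ : p ^ e * ((2 * X / p ^ c) ^ r * (B * X ^ (β * r))) ≤
      (2 : ℝ) ^ ((r : ℝ) + g) * B * (P ^ e * X ^ r) := by
    have h₄ : P ^ ((c : ℝ) * r) = P ^ e * P ^ ((c : ℝ) * r - e) := by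
      rw [← Real.rpow_add hP0]; congr 1; ring
    have h₅ : (p ^ c) ^ r = p ^ e * p ^ ((c : ℝ) * r - e) := by
      rw [← Real.rpow_add hp, ← pow_mul, ← Real.rpow_natCast]; congr 1; push_cast; ring
    have h₆ : P ^ ((c : ℝ) * r - e) ≤ 2 ^ g * p ^ ((c : ℝ) * r - e) := by
      have h₇ : (P / p) ^ ((c : ℝ) * r - e) ≤ 2 ^ g := by
        calc (P / p) ^ ((c : ℝ) * r - e) ≤ (P / p) ^ g :=
              Real.rpow_le_rpow_of_exponent_le ((one_le_div hp).2 hpP) hg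
          _ ≤ 2 ^ g := Real.rpow_le_rpow (by positivity) ((div_le_iff₀ hp).2 hPp) hg0
      rw [Real.div_rpow hP0.le hp.le] at h₇
      rwa [div_le_iff₀ (by positivity)] at h₇
    rw [hPcr, h₄, div_pow, h₅, mul_pow, Real.rpow_add (by norm_num), Real.rpow_natCast]
    have hpe : 0 < p ^ e := by positivity
    have hpd : 0 < p ^ ((c : ℝ) * r - e) := by positivity
    calc p ^ e * (2 ^ r * X ^ r / (p ^ e * p ^ ((c : ℝ) * r - e)) *
          (B * (P ^ e * P ^ ((c : ℝ) * r - e))))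
        = 2 ^ r * X ^ r * B * P ^ e * (P ^ ((c : ℝ) * r - e) / p ^ ((c : ℝ) * r - e)) := by
          field_simp
      _ ≤ 2 ^ r * X ^ r * B * P ^ e * 2 ^ g := by
          gcongr
          exact (div_le_iff₀ hpd).2 h₆
      _ = _ := by ring
  have h2 : (1 : ℝ) ≤ (2 : ℝ) ^ ((r : ℝ) + g) * B := by
    have := Real.one_le_rpow (x := 2) (z := (r : ℝ) + g) (by norm_num) (by positivity)
    nlinarith
  rw [Real.rpow_add hX0, hPe, Real.rpow_natCast]
  have h2r : (2 : ℝ) ^ (2 * (r : ℝ) + g) = 2 ^ (r - 1) * 2 * (2 : ℝ) ^ ((r : ℝ) + g) := by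
    rw [← pow_succ, Nat.sub_add_cancel hr, ← Real.rpow_natCast, ← Real.rpow_add (by norm_num)]
    congr 1; ring
  rw [h2r]
  calc _ = W * r.factorial * 2 ^ (r - 1) * (p ^ (2 * s) * p ^ t * p ^ (-E) * X ^ r +
        p ^ (2 * s) * p ^ t * p ^ (-E) * ((2 * X / p ^ c) ^ r * (B * X ^ (β * r)))) := by ring
    _ = W * r.factorial * 2 ^ (r - 1) * (p ^ e * X ^ r +
        p ^ e * ((2 * X / p ^ c) ^ r * (B * X ^ (β * r)))) := by rw [h₁]
    _ ≤ W * r.factorial * 2 ^ (r - 1) * (2 * ((2 : ℝ) ^ ((r : ℝ) + g) * B * (P ^ e * X ^ r))) := by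
        gcongr
        have : P ^ e * X ^ r ≤ (2 : ℝ) ^ ((r : ℝ) + g) * B * (P ^ e * X ^ r) :=
          le_mul_of_one_le_left (by positivity) h2
        linarith
    _ = _ := by ring

/-- The weight attached to a residue class modulo `q`. -/
noncomputable def wt (C E : ℝ) (X q : ℕ) : ℝ := 2 * C * ((X : ℝ) / q) ^ E

lemma wt_nonneg {C : ℝ} (hC : 0 ≤ C) (E : ℝ) (X q : ℕ) : 0 ≤ wt C E X q := by
  unfold wt; positivity

lemma wt_mul (C E : ℝ) (X q p : ℕ) : wt C E X (q * p) = wt C E X q * (p : ℝ) ^ (-E) := by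
  unfold wt
  rw [Nat.cast_mul, ← div_div, Real.div_rpow (by positivity) (by positivity),
    Real.rpow_neg (by positivity)]
  ring

lemma mv_le_level_of_params {k N X r r' s c q t : ℕ} [NeZero N] (hk : 129 ≤ k) (hX : 1 ≤ X)
    (hr : 0 < r) (hr' : r ≤ 2 * r') (hs : 0 < s) (hc : 0 < c) (hq : 0 < q) (l : List ℤ)
    (hl : ∀ h ∈ l, h ≠ 0 ∧ |h| ≤ X) (hrl : r * r / 2 + l.length ≤ k * k / 2)
    (I : Finset ℤ) (hI : I ⊆ Finset.Icc 1 (X : ℤ)) (a : ℤ)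
    {C E e β g B P : ℝ} (hC : 0 ≤ C) (hB : 1 ≤ B) (hPc : P = (X : ℝ) ^ (β / c)) (hβ : 0 ≤ β)
    (hβc : β ≤ c)
    (hP : (k : ℝ) ^ (3.85 : ℝ) ≤ P) (hXP : (X : ℝ) ≤ P ^ ((k : ℝ) + 2))
    (hN : ∀ p : ℕ, 0 < p → p ≤ X → p ^ c ∣ N)
    (hlift : ∀ (p : ℕ) [Fact p.Prime], k < p → (∀ h ∈ l, ¬ (p : ℤ) ∣ h) → ∀ η b,
      ((distinctRes p hc.ne' r).filter
        (fun ξ => liftKey p c (k - l.length) l η ξ = b)).card ≤ r.factorial * p ^ t)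
    (he : 2 * s - E + t = e) (he0 : 0 ≤ e) (hg : c * r - e ≤ g) (hg0 : 0 ≤ g)
    (hJ₀ : mv₁ s (progr q a X) (curve k N) ≤ wt C E X q)
    (hJ : ∀ p : ℕ, 0 < p → (p : ℝ) ≤ P → ∀ a',
      mv₁ s (progr (q * p) a' X) (curve k N) ≤ wt C E X (q * p))
    (hD : ∀ p : ℕ, 0 < p → (p : ℝ) ≤ P → ∀ a', ∀ h ∈ shifts X (p ^ c),
      ∀ I' ⊆ Finset.Icc 1 (X : ℤ),
      mv r' I' (difs (h :: l) (curve k N)) s (progr (q * p) a' X) (curve k N) ≤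
        wt C E X (q * p) * (B * (X : ℝ) ^ (2 * β * r'))) :
    mv r I (difs l (curve k N)) s (progr q a X) (curve k N) ≤
      wt C E X q * max (2 * (numPrimes k : ℝ) ^ 2 *
        (r.factorial * (2 : ℝ) ^ (2 * r + g) * B ^ ((r : ℝ) / (2 * r' : ℕ))))
        ((4 * r ^ 2 : ℝ) ^ r) * (X : ℝ) ^ (r + β * e / c) := by
  have hX1 : (1 : ℝ) ≤ X := by exact_mod_cast hX
  have hX0 : (0 : ℝ) < X := by linarith
  have hcr : (0 : ℝ) < c := by exact_mod_cast hc
  have hk0 : (0 : ℝ) < k := by positivity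
  have hk1 : (1 : ℝ) < k := by exact_mod_cast (show 1 < k by omega)
  have hP0 : 0 < P := lt_of_lt_of_le (by positivity) hP
  have hPX : P ≤ X := by
    rw [hPc]
    calc (X : ℝ) ^ (β / c) ≤ (X : ℝ) ^ (1 : ℝ) :=
          Real.rpow_le_rpow_of_exponent_le hX1 ((div_le_one hcr).2 hβc)
      _ = X := Real.rpow_one _
  have h2k : 2 * (k : ℝ) ≤ P := by
    refine le_trans ?_ hP
    calc 2 * (k : ℝ) ≤ (k : ℝ) ^ (2 : ℝ) := by
          rw [Real.rpow_two]
          have : (2 : ℝ) ≤ k := by exact_mod_cast (show 2 ≤ k by omega)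
          nlinarith
      _ ≤ _ := Real.rpow_le_rpow_of_exponent_le hk1.le (by norm_num)
  obtain ⟨Q, hQc, hQ⟩ := exists_primes hk hP
  have hr'0 : 0 < r' := by omega
  have hQP : ∀ p ∈ Q, (p : ℝ) ≤ P ∧ P ≤ 2 * p ∧ k < p := by
    intro p hp
    have h₁ : P / 2 < ⌊P / 2⌋₊ + 1 := Nat.lt_floor_add_one _
    have h₂ : (⌊P / 2⌋₊ : ℝ) ≤ P / 2 := Nat.floor_le (by positivity)
    have h₃ : ((⌊P / 2⌋₊ + 1 : ℕ) : ℝ) ≤ p := by exact_mod_cast (hQ p hp).2.1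
    have h₄ : (p : ℝ) ≤ ((2 * ⌊P / 2⌋₊ : ℕ) : ℝ) := by exact_mod_cast (hQ p hp).2.2
    push_cast at h₃ h₄
    refine ⟨by linarith, by linarith, ?_⟩
    have : (k : ℝ) < p := by linarith
    exact_mod_cast this
  have hkey := mv_le_of_level (k := k) (N := N) (X := X) (r := r) (r' := r') (s := s) (c := c)
    (q := q) (v := 53 * k / 50) hr hr' hs hc.ne' hq l hl I hI a Q (fun p hp => (hQ p hp).1)
    (fun p hp => hN p (hQ p hp).1.pos (by exact_mod_cast (hQP p hp).1.trans hPX))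
    (fun w hw hwX => card_primes_dvd_le_of_le hk hP hXP (fun p hp => ⟨(hQ p hp).1, (hQ p hp).2.1⟩)
      hw (by exact_mod_cast hwX))
    (by
      rw [hQc, numPrimes]
      exact Nat.lt_succ_of_le (Nat.mul_le_mul hrl le_rfl))
    (fun p => r.factorial * p ^ t)
    (fun p _ hp hl' η b => hlift p (hQP p hp).2.2 hl' η b)
    (fun p => wt C E X (q * p)) (fun _ => B * (X : ℝ) ^ (2 * β * r'))
    (fun _ => by positivity)
    (fun p hp a' => hJ p (hQ p hp).1.pos (hQP p hp).1 a')
    (fun p hp a' h hh I' hI' => hD p (hQ p hp).1.pos (hQP p hp).1 a' h hh I' hI')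
    (K := wt C E X q * (r.factorial * (2 : ℝ) ^ (2 * r + g) * B ^ ((r : ℝ) / (2 * r' : ℕ))) *
      (X : ℝ) ^ (r + β * e / c)) ?_
  · refine hkey.trans ?_
    have hw := wt_nonneg hC E X q
    have hXe : (X : ℝ) ^ r ≤ (X : ℝ) ^ (r + β * e / c) := by
      rw [← Real.rpow_natCast]
      exact Real.rpow_le_rpow_of_exponent_le hX1 (le_add_of_nonneg_right (by positivity))
    apply max_le
    · rw [hQc]
      calc _ = wt C E X q * (2 * (numPrimes k : ℝ) ^ 2 *
            (r.factorial * (2 : ℝ) ^ (2 * r + g) * B ^ ((r : ℝ) / (2 * r' : ℕ)))) *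
            (X : ℝ) ^ (r + β * e / c) := by ring
        _ ≤ _ := by
          gcongr
          exact le_max_left _ _
    · calc (4 * r ^ 2 * X : ℝ) ^ r * mv₁ s (progr q a X) (curve k N)
          ≤ (4 * r ^ 2 * X : ℝ) ^ r * wt C E X q := by gcongr
        _ = wt C E X q * (4 * r ^ 2 : ℝ) ^ r * (X : ℝ) ^ r := by rw [mul_pow]; ring
        _ ≤ _ := by
          gcongr
          exact le_max_right _ _
  · intro p hp
    have hp0 : (0 : ℝ) < p := by exact_mod_cast (hQ p hp).1.pos
    have := level_real (X := X) (P := P) (p := p) (W := wt C E X q) (E := E) (e := e) (β := β)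
      (g := g) (B := B ^ ((r : ℝ) / (2 * r' : ℕ))) (r := r) (c := c) (s := s) (t := t) hr hc hX1 hp0
      (hQP p hp).1 (hQP p hp).2.1 (wt_nonneg hC E X q) hPc he he0 hg hg0
      (Real.one_le_rpow hB (by positivity))
    refine le_trans (le_of_eq ?_) this
    rw [wt_mul, Real.mul_rpow (by linarith) (by positivity), ← Real.rpow_mul hX0.le]
    have h₁ : 2 * β * (r' : ℝ) * ((r : ℝ) / (2 * r' : ℕ)) = β * r := by
      have : (0 : ℝ) < r' := by exact_mod_cast hr'0
      push_cast
      field_simp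
    rw [h₁]
    push_cast
    ring

end LevelReal

section Step

/-- The bound `J_{s,k}(X) ≤ C X^{2s - A}`. -/
def PowBound (k s : ℕ) (A C : ℝ) : Prop :=
  ∀ X : ℕ, 1 ≤ X → (vin s k X : ℝ) ≤ C * (X : ℝ) ^ (2 * s - A : ℝ)

lemma mv₁_progr_le_wt {k s X q N : ℕ} [NeZero N] {A C : ℝ} (hs : 0 < s) (hC : 0 ≤ C)
    (hb : PowBound k s A C) (hA : 0 ≤ A) (hAs : A ≤ 2 * s) (hX : (4 * s) ^ 5 ≤ X)
    (hN : s * X ^ k < N) (hq : 0 < q) (hqX : q ^ 15 ≤ X ^ 12) (a : ℤ) :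
    mv₁ s (progr q a X) (curve k N) ≤ wt C (2 * s - A) X q := by
  have hX0 : 0 < X := lt_of_lt_of_le (by positivity) hX
  have hXr : (0 : ℝ) < X := by exact_mod_cast hX0
  have hqr : (0 : ℝ) < q := by exact_mod_cast hq
  have hsr : (0 : ℝ) < s := by exact_mod_cast hs
  refine (mv₁_progr_le hX0 hN hq a).trans ((hb _ (Nat.le_add_left 1 _)).trans ?_)
  set E : ℝ := 2 * s - A with hE
  have hE0 : 0 ≤ E := by linarith
  have h1 : (((X / q + 1 : ℕ)) : ℝ) ≤ (X : ℝ) / q * (1 + q / X) := by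
    push_cast
    have := Nat.cast_div_le (α := ℝ) (m := X) (n := q)
    have e : (X : ℝ) / q * (1 + q / X) = X / q + 1 := by field_simp
    rw [e]; linarith
  have h2 : (4 * s : ℝ) * q ≤ X := by
    by_contra h
    push Not at h
    have h3 : X < 4 * s * q := by exact_mod_cast h
    have h4 : X ^ 15 < (4 * s * q) ^ 15 := Nat.pow_lt_pow_left h3 (by norm_num)
    have h5 : (4 * s * q) ^ 15 ≤ X ^ 15 := by
      calc (4 * s * q) ^ 15 = ((4 * s) ^ 5) ^ 3 * q ^ 15 := by ring
        _ ≤ X ^ 3 * X ^ 12 := Nat.mul_le_mul (Nat.pow_le_pow_left hX 3) hqX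
        _ = X ^ 15 := by ring
    omega
  have h3 : (1 + (q : ℝ) / X) ^ E ≤ 2 := by
    have h4 : (q : ℝ) / X * E ≤ 1 / 2 := by
      rw [div_mul_eq_mul_div, div_le_iff₀ hXr]
      nlinarith
    calc (1 + (q : ℝ) / X) ^ E ≤ (Real.exp (q / X)) ^ E := by
          apply Real.rpow_le_rpow (by positivity) _ hE0
          linarith [Real.add_one_le_exp ((q : ℝ) / X)]
      _ = Real.exp (q / X * E) := by rw [← Real.exp_mul]
      _ ≤ Real.exp (1 / 2) := Real.exp_le_exp.2 h4
      _ ≤ 2 := by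
        have h5 : Real.exp (1 / 2) ^ 2 = Real.exp 1 := by rw [← Real.exp_nat_mul]; norm_num
        have := Real.exp_one_lt_d9
        nlinarith [Real.exp_pos (1 / 2)]
  calc C * (((X / q + 1 : ℕ)) : ℝ) ^ E ≤ C * ((X : ℝ) / q * (1 + q / X)) ^ E := by
        gcongr
    _ = C * (((X : ℝ) / q) ^ E * (1 + q / X) ^ E) := by
        rw [Real.mul_rpow (by positivity) (by positivity)]
    _ ≤ C * (((X : ℝ) / q) ^ E * 2) := by gcongr
    _ = wt C E X q := by unfold wt; ring

/-- The exponent of two lost in one level. -/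
noncomputable def gExp (k : ℕ) : ℝ := ((k : ℝ) + 2) ^ 2 / 4 + 1

/-- The constant lost in one level. -/
noncomputable def lvC (k : ℕ) : ℝ :=
  2 * (numPrimes k : ℝ) ^ 2 * (k.factorial * (2 : ℝ) ^ (2 * k + gExp k))

lemma one_le_numPrimes (k : ℕ) : (1 : ℝ) ≤ numPrimes k := by
  have : 1 ≤ numPrimes k := by unfold numPrimes; omega
  exact_mod_cast this

lemma sixteen_mul_le_two_pow {m : ℕ} (hm : 16 ≤ m) : 16 * m + 14 ≤ 2 ^ m := by
  induction m, hm using Nat.le_induction with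
  | base => norm_num
  | succ n hn ih => rw [pow_succ]; omega

lemma four_mul_sq_pow_le {k : ℕ} (hk : 129 ≤ k) : (4 * k ^ 2 : ℝ) ^ k ≤ (2 : ℝ) ^ gExp k := by
  have h1 := sixteen_mul_le_two_pow (m := k / 8) (by omega)
  have h2 : 2 * k ≤ 2 ^ (k / 8) := by omega
  have h3 : (4 * k ^ 2) ^ k ≤ 2 ^ (k / 8 * 2 * k) := by
    rw [pow_mul, pow_mul]
    apply Nat.pow_le_pow_left
    calc 4 * k ^ 2 = (2 * k) ^ 2 := by ring
      _ ≤ _ := Nat.pow_le_pow_left h2 2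
  have h4 : (4 * k ^ 2 : ℝ) ^ k ≤ (2 : ℝ) ^ (k / 8 * 2 * k) := by exact_mod_cast h3
  refine h4.trans ?_
  rw [← Real.rpow_natCast]
  apply Real.rpow_le_rpow_of_exponent_le (by norm_num)
  have h5 : ((k / 8 : ℕ) : ℝ) ≤ k / 8 := Nat.cast_div_le
  have hk0 : (0 : ℝ) ≤ k := by positivity
  unfold gExp
  push_cast
  nlinarith

lemma two_rpow_gExp_le_lvC (k : ℕ) : (2 : ℝ) ^ gExp k ≤ lvC k := by
  have h1 := one_le_numPrimes k
  have h2 : (1 : ℝ) ≤ k.factorial := by exact_mod_cast Nat.factorial_pos k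
  have h3 : (2 : ℝ) ^ gExp k ≤ (2 : ℝ) ^ (2 * k + gExp k) :=
    Real.rpow_le_rpow_of_exponent_le (by norm_num) (by linarith [(Nat.cast_nonneg k : (0 : ℝ) ≤ k)])
  have h4 : (1 : ℝ) ≤ (numPrimes k : ℝ) ^ 2 := one_le_pow₀ h1
  have h5 : (0 : ℝ) < (2 : ℝ) ^ (2 * k + gExp k) := by positivity
  have h6 : (2 : ℝ) ^ (2 * k + gExp k) ≤ k.factorial * (2 : ℝ) ^ (2 * k + gExp k) :=
    le_mul_of_one_le_left h5.le h2
  unfold lvC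
  nlinarith

lemma gExp_nonneg (k : ℕ) : 0 ≤ gExp k := by unfold gExp; positivity

lemma one_le_lvC (k : ℕ) : 1 ≤ lvC k :=
  (Real.one_le_rpow (by norm_num) (gExp_nonneg k)).trans (two_rpow_gExp_le_lvC k)

lemma max_le_lvC {k r r' : ℕ} (hk : 129 ≤ k) (hr : 0 < r) (hrk : r ≤ k) (hr' : 50 * r ≤ 51 * r')
    {g : ℝ} (hg : g = gExp k) :
    max (2 * (numPrimes k : ℝ) ^ 2 *
        (r.factorial * (2 : ℝ) ^ (2 * r + g) *
          (lvC k ^ (2.05 : ℝ)) ^ ((r : ℝ) / (2 * r' : ℕ))))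
        ((4 * r ^ 2 : ℝ) ^ r) ≤ lvC k ^ (2.05 : ℝ) := by
  have hZ := one_le_lvC k
  have hrk' : (r : ℝ) ≤ k := by exact_mod_cast hrk
  apply max_le
  · have h1 : (lvC k ^ (2.05 : ℝ)) ^ ((r : ℝ) / (2 * r' : ℕ)) ≤ lvC k ^ (1.05 : ℝ) := by
      rw [← Real.rpow_mul (by linarith)]
      apply Real.rpow_le_rpow_of_exponent_le hZ
      have h2 : (50 * r : ℝ) ≤ 51 * r' := by exact_mod_cast hr'
      have h3 : (0 : ℝ) < r' := by
        have : 0 < r' := by omega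
        exact_mod_cast this
      rw [mul_div_assoc', div_le_iff₀ (by push_cast; linarith)]
      push_cast
      nlinarith
    have h2 : (r.factorial : ℝ) * (2 : ℝ) ^ (2 * r + g) ≤ k.factorial * (2 : ℝ) ^ (2 * k + gExp k) := by
      have : (r.factorial : ℝ) ≤ k.factorial := by exact_mod_cast Nat.factorial_le hrk
      have h3 : (2 : ℝ) ^ (2 * r + g) ≤ (2 : ℝ) ^ (2 * k + gExp k) :=
        Real.rpow_le_rpow_of_exponent_le (by norm_num) (by rw [hg]; linarith)
      gcongr
    calc _ ≤ 2 * (numPrimes k : ℝ) ^ 2 * ((k.factorial * (2 : ℝ) ^ (2 * k + gExp k)) *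
          lvC k ^ (1.05 : ℝ)) := by
          have : (0 : ℝ) ≤ lvC k ^ (1.05 : ℝ) := by positivity
          gcongr
      _ = lvC k * lvC k ^ (1.05 : ℝ) := by rw [← mul_assoc]; rfl
      _ = lvC k ^ (2.05 : ℝ) := by
          rw [← Real.rpow_one_add' (by linarith) (by norm_num)]; norm_num
  · calc (4 * r ^ 2 : ℝ) ^ r ≤ (4 * k ^ 2 : ℝ) ^ r := by gcongr
      _ ≤ (4 * k ^ 2 : ℝ) ^ k := by
          apply pow_le_pow_right₀ _ hrk
          have : (1 : ℝ) ≤ k := by exact_mod_cast (show 1 ≤ k by omega)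
          nlinarith
      _ ≤ lvC k := (four_mul_sq_pow_le hk).trans (two_rpow_gExp_le_lvC k)
      _ ≤ _ := by
          conv_lhs => rw [← Real.rpow_one (lvC k)]
          exact Real.rpow_le_rpow_of_exponent_le hZ (by norm_num)

end Step

section Chain

/-- The smallest size treated by the iteration. -/
noncomputable def sizeMin (k : ℕ) : ℝ := ((k : ℝ) ^ (3.85 : ℝ)) ^ ((k : ℝ) + 2)

lemma rpow_div_bounds {k X c : ℕ} {β : ℝ} (hk : 129 ≤ k) (hX : sizeMin k ≤ X) (hc : 15 ≤ c)
    (hβ1 : β ≤ 1) (hβc : (c : ℝ) ≤ β * (k + 2)) :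
    (k : ℝ) ^ (3.85 : ℝ) ≤ (X : ℝ) ^ (β / c) ∧
      (X : ℝ) ≤ ((X : ℝ) ^ (β / c)) ^ ((k : ℝ) + 2) ∧
      ∀ p : ℕ, (p : ℝ) ≤ (X : ℝ) ^ (β / c) → p ^ 15 ≤ X := by
  have hk1 : (1 : ℝ) ≤ k := by exact_mod_cast (show 1 ≤ k by omega)
  have hk0 : (1 : ℝ) ≤ (k : ℝ) ^ (3.85 : ℝ) := Real.one_le_rpow hk1 (by norm_num)
  have hX1 : (1 : ℝ) ≤ X := (Real.one_le_rpow hk0 (by positivity)).trans hX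
  have hc15 : (15 : ℝ) ≤ c := by exact_mod_cast hc
  have hk2 : (0 : ℝ) < (k : ℝ) + 2 := by positivity
  have hinv : 1 / ((k : ℝ) + 2) ≤ β / c := by
    rw [div_le_div_iff₀ hk2 (by linarith)]; linarith
  refine ⟨?_, ?_, ?_⟩
  · calc (k : ℝ) ^ (3.85 : ℝ) = sizeMin k ^ (1 / ((k : ℝ) + 2)) := by
          rw [sizeMin, ← Real.rpow_mul (by positivity), mul_one_div_cancel hk2.ne', Real.rpow_one]
      _ ≤ (X : ℝ) ^ (1 / ((k : ℝ) + 2)) := by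
          apply Real.rpow_le_rpow _ hX (by positivity)
          unfold sizeMin; positivity
      _ ≤ _ := Real.rpow_le_rpow_of_exponent_le hX1 hinv
  · rw [← Real.rpow_mul (by linarith)]
    conv_lhs => rw [← Real.rpow_one (X : ℝ)]
    apply Real.rpow_le_rpow_of_exponent_le hX1
    rwa [div_le_iff₀ hk2] at hinv
  · intro p hp
    have : (p : ℝ) ^ 15 ≤ X := by
      calc (p : ℝ) ^ 15 ≤ ((X : ℝ) ^ (β / c)) ^ 15 := by gcongr
        _ = (X : ℝ) ^ (β / c * 15) := by
            rw [← Real.rpow_natCast, ← Real.rpow_mul (by linarith)]; norm_num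
        _ ≤ (X : ℝ) ^ (1 : ℝ) := by
            apply Real.rpow_le_rpow_of_exponent_le hX1
            rw [div_mul_eq_mul_div, div_le_one (by linarith)]
            linarith
        _ = X := Real.rpow_one _
    exact_mod_cast this

/-- A bound for the mean values twisted by `d`-fold differences of the curve. -/
def LevelBound (k N X s : ℕ) [NeZero N] (C E B b : ℝ) (d : ℕ) : Prop :=
  ∀ q : ℕ, 0 < q → q ^ 15 ≤ X ^ d → ∀ l : List ℤ, l.length = d →
    (∀ h ∈ l, h ≠ 0 ∧ |h| ≤ X) → ∀ I ⊆ Finset.Icc 1 (X : ℤ), ∀ a,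
      mv (k - d) I (difs l (curve k N)) s (progr q a X) (curve k N) ≤
        wt C E X q * (B * (X : ℝ) ^ (2 * b * (k - d : ℕ)))

lemma levelBound_of_one {k N X s d : ℕ} [NeZero N] {C E B : ℝ} (hC : 0 ≤ C) (hB : 1 ≤ B)
    (hX : 1 ≤ X) (hd : d ≤ 12)
    (hw : ∀ q : ℕ, 0 < q → q ^ 15 ≤ X ^ 12 → ∀ a,
      mv₁ s (progr q a X) (curve k N) ≤ wt C E X q) :
    LevelBound k N X s C E B 1 d := by
  intro q hq hqX l _ _ I hI a
  refine (mv_le_trivial _ _ _ _ _ _).trans ?_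
  have h1 := hw q hq (hqX.trans (Nat.pow_le_pow_right hX hd)) a
  have h2 : ((I.card : ℝ)) ≤ X := by
    have := Finset.card_le_card hI
    rw [Int.card_Icc] at this
    exact_mod_cast (show I.card ≤ X by omega)
  have h3 : (X : ℝ) ^ (2 * (1 : ℝ) * (k - d : ℕ)) = (X : ℝ) ^ (2 * (k - d)) := by
    rw [← Real.rpow_natCast]; push_cast; ring_nf
  rw [h3, mul_comm]
  refine mul_le_mul h1 ?_ (by positivity) (wt_nonneg hC _ _ _)
  calc (I.card : ℝ) ^ (2 * (k - d)) ≤ (X : ℝ) ^ (2 * (k - d)) := by gcongr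
    _ ≤ _ := le_mul_of_one_le_left (by positivity) hB

lemma levelBound_step {k N X s c d : ℕ} [NeZero N] {A C b b' : ℝ} (hk : 129 ≤ k) (hs : 0 < s)
    (hX : sizeMin k ≤ X) (hC : 0 ≤ C) (hA : 0 ≤ A) (hc : 15 ≤ c) (hck : c ≤ k)
    (hd : d ≤ 11)
    (hw : ∀ q : ℕ, 0 < q → q ^ 15 ≤ X ^ 12 → ∀ a,
      mv₁ s (progr q a X) (curve k N) ≤ wt C (2 * s - A) X q)
    (hN : ∀ p c : ℕ, 0 < p → p ≤ X → c ≤ k → p ^ c ∣ N)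
    (hg : (c : ℝ) * k - A - c * (c - 1) / 2 ≤ gExp k)
    (hb0 : 0 ≤ b') (hb1 : b' ≤ 1) (hbc : (c : ℝ) ≤ b' * (k + 2))
    (hstep : ((k : ℝ) - d) + b' * (A + (c - d) * (c - d - 1) / 2) / c ≤ 2 * b * (k - d))
    (hL : LevelBound k N X s C (2 * s - A) (lvC k ^ (2.05 : ℝ)) b' (d + 1)) :
    LevelBound k N X s C (2 * s - A) (lvC k ^ (2.05 : ℝ)) b d := by
  intro q hq hqX l hlen hl I hI a
  subst hlen
  obtain ⟨hP, hXP, hp15⟩ := rpow_div_bounds hk hX hc hb1 hbc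
  have hk1 : (1 : ℝ) ≤ k := by exact_mod_cast (show 1 ≤ k by omega)
  have hX1r : (1 : ℝ) ≤ X :=
    (Real.one_le_rpow (Real.one_le_rpow hk1 (by norm_num)) (by positivity)).trans hX
  have hX1 : 1 ≤ X := by exact_mod_cast hX1r
  have hc15 : (15 : ℝ) ≤ c := by exact_mod_cast hc
  have hd11 : (l.length : ℝ) ≤ 11 := by exact_mod_cast hd
  have hq12 : q ^ 15 ≤ X ^ 12 := hqX.trans (Nat.pow_le_pow_right hX1 (by omega))
  have hkd : ((k - l.length : ℕ) : ℝ) = k - l.length := by rw [Nat.cast_sub (by omega)]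
  have ht : (((c - l.length) * (c - l.length - 1) / 2 : ℕ) : ℝ) = ((c : ℝ) - l.length) * (c - l.length - 1) / 2 := by
    rw [Nat.cast_div (Nat.even_mul_pred_self _).two_dvd (by norm_num), Nat.cast_mul,
      Nat.cast_sub (by omega : 1 ≤ c - l.length), Nat.cast_sub (by omega : l.length ≤ c)]
    norm_num
  have ht0 : 0 ≤ ((c : ℝ) - l.length) * (c - l.length - 1) / 2 := by
    apply div_nonneg _ (by norm_num)
    apply mul_nonneg <;> linarith
  have hqp : ∀ p : ℕ, (p : ℝ) ≤ (X : ℝ) ^ (b' / c) → (q * p) ^ 15 ≤ X ^ (l.length + 1) := by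
    intro p hp
    rw [mul_pow, pow_succ]
    exact Nat.mul_le_mul hqX (hp15 p hp)
  have key := mv_le_level_of_params (k := k) (N := N) (X := X) (r := k - l.length) (r' := k - (l.length + 1))
    (s := s) (c := c) (q := q) (t := (c - l.length) * (c - l.length - 1) / 2) hk hX1 (by omega) (by omega) hs
    (by omega) hq l hl (by
      have h1 : (k - l.length) * (k - l.length) + 2 * l.length ≤ k * k := by
        obtain ⟨m, rfl⟩ : ∃ m, k = m + l.length := ⟨k - l.length, by omega⟩
        rw [Nat.add_sub_cancel]
        nlinarith
      omega) I hI a (C := C) (E := 2 * s - A) (β := b') (g := gExp k) (B := lvC k ^ (2.05 : ℝ))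
    (e := A + ((c : ℝ) - l.length) * (c - l.length - 1) / 2) hC (Real.one_le_rpow (one_le_lvC k) (by norm_num))
    rfl hb0 (by linarith) hP hXP (fun p hp hpX => hN p c hp hpX hck)
    (by
      intro p _ hkp hp η β
      exact card_liftKey_le (p := p) (k := k) (c := c) (by omega) l hp (by omega) hck hkp η β)
    (by rw [ht]; ring) (by positivity)
    (by rw [hkd]; nlinarith [(Nat.cast_nonneg l.length : (0 : ℝ) ≤ l.length)])
    (gExp_nonneg k) (hw q hq hq12 a)
    (fun p hp hpP a' => hw (q * p) (by positivity)
      ((hqp p hpP).trans (Nat.pow_le_pow_right hX1 (by omega))) a')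
    (fun p hp hpP a' h hh I' hI' => by
      refine hL (q * p) (by positivity) (hqp p hpP) (h :: l) (by simp) ?_ I' hI' a'
      intro h' hh'
      rcases List.mem_cons.1 hh' with rfl | h2
      · rw [shifts, Finset.mem_filter, Finset.mem_Icc] at hh
        exact ⟨hh.2.1, abs_le.2 hh.1⟩
      · exact hl h' h2)
  refine key.trans ?_
  rw [mul_assoc]
  have hmax := max_le_lvC (k := k) (r := k - l.length) (r' := k - (l.length + 1)) hk (by omega) (by omega)
    (by omega) (g := gExp k) rfl
  refine mul_le_mul_of_nonneg_left (mul_le_mul hmax ?_ (by positivity) ?_) (wt_nonneg hC _ _ _)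
  · apply Real.rpow_le_rpow_of_exponent_le hX1r
    rw [hkd]
    linarith
  · exact Real.rpow_nonneg (by linarith [one_le_lvC k]) _

end Chain

section Iterate

/-- The admissible constant after `n` steps of the iteration. -/
noncomputable def iterC (k n : ℕ) : ℝ :=
  sizeMin k ^ ((k : ℝ) * (k + 1) / 2) * (2 * lvC k ^ (2.05 : ℝ)) ^ n

lemma one_le_sizeMin {k : ℕ} (hk : 129 ≤ k) : 1 ≤ sizeMin k := by
  have hk1 : (1 : ℝ) ≤ k := by exact_mod_cast (show 1 ≤ k by omega)
  exact Real.one_le_rpow (Real.one_le_rpow hk1 (by norm_num)) (by positivity)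

lemma one_le_two_mul_lvC (k : ℕ) : 1 ≤ 2 * lvC k ^ (2.05 : ℝ) := by
  have := Real.one_le_rpow (one_le_lvC k) (show (0 : ℝ) ≤ 2.05 by norm_num)
  linarith

lemma sizeMin_le_iterC {k : ℕ} (hk : 129 ≤ k) (n : ℕ) :
    sizeMin k ^ ((k : ℝ) * (k + 1) / 2) ≤ iterC k n := by
  have := one_le_sizeMin hk
  exact le_mul_of_one_le_right (by positivity) (one_le_pow₀ (one_le_two_mul_lvC k))

lemma iterC_pos {k : ℕ} (hk : 129 ≤ k) (n : ℕ) : 0 < iterC k n := by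
  have := one_le_sizeMin hk
  exact lt_of_lt_of_le (by positivity) (sizeMin_le_iterC hk n)

lemma four_mul_pow_le_of_sizeMin_le {k s X : ℕ} (hk : 129 ≤ k) (hs : s ≤ k ^ 4)
    (hX : sizeMin k ≤ X) : (4 * s) ^ 5 ≤ X := by
  have hk1 : (129 : ℝ) ≤ k := by exact_mod_cast hk
  have h1 : ((k ^ 25 : ℕ) : ℝ) ≤ X := by
    refine le_trans ?_ hX
    rw [sizeMin, ← Real.rpow_mul (by positivity)]
    push_cast
    rw [← Real.rpow_natCast]
    apply Real.rpow_le_rpow_of_exponent_le (by linarith)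
    push_cast
    nlinarith
  have h2 : k ^ 25 ≤ X := by exact_mod_cast h1
  have h3 : 1024 ≤ k ^ 5 := (show 1024 ≤ 129 ^ 5 by norm_num).trans (Nat.pow_le_pow_left hk 5)
  calc (4 * s) ^ 5 ≤ (4 * k ^ 4) ^ 5 := Nat.pow_le_pow_left (by omega) 5
    _ = 1024 * k ^ 20 := by ring
    _ ≤ k ^ 5 * k ^ 20 := Nat.mul_le_mul_right _ h3
    _ = k ^ 25 := by ring
    _ ≤ X := h2

theorem powBound_step {k s r c n : ℕ} {A A' : ℝ} (b : ℕ → ℝ) (hk : 129 ≤ k) (hs : 0 < s)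
    (hsk : s ≤ k ^ 4) (hA : 0 ≤ A) (hAs : A ≤ s) (hA'0 : 0 ≤ A') (hA'K : A' ≤ k * (k + 1) / 2)
    (hb : PowBound k s A (iterC k n)) (hc : 15 ≤ c) (hck : c ≤ k)
    (hg : (c : ℝ) * k - A - c * (c - 1) / 2 ≤ gExp k)
    (hb0 : ∀ d, 0 ≤ b d) (hb1 : ∀ d, b d ≤ 1) (hb12 : b 12 = 1)
    (hbc : ∀ d, 2 ≤ d → d ≤ 12 → (c : ℝ) ≤ b d * (k + 2))
    (hstep : ∀ d : ℕ, 1 ≤ d → d ≤ 11 → b d = 1 ∨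
      ((k : ℝ) - d) + b (d + 1) * (A + (c - d) * (c - d - 1) / 2) / c ≤ 2 * b d * (k - d))
    (hrk : r ≤ k) (hkr : k < 2 * r) (hbr : (r : ℝ) ≤ b 1 * (k + 2))
    (hgr : (r : ℝ) * r - A - ((2 * r - k) * (2 * r - k - 1) / 2 + (k - r)) ≤ gExp k)
    (hA' : A' ≤ A + r - b 1 * (A + ((2 * r - k) * (2 * r - k - 1) / 2 + (k - r))) / r) :
    PowBound k (s + r) A' (iterC k (n + 1)) := by
  intro X hX1
  have hX1r : (1 : ℝ) ≤ X := by exact_mod_cast hX1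
  have hX0 : (0 : ℝ) < X := by linarith
  rcases lt_or_ge (X : ℝ) (sizeMin k) with hXs | hXs
  · refine (vin_le_trivial (s + r) k X).trans ?_
    have h1 : (X : ℝ) ^ (2 * (s + r)) = (X : ℝ) ^ A' * (X : ℝ) ^ (2 * ((s + r : ℕ) : ℝ) - A') := by
      rw [← Real.rpow_add hX0, ← Real.rpow_natCast]
      congr 1
      push_cast
      ring
    rw [h1]
    refine mul_le_mul_of_nonneg_right ?_ (by positivity)
    calc (X : ℝ) ^ A' ≤ sizeMin k ^ A' := Real.rpow_le_rpow hX0.le hXs.le hA'0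
      _ ≤ sizeMin k ^ ((k : ℝ) * (k + 1) / 2) :=
          Real.rpow_le_rpow_of_exponent_le (one_le_sizeMin hk) hA'K
      _ ≤ _ := sizeMin_le_iterC hk _
  have hX5 := four_mul_pow_le_of_sizeMin_le hk hsk hXs
  obtain ⟨N, hN0, hNs, hNp⟩ : ∃ N : ℕ, N ≠ 0 ∧ s * X ^ k < N ∧
      ∀ p c : ℕ, 0 < p → p ≤ X → c ≤ k → p ^ c ∣ N := by
    refine ⟨((s * X ^ k + X + 1).factorial) ^ k, pow_ne_zero _ (Nat.factorial_ne_zero _), ?_, ?_⟩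
    · calc s * X ^ k < s * X ^ k + X + 1 := by omega
        _ ≤ (s * X ^ k + X + 1).factorial := Nat.self_le_factorial _
        _ ≤ _ := Nat.le_self_pow (by omega) _
    · intro p c hp hpX hck
      exact (pow_dvd_pow p hck).trans (pow_dvd_pow_of_dvd (Nat.dvd_factorial hp (by omega)) k)
  have : NeZero N := ⟨hN0⟩
  set C := iterC k n with hCdef
  have hC : 0 ≤ C := (iterC_pos hk n).le
  have hw : ∀ q : ℕ, 0 < q → q ^ 15 ≤ X ^ 12 → ∀ a,
      mv₁ s (progr q a X) (curve k N) ≤ wt C (2 * s - A) X q := fun q hq hqX a =>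
    mv₁_progr_le_wt hs hC hb hA (by linarith [(Nat.cast_nonneg s : (0 : ℝ) ≤ s)]) hX5 hNs hq hqX a
  have hBz := Real.one_le_rpow (one_le_lvC k) (show (0 : ℝ) ≤ 2.05 by norm_num)
  have hL : ∀ j : ℕ, j ≤ 11 →
      LevelBound k N X s C (2 * s - A) (lvC k ^ (2.05 : ℝ)) (b (12 - j)) (12 - j) := by
    intro j
    induction j with
    | zero => intro _; rw [Nat.sub_zero, hb12]; exact levelBound_of_one hC hBz hX1 le_rfl hw
    | succ j ih =>
      intro hj
      obtain ⟨d, hd⟩ : ∃ d, d = 12 - (j + 1) := ⟨_, rfl⟩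
      have hd' : 12 - j = d + 1 := by omega
      rw [← hd]
      have ih := ih (by omega)
      rw [hd'] at ih
      rcases hstep d (by omega) (by omega) with h1 | h1
      · rw [h1]; exact levelBound_of_one hC hBz hX1 (by omega) hw
      · exact levelBound_step hk hs hXs hC hA hc hck (by omega) hw hNp hg (hb0 _) (hb1 _)
          (hbc _ (by omega) (by omega)) h1 ih
  have hL1 : LevelBound k N X s C (2 * s - A) (lvC k ^ (2.05 : ℝ)) (b 1) 1 := hL 11 le_rfl
  obtain ⟨hP, hXP, hp15⟩ := rpow_div_bounds (c := r) hk hXs (by omega) (hb1 1) hbr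
  have hr0 : (0 : ℝ) < r := by exact_mod_cast (show 0 < r by omega)
  have hkr' : (k : ℝ) + 1 ≤ 2 * r := by exact_mod_cast hkr
  have hrk' : (r : ℝ) ≤ k := by exact_mod_cast hrk
  have ht : (((2 * r - k) * (2 * r - k - 1) / 2 + (k - r) : ℕ) : ℝ) =
      ((2 * r - k) * (2 * r - k - 1) / 2 + (k - r) : ℝ) := by
    rw [Nat.cast_add, Nat.cast_div (Nat.even_mul_pred_self _).two_dvd (by norm_num), Nat.cast_mul,
      Nat.cast_sub (by omega : 1 ≤ 2 * r - k), Nat.cast_sub (by omega : k ≤ 2 * r),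
      Nat.cast_sub hrk]
    push_cast
    ring
  have ht0 : 0 ≤ ((2 * r - k) * (2 * r - k - 1) / 2 + (k - r) : ℝ) := by
    apply add_nonneg _ (by linarith)
    apply div_nonneg _ (by norm_num)
    apply mul_nonneg <;> linarith
  have key := mv_le_level_of_params (k := k) (N := N) (X := X) (r := r) (r' := k - 1)
    (s := s) (c := r) (q := 1) (t := (2 * r - k) * (2 * r - k - 1) / 2 + (k - r)) hk hX1
    (by omega) (by omega) hs (by omega) one_pos [] (by simp) (by
      rw [List.length_nil, add_zero]
      exact Nat.div_le_div_right (Nat.mul_le_mul hrk hrk)) (Finset.Icc 1 (X : ℤ)) subset_rfl 0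
    (C := C) (E := 2 * s - A) (β := b 1) (g := gExp k) (B := lvC k ^ (2.05 : ℝ))
    (e := A + ((2 * r - k) * (2 * r - k - 1) / 2 + (k - r))) hC hBz rfl (hb0 1)
    ((hb1 1).trans (by exact_mod_cast (show 1 ≤ r by omega))) hP hXP
    (fun p hp hpX => hNp p r hp hpX hrk)
    (by
      intro p _ hkp _ η β
      rw [mul_comm]
      exact card_liftKey_nil_le (p := p) (k := k) (r := r) (by omega) hrk hkr hkp η β)
    (by rw [ht]; ring) (by positivity) (by linarith) (gExp_nonneg k)
    (hw 1 one_pos (by rw [one_pow]; exact Nat.one_le_pow _ _ hX1) 0)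
    (fun p hp hpP a' => hw (1 * p) (by omega) (by
      rw [one_mul]
      exact (hp15 p hpP).trans (Nat.le_self_pow (by norm_num) X)) a')
    (fun p hp hpP a' h hh I' hI' => by
      refine hL1 (1 * p) (by omega) (by rw [one_mul, pow_one]; exact hp15 p hpP) [h] rfl ?_ I' hI' a'
      intro h' hh'
      rw [List.mem_singleton] at hh'
      subst hh'
      rw [shifts, Finset.mem_filter, Finset.mem_Icc] at hh
      exact ⟨hh.2.1, abs_le.2 hh.1⟩)
  rw [mv_nil_eq] at key
  refine (vin_le_mv₁ (s + r) k X N).trans (key.trans ?_)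
  have hmax := max_le_lvC (k := k) (r := r) (r' := k - 1) hk (by omega) hrk (by omega)
    (g := gExp k) rfl
  have hexp : (X : ℝ) ^ (2 * (s : ℝ) - A) * (X : ℝ) ^ (r + b 1 *
      (A + ((2 * r - k) * (2 * r - k - 1) / 2 + (k - r))) / r) ≤
      (X : ℝ) ^ (2 * ((s + r : ℕ) : ℝ) - A') := by
    rw [← Real.rpow_add hX0]
    apply Real.rpow_le_rpow_of_exponent_le hX1r
    push_cast
    linarith
  have hwt : wt C (2 * s - A) X 1 = 2 * C * (X : ℝ) ^ (2 * (s : ℝ) - A) := by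
    rw [wt, Nat.cast_one, div_one]
  rw [hwt]
  have hCs : iterC k (n + 1) = 2 * C * lvC k ^ (2.05 : ℝ) := by
    rw [hCdef, iterC, iterC, pow_succ]; ring
  rw [hCs]
  calc _ ≤ 2 * C * (X : ℝ) ^ (2 * (s : ℝ) - A) * lvC k ^ (2.05 : ℝ) * (X : ℝ) ^ (r + b 1 *
      (A + ((2 * r - k) * (2 * r - k - 1) / 2 + (k - r))) / r) := by gcongr
    _ = 2 * C * lvC k ^ (2.05 : ℝ) * ((X : ℝ) ^ (2 * (s : ℝ) - A) * (X : ℝ) ^ (r + b 1 *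
      (A + ((2 * r - k) * (2 * r - k - 1) / 2 + (k - r))) / r)) := by ring
    _ ≤ _ := by gcongr

end Iterate

section Final

lemma powBound_self {k : ℕ} (hk : 129 ≤ k) : PowBound k k k (iterC k 0) := by
  intro X hX
  have hk1 : (129 : ℝ) ≤ k := by exact_mod_cast hk
  have h1 : (X : ℝ) ^ (2 * (k : ℝ) - k) = (X : ℝ) ^ k := by
    rw [← Real.rpow_natCast]; congr 1; ring
  rw [h1]
  refine (vin_self_le k X).trans (mul_le_mul_of_nonneg_right ?_ (by positivity))
  refine le_trans ?_ (sizeMin_le_iterC hk 0)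
  rw [sizeMin, ← Real.rpow_mul (by positivity), ← Real.rpow_mul (by positivity),
    ← Real.rpow_natCast]
  apply Real.rpow_le_rpow_of_exponent_le (by linarith)
  nlinarith [mul_nonneg (show (0 : ℝ) ≤ k by positivity) (show (0 : ℝ) ≤ k by positivity)]

lemma log_lvC_le {k : ℕ} (hk : 129 ≤ k) :
    Real.log (lvC k) ≤ (k + 6) * Real.log k + 0.6932 * (2 * k + 2 + (k + 2) ^ 2 / 4) := by
  have hk1 : (129 : ℝ) ≤ k := by exact_mod_cast hk
  have hn := one_le_numPrimes k
  have hn' : (numPrimes k : ℝ) ≤ (k : ℝ) ^ 3 := by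
    have := numPrimes_le k
    have h3 : (129 : ℝ) ^ 3 ≤ (k : ℝ) ^ 3 := by gcongr
    linarith
  have hl : Real.log (numPrimes k) ≤ 3 * Real.log k := by
    rw [show (3 : ℝ) = (3 : ℕ) by norm_num, ← Real.log_pow]
    exact Real.log_le_log (by linarith) hn'
  have hf : Real.log (k.factorial) ≤ k * Real.log k := by
    rw [← Real.log_pow]
    refine Real.log_le_log (by exact_mod_cast Nat.factorial_pos k) ?_
    exact_mod_cast Nat.factorial_le_pow k
  have h2 : Real.log 2 ≤ 0.6932 := by linarith [Real.log_two_lt_d9]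
  have h20 : 0 ≤ Real.log 2 := Real.log_nonneg (by norm_num)
  have hf0 : (k.factorial : ℝ) ≠ 0 := by positivity
  unfold lvC
  rw [Real.log_mul (by positivity) (by positivity), Real.log_mul (by norm_num) (by positivity),
    Real.log_mul hf0 (by positivity), Real.log_rpow (by norm_num), Real.log_pow]
  have h4 : (2 * (k : ℝ) + gExp k) * Real.log 2 ≤ (2 * k + gExp k) * 0.6932 := by
    have := gExp_nonneg k
    gcongr
  unfold gExp at h4
  unfold gExp
  push_cast
  linarith

lemma log_iterC_le {k n : ℕ} (hk : 129 ≤ k) (hn : n ≤ 4 * k) :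
    Real.log (iterC k n) ≤ Real.log k * (3.85 * (k + 2) * (k * (k + 1) / 2) +
      8.2 * k * (k + 6) + 0.8245 * k * (0.6932 + 1.4211 * (2 * k + 2 + (k + 2) ^ 2 / 4))) := by
  have hk1 : (129 : ℝ) ≤ k := by exact_mod_cast hk
  have hL := log_ge hk
  have hlv := one_le_lvC k
  have hs := one_le_sizeMin hk
  have hn' : (n : ℝ) ≤ 4 * k := by exact_mod_cast hn
  have h1 : Real.log (sizeMin k) = (k + 2) * (3.85 * Real.log k) := by
    rw [sizeMin, Real.log_rpow (by positivity), Real.log_rpow (by positivity)]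
  have h2 := log_lvC_le hk
  have h3 : Real.log 2 ≤ 0.6932 := by linarith [Real.log_two_lt_d9]
  have h5 : 0 ≤ Real.log (lvC k) := Real.log_nonneg hlv
  have h20 : 0 ≤ Real.log 2 := Real.log_nonneg (by norm_num)
  unfold iterC
  rw [Real.log_mul (by positivity) (by positivity), Real.log_rpow (by linarith), Real.log_pow,
    Real.log_mul (by norm_num) (by positivity), Real.log_rpow (by linarith), h1]
  have h6 : (n : ℝ) * (Real.log 2 + 2.05 * Real.log (lvC k)) ≤ 4 * k * (0.6932 + 2.05 *
      ((k + 6) * Real.log k + 0.6932 * (2 * k + 2 + (k + 2) ^ 2 / 4))) := by gcongr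
  have h7 : (1 : ℝ) ≤ Real.log k * 0.206125 := by linarith
  have h8 : 4 * (k : ℝ) * (0.6932 + 1.42106 * (2 * k + 2 + (k + 2) ^ 2 / 4)) * 1 ≤
      4 * (k : ℝ) * (0.6932 + 1.42106 * (2 * k + 2 + (k + 2) ^ 2 / 4)) *
        (Real.log k * 0.206125) := by gcongr
  have h9 : 0 ≤ Real.log k * (k * (2 * k + 2 + ((k : ℝ) + 2) ^ 2 / 4)) := by
    have : 0 ≤ Real.log k := by linarith
    positivity
  nlinarith

lemma iterC_le_of_poly {k n : ℕ} {θ : ℝ} (hk : 129 ≤ k) (hn : n ≤ 4 * k)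
    (hθ : 3.85 * ((k : ℝ) + 2) * (k * (k + 1) / 2) +
      8.2 * k * (k + 6) + 0.8245 * k * (0.6932 + 1.4211 * (2 * k + 2 + (k + 2) ^ 2 / 4)) ≤
      θ * (k : ℝ) ^ 3) : iterC k n ≤ (k : ℝ) ^ (θ * (k : ℝ) ^ 3) := by
  have hL := log_ge hk
  have h := (log_iterC_le hk hn).trans (mul_le_mul_of_nonneg_left hθ (by linarith))
  rw [Real.rpow_def_of_pos (by positivity)]
  exact (Real.log_le_iff_le_exp (iterC_pos hk n)).1 h

lemma iterC_le {k n : ℕ} (hk : 129 ≤ k) (hn : n ≤ 4 * k) :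
    iterC k n ≤ (k : ℝ) ^ ((if 200 ≤ k then (2.3291 : ℝ) else if 150 ≤ k then 2.3849 else 2.4183)
      * (k : ℝ) ^ 3) := by
  apply iterC_le_of_poly hk hn
  split_ifs with h1 h2
  · have h : (200 : ℝ) ≤ k := by exact_mod_cast h1
    nlinarith [mul_nonneg (show (0 : ℝ) ≤ k by linarith) (sub_nonneg.2 h),
      mul_nonneg (mul_nonneg (show (0 : ℝ) ≤ k by linarith) (show (0 : ℝ) ≤ k by linarith)) (sub_nonneg.2 h)]
  · have h : (150 : ℝ) ≤ k := by exact_mod_cast h2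
    nlinarith [mul_nonneg (show (0 : ℝ) ≤ k by linarith) (sub_nonneg.2 h),
      mul_nonneg (mul_nonneg (show (0 : ℝ) ≤ k by linarith) (show (0 : ℝ) ≤ k by linarith)) (sub_nonneg.2 h)]
  · have h : (129 : ℝ) ≤ k := by exact_mod_cast hk
    nlinarith [mul_nonneg (show (0 : ℝ) ≤ k by linarith) (sub_nonneg.2 h),
      mul_nonneg (mul_nonneg (show (0 : ℝ) ≤ k by linarith) (show (0 : ℝ) ≤ k by linarith)) (sub_nonneg.2 h)]

lemma Jv_le_vin (s k : ℕ) {P : ℝ} (hP : 1 ≤ P) : Jv s k P ≤ vin s k ⌊P⌋₊ := by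
  unfold Jv vin
  apply le_of_eq
  apply Nat.subtype_card
  intro xy
  have hb : ∀ z : ℤ, z ≤ (⌊P⌋₊ : ℤ) ↔ (z : ℝ) ≤ P := by
    intro z
    rw [Int.natCast_floor_eq_floor (by linarith), Int.le_floor]
  simp only [Finset.mem_filter, Finset.mem_product, box, Fintype.mem_piFinset, Finset.mem_Icc, hb,
    Finset.sum_sub_distrib, sub_eq_zero]
  refine and_congr_left fun _ => ⟨fun h i => ?_, fun h => ⟨fun i => ?_, fun i => ?_⟩⟩
  · exact ⟨(h.1 i).1, (h.1 i).2, (h.2 i).1, (h.2 i).2⟩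
  · exact ⟨(h i).1, (h i).2.1⟩
  · exact ⟨(h i).2.2.1, (h i).2.2.2⟩

lemma Jv_le_of_powBound {k s n : ℕ} {A P : ℝ} (hk : 129 ≤ k) (hn : n ≤ 4 * k)
    (hb : PowBound k s A (iterC k n))
    (hA : (k : ℝ) * (k + 1) / 2 - 0.001 * (k : ℝ) ^ 2 ≤ A) (hAs : A ≤ s) (hP : 1 ≤ P) :
    (Jv s k P : ℝ) ≤
      (k : ℝ) ^ ((if 200 ≤ k then (2.3291 : ℝ) else if 150 ≤ k then 2.3849 else 2.4183)
        * (k : ℝ) ^ 3) *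
      P ^ (2 * (s : ℝ) - (k : ℝ) * (k + 1) / 2 + 0.001 * (k : ℝ) ^ 2) := by
  have h1 : (Jv s k P : ℝ) ≤ vin s k ⌊P⌋₊ := by exact_mod_cast Jv_le_vin s k hP
  have h2 : 1 ≤ ⌊P⌋₊ := Nat.one_le_floor_iff _ |>.2 hP
  have hs : (0 : ℝ) ≤ s := by positivity
  refine h1.trans ((hb _ h2).trans ?_)
  have h3 : (⌊P⌋₊ : ℝ) ^ (2 * (s : ℝ) - A) ≤
      P ^ (2 * (s : ℝ) - (k : ℝ) * (k + 1) / 2 + 0.001 * (k : ℝ) ^ 2) :=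
    (Real.rpow_le_rpow (by positivity) (Nat.floor_le (by linarith)) (by linarith)).trans
      (Real.rpow_le_rpow_of_exponent_le hP (by linarith))
  exact mul_le_mul (iterC_le hk hn) h3 (by positivity) (by positivity)

end Final

section SmallDegrees

/-- `force x f` is `f x`; evaluating it in the kernel evaluates `x` first. -/
def force (x : ℕ) (f : ℕ → Bool) : Bool :=
  Nat.rec (f 0) (fun n _ => f (Nat.succ n)) x

/-- Computes, in fixed-point arithmetic with ten decimals, the weights at levels `d, …, 1` from the
weight `b` at level `d + 1`, checks the side conditions, and passes the last weight to `f`. -/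
def chainCheck (k c A d : ℕ) : ℕ → (ℕ → Bool) → Bool :=
  Nat.rec (fun b f => f b)
    (fun d ih b f =>
      Nat.ble (c * 10000000000) (b * (k + 2)) &&
      force ((10000000000 + b * (A + 1000000 * ((c - Nat.succ d) * (c - Nat.succ d - 1) / 2))
        / (1000000 * c * (k - Nat.succ d)) + 1) / 2 + 1) fun b' =>
      ih (bif Nat.ble b' 10000000000 then b' else 10000000000) f) d

/-- Runs at most `m` efficient-differencing steps from the exponent `A / 10 ^ 6`, checking the
hypotheses of `powBound_step` along the way. -/
def descentCheck (k S m : ℕ) : ℕ → ℕ → ℕ → ℕ → Bool :=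
  Nat.rec (fun _ _ _ _ => false)
    (fun _ ih A s n c =>
      bif Nat.ble (1000 * (1000000 * (k * (k + 1) / 2))) (1000 * A + k * k * 1000000) then
        Nat.ble s S && Nat.ble n (4 * k)
      else
        force ((c * c + 2 * (A / 1000000)) / (2 * c)) fun c =>
        Nat.ble 15 c && Nat.ble c k && Nat.ble s (4 * k * k) &&
        Nat.ble (4000000 * c * k)
          (4 * A + 2000000 * c * (c - 1) + 1000000 * ((k + 2) * (k + 2) + 4)) &&
        chainCheck k c A 5 10000000000 fun b =>
        force ((k * k + 2 * k + A / 1000000 - k * (k + 1) / 2 + (k + 1) / 2)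
          / (k + 1)) fun r =>
        force (bif Nat.ble r k then r else k) fun r =>
        force ((2 * r - k) * (2 * r - k - 1) / 2 + (k - r)) fun t =>
        force (b * (A + 1000000 * t) / (10000000000 * r) + 1) fun x =>
        Nat.ble r k && Nat.ble (k + 1) (2 * r) &&
        Nat.ble (r * 10000000000) (b * (k + 2)) &&
        Nat.ble (4000000 * r * r)
          (4 * A + 4000000 * t + 1000000 * ((k + 2) * (k + 2) + 4)) &&
        Nat.ble x (1000000 * r) &&
        force (A + 1000000 * r - x) fun A' =>
        force (s + r) fun s' =>
        force (n + 1) fun n' =>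
        Nat.ble A' (1000000 * (k * (k + 1) / 2)) &&
        ih A' s' n' c) m

/-- The simulated iteration for a single degree, with the budget of the theorem. -/
def smallCheck (k : ℕ) : Bool :=
  descentCheck k ((bif Nat.ble 150 k then 321734 else 322313) * k * k / 100000) (4 * k + 1)
    (1000000 * k) k 0 16

set_option maxRecDepth 100000 in
lemma smallCheck_eq_true : ∀ i < 51, smallCheck (129 + i) = true := by decide +kernel

lemma force_eq (x : ℕ) (f : ℕ → Bool) : force x f = f x := by
  cases x <;> rfl

lemma bif_ble_eq_min (a b : ℕ) : (bif Nat.ble a b then a else b) = min a b := by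
  cases h : Nat.ble a b
  · have : ¬ a ≤ b := by rw [← Nat.ble_eq, h]; simp
    simp only [cond_false]; omega
  · have : a ≤ b := by rw [← Nat.ble_eq, h]
    simp only [cond_true]; omega

lemma chainCheck_succ {k c A d b : ℕ} {f : ℕ → Bool} (h : chainCheck k c A (d + 1) b f = true) :
    c * 10000000000 ≤ b * (k + 2) ∧
      chainCheck k c A d (min ((10000000000 + b * (A + 1000000 * ((c - (d + 1)) *
        (c - (d + 1) - 1) / 2)) / (1000000 * c * (k - (d + 1))) + 1) / 2 + 1) 10000000000) f
        = true := by
  have h' : (Nat.ble (c * 10000000000) (b * (k + 2)) &&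
      force ((10000000000 + b * (A + 1000000 * ((c - (d + 1)) * (c - (d + 1) - 1) / 2))
        / (1000000 * c * (k - (d + 1))) + 1) / 2 + 1) fun b' =>
      chainCheck k c A d (bif Nat.ble b' 10000000000 then b' else 10000000000) f) = true := h
  simp only [force_eq, Bool.and_eq_true, Nat.ble_eq, bif_ble_eq_min] at h'
  exact h'

lemma chainCheck_sound {k c A d b : ℕ} {f : ℕ → Bool} (h : chainCheck k c A d b f = true) :
    ∃ β : ℕ → ℕ, β (d + 1) = b ∧ f (β 1) = true ∧ ∀ j, 1 ≤ j → j ≤ d →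
      β j ≤ 10000000000 ∧ c * 10000000000 ≤ β (j + 1) * (k + 2) ∧
      (β j = 10000000000 ∨ 10000000000 + β (j + 1) * (A + 1000000 * ((c - j) * (c - j - 1) / 2)) /
        (1000000 * c * (k - j)) + 1 ≤ 2 * β j) := by
  induction d generalizing b with
  | zero => exact ⟨fun _ => b, rfl, h, fun j h1 h2 => by omega⟩
  | succ d ih =>
    obtain ⟨h1, h2⟩ := chainCheck_succ h
    obtain ⟨β, hβ, hf, hj⟩ := ih h2
    refine ⟨Function.update β (d + 2) b, by simp, ?_, fun j hj1 hj2 => ?_⟩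
    · rw [Function.update_of_ne (by omega)]; exact hf
    · rcases Nat.lt_or_ge d j with hd | hd
      · obtain rfl : j = d + 1 := by omega
        rw [Function.update_self, Function.update_of_ne (by omega), hβ]
        refine ⟨min_le_right _ _, h1, ?_⟩
        set X := 10000000000 + b * (A + 1000000 * ((c - (d + 1)) * (c - (d + 1) - 1) / 2)) /
          (1000000 * c * (k - (d + 1))) + 1 with hX
        rcases le_total (X / 2 + 1) 10000000000 with hX' | hX'
        · right; rw [min_eq_left hX']; omega
        · left; exact min_eq_right hX'
      · rw [Function.update_of_ne (by omega), Function.update_of_ne (by omega)]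
        exact hj j hj1 hd

lemma descentCheck_succ {k S m A s n c : ℕ} (h : descentCheck k S (m + 1) A s n c = true) :
    (1000 * (1000000 * (k * (k + 1) / 2)) ≤ 1000 * A + k * k * 1000000 ∧ s ≤ S ∧ n ≤ 4 * k) ∨
    ∃ c r x t : ℕ, t = (2 * r - k) * (2 * r - k - 1) / 2 + (k - r) ∧
      15 ≤ c ∧ c ≤ k ∧ s ≤ 4 * k * k ∧ 4000000 * c * k ≤
        4 * A + 2000000 * c * (c - 1) + 1000000 * ((k + 2) * (k + 2) + 4) ∧
      r ≤ k ∧ k + 1 ≤ 2 * r ∧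
      4000000 * r * r ≤ 4 * A + 4000000 * t + 1000000 * ((k + 2) * (k + 2) + 4) ∧
      x ≤ 1000000 * r ∧
      A + 1000000 * r - x ≤ 1000000 * (k * (k + 1) / 2) ∧
      descentCheck k S m (A + 1000000 * r - x) (s + r) (n + 1) c = true ∧
      ∃ β : ℕ → ℕ, β 6 = 10000000000 ∧ (∀ j, 1 ≤ j → j ≤ 5 →
        β j ≤ 10000000000 ∧ c * 10000000000 ≤ β (j + 1) * (k + 2) ∧
        (β j = 10000000000 ∨ 10000000000 + β (j + 1) * (A + 1000000 * ((c - j) * (c - j - 1) / 2)) /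
          (1000000 * c * (k - j)) + 1 ≤ 2 * β j)) ∧
        r * 10000000000 ≤ β 1 * (k + 2) ∧
        x = β 1 * (A + 1000000 * t) / (10000000000 * r) + 1 := by
  have h' : (bif Nat.ble (1000 * (1000000 * (k * (k + 1) / 2))) (1000 * A + k * k * 1000000) then
        Nat.ble s S && Nat.ble n (4 * k)
      else
        force ((c * c + 2 * (A / 1000000)) / (2 * c)) fun c =>
        Nat.ble 15 c && Nat.ble c k && Nat.ble s (4 * k * k) &&
        Nat.ble (4000000 * c * k)
          (4 * A + 2000000 * c * (c - 1) + 1000000 * ((k + 2) * (k + 2) + 4)) &&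
        chainCheck k c A 5 10000000000 fun b =>
        force ((k * k + 2 * k + A / 1000000 - k * (k + 1) / 2 + (k + 1) / 2)
          / (k + 1)) fun r =>
        force (bif Nat.ble r k then r else k) fun r =>
        force ((2 * r - k) * (2 * r - k - 1) / 2 + (k - r)) fun t =>
        force (b * (A + 1000000 * t) / (10000000000 * r) + 1) fun x =>
        Nat.ble r k && Nat.ble (k + 1) (2 * r) &&
        Nat.ble (r * 10000000000) (b * (k + 2)) &&
        Nat.ble (4000000 * r * r)
          (4 * A + 4000000 * t + 1000000 * ((k + 2) * (k + 2) + 4)) &&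
        Nat.ble x (1000000 * r) &&
        force (A + 1000000 * r - x) fun A' =>
        force (s + r) fun s' =>
        force (n + 1) fun n' =>
        Nat.ble A' (1000000 * (k * (k + 1) / 2)) &&
        descentCheck k S m A' s' n' c) = true := h
  simp only [force_eq] at h'
  cases hb : Nat.ble (1000 * (1000000 * (k * (k + 1) / 2))) (1000 * A + k * k * 1000000)
  · rw [hb] at h'
    simp only [cond_false, Bool.and_eq_true, Nat.ble_eq] at h'
    obtain ⟨⟨⟨⟨h1, h2⟩, h3⟩, h4⟩, h5⟩ := h'
    obtain ⟨β, hβ, hf, hj⟩ := chainCheck_sound h5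
    simp only [Bool.and_eq_true, Nat.ble_eq] at hf
    obtain ⟨⟨⟨⟨⟨f1, f2⟩, f3⟩, f4⟩, f5⟩, f6, f7⟩ := hf
    exact Or.inr ⟨_, _, _, _, rfl, h1, h2, h3, h4, f1, f2, f4, f5, f6, f7, β, hβ, hj, f3, rfl⟩
  · rw [hb] at h'
    simp only [cond_true, Bool.and_eq_true, Nat.ble_eq] at h'
    exact Or.inl ⟨by rwa [← Nat.ble_eq], h'.1, h'.2⟩

/-- The conclusion drawn from a successful descent: an admissible exponent within `0.001 k²` of the
optimal one, for at most `S` pairs of variables. -/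
def HasExponent (k : ℕ) (S : ℝ) : Prop :=
  ∃ (s n : ℕ) (A : ℝ), 0 < s ∧ (s : ℝ) ≤ S ∧ n ≤ 4 * k ∧ PowBound k s A (iterC k n) ∧ A ≤ s ∧
    (k : ℝ) * (k + 1) / 2 - 0.001 * (k : ℝ) ^ 2 ≤ A

lemma natCast_choose_two (n : ℕ) : ((n * (n - 1) / 2 : ℕ) : ℝ) = (n : ℝ) * (n - 1) / 2 := by
  rw [← Nat.choose_two_right, Nat.cast_choose_two]

lemma natCast_mul_succ_div_two (n : ℕ) : ((n * (n + 1) / 2 : ℕ) : ℝ) = (n : ℝ) * (n + 1) / 2 := by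
  have := natCast_choose_two (n + 1)
  rw [Nat.add_sub_cancel, mul_comm] at this
  rw [this]; push_cast; ring

lemma weight_ineq {k c A d b b' : ℕ} (hc : 0 < c) (hdc : d ≤ c) (hdk : d < k)
    (h : 10000000000 + b * (A + 1000000 * ((c - d) * (c - d - 1) / 2)) / (1000000 * c * (k - d)) + 1
      ≤ 2 * b') :
    (k : ℝ) - d + (b : ℝ) / 10000000000 * ((A : ℝ) / 1000000 + (c - d) * (c - d - 1) / 2) / c ≤
      2 * ((b' : ℝ) / 10000000000) * (k - d) := by
  have hkd : (0 : ℝ) < k - d := by rw [sub_pos]; exact_mod_cast hdk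
  have hc0 : (0 : ℝ) < c := by exact_mod_cast hc
  have hfl := Nat.lt_floor_add_one ((b * (A + 1000000 *
    ((c - d) * (c - d - 1) / 2)) : ℕ) / (1000000 * c * (k - d) : ℕ) : ℝ)
  rw [Nat.floor_div_natCast, Nat.floor_natCast] at hfl
  have h' : (10000000000 : ℝ) + ((b * (A + 1000000 * ((c - d) * (c - d - 1) / 2)) /
    (1000000 * c * (k - d)) : ℕ) : ℝ) + 1 ≤ 2 * b' := by exact_mod_cast h
  have hq := hfl.le.trans (show _ ≤ 2 * (b' : ℝ) - 10000000000 by linarith)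
  have ht := natCast_choose_two (c - d)
  generalize (c - d) * (c - d - 1) / 2 = t at hq ht
  push_cast [Nat.cast_sub hdc, Nat.cast_sub hdk.le] at hq ht
  rw [← ht]
  rw [div_le_iff₀ (by positivity)] at hq
  rw [← sub_nonneg]
  have e : 2 * ((b' : ℝ) / 10000000000) * (k - d) - ((k : ℝ) - d +
      (b : ℝ) / 10000000000 * ((A : ℝ) / 1000000 + t) / c) =
      ((2 * (b' : ℝ) - 10000000000) * (1000000 * c * (k - d)) -
      b * (A + 1000000 * t)) / (10000000000 * 1000000 * c) := by
    field_simp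
    ring
  rw [e]
  exact div_nonneg (by linarith) (by positivity)

set_option maxHeartbeats 1000000 in
lemma descentCheck_sound {k S m A s n c : ℕ} (hk : 129 ≤ k) (hs : 0 < s)
    (hAs : (A / 1000000 : ℝ) ≤ s) (hb : PowBound k s (A / 1000000 : ℝ) (iterC k n))
    (h : descentCheck k S m A s n c = true) : HasExponent k S := by
  induction m generalizing A s n c with
  | zero => exact absurd h (by simp [descentCheck])
  | succ m ih =>
    rcases descentCheck_succ h with ⟨h1, h2, h3⟩ | ⟨c, r, x, t, ht, h1, h2, h3, h4, h5, h6, h7, h8,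
      h9, h10, β, hβ, hj, h11, hx⟩
    · refine ⟨s, n, _, hs, by exact_mod_cast h2, h3, hb, hAs, ?_⟩
      have h1' : (1000 * (1000000 * ((k * (k + 1) / 2 : ℕ) : ℝ))) ≤ 1000 * A + k * k * 1000000 := by
        exact_mod_cast h1
      rw [natCast_mul_succ_div_two] at h1'
      linarith
    · have hkr : k < 2 * r := by omega
      have hr0 : (0 : ℝ) < r := by exact_mod_cast (show 0 < r by omega)
      have hc0 : (15 : ℝ) ≤ c := by exact_mod_cast h1
      have hck : (c : ℝ) ≤ k := by exact_mod_cast h2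
      have hk0 : (129 : ℝ) ≤ k := by exact_mod_cast hk
      have ht' : (t : ℝ) = (2 * r - k) * (2 * r - k - 1) / 2 + (k - r) := by
        rw [ht]; push_cast [Nat.cast_sub h5, natCast_choose_two, Nat.cast_sub hkr.le]; ring
      have hA' : ((A + 1000000 * r - x : ℕ) : ℝ) = A + 1000000 * r - x := by
        rw [Nat.cast_sub (by omega)]; push_cast; ring
      have hxr : (β 1 : ℝ) * (A + 1000000 * t) / (10000000000 * r) ≤ x := by
        rw [hx]
        have := Nat.lt_floor_add_one ((β 1 * (A + 1000000 * t) : ℕ) / (10000000000 * r : ℕ) : ℝ)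
        rw [Nat.floor_div_natCast, Nat.floor_natCast] at this
        push_cast at this ⊢
        linarith
      have h8' : (x : ℝ) ≤ 1000000 * r := by exact_mod_cast h8
      refine ih (by omega) ?_ ?_ h10
      · rw [hA']; push_cast; 
        have : (0 : ℝ) ≤ x := by positivity
        linarith
      · have hβle : ∀ j, 1 ≤ j → j ≤ 6 → β j ≤ 10000000000 := by
          intro j hj1 hj2
          rcases Nat.lt_or_ge j 6 with h | h
          · exact (hj j hj1 (by omega)).1
          · rw [show j = 6 by omega, hβ]
        have hgr : (r : ℝ) * r - A / 1000000 - t ≤ gExp k := by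
          have h7' : (4000000 : ℝ) * r * r ≤
            4 * A + 4000000 * t + 1000000 * ((k + 2) * (k + 2) + 4) := by exact_mod_cast h7
          unfold gExp; nlinarith
        have hg : (c : ℝ) * k - A / 1000000 - c * (c - 1) / 2 ≤ gExp k := by
          have h4' : (4000000 : ℝ) * c * k ≤ 4 * A + 2000000 * c * ((c - 1 : ℕ) : ℝ) +
            1000000 * ((k + 2) * (k + 2) + 4) := by exact_mod_cast h4
          rw [Nat.cast_sub (by omega), Nat.cast_one] at h4'
          unfold gExp; nlinarith
        set b : ℕ → ℝ := fun d => if 1 ≤ d ∧ d ≤ 6 then (β d : ℝ) / 10000000000 else 1 with hbdef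
        have hb1 : b 1 = (β 1 : ℝ) / 10000000000 := by simp [hbdef]
        have h9' : (A + 1000000 * r - x : ℝ) ≤ 1000000 * (k * (k + 1) / 2) := by
          rw [← hA', ← natCast_mul_succ_div_two]; exact_mod_cast h9
        refine powBound_step b hk hs ?_ (by positivity) hAs (by positivity) ?_ hb h1 h2 hg ?_ ?_ ?_
          ?_ ?_ h5 hkr ?_ (by rw [← ht']; exact hgr) ?_
        · calc s ≤ 4 * k * k := h3
            _ ≤ k * k * k * k := by nlinarith [Nat.mul_le_mul hk hk, Nat.zero_le (k * k)]
            _ = k ^ 4 := by ring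
        · rw [hA']; linarith
        · intro d; simp only [hbdef]; split_ifs <;> positivity
        · intro d; simp only [hbdef]; split_ifs with hd
          · rw [div_le_one (by norm_num)]; exact_mod_cast hβle d hd.1 hd.2
          · exact le_rfl
        · simp [hbdef]
        · intro d hd1 hd2
          simp only [hbdef]
          split_ifs with hd
          · have := (hj (d - 1) (by omega) (by omega)).2.1
            rw [show d - 1 + 1 = d by omega] at this
            have : (c : ℝ) * 10000000000 ≤ β d * (k + 2) := by exact_mod_cast this
            linarith
          · linarith
        · intro d hd1 hd2
          rcases Nat.lt_or_ge 5 d with hd | hd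
          · left; simp only [hbdef]
            split_ifs with hd'
            · rw [show d = 6 by omega, hβ]; norm_num
            · rfl
          · rcases (hj d hd1 hd).2.2 with h | h
            · left; simp only [hbdef]; rw [if_pos ⟨hd1, by omega⟩, h]; norm_num
            · right
              simp only [hbdef]
              rw [if_pos (show 1 ≤ d ∧ d ≤ 6 by omega),
                if_pos (show 1 ≤ d + 1 ∧ d + 1 ≤ 6 by omega)]
              exact weight_ineq (by omega) (by omega) (by omega) h
        · rw [hb1]
          have : (r : ℝ) * 10000000000 ≤ β 1 * (k + 2) := by exact_mod_cast h11
          linarith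
        · rw [hA', hb1, ← ht']
          have e : (β 1 : ℝ) / 10000000000 * ((A : ℝ) / 1000000 + t) / r =
            (β 1 : ℝ) * (A + 1000000 * t) / (10000000000 * r) / 1000000 := by
            field_simp
          rw [e]; linarith

lemma hasExponent_of_lt {k : ℕ} (hk : 129 ≤ k) (hk' : k < 180) :
    HasExponent k ((if 150 ≤ k then 3.21734 else 3.22313) * (k : ℝ) ^ 2) := by
  have h := smallCheck_eq_true (k - 129) (by omega)
  rw [show 129 + (k - 129) = k by omega] at h
  have hs : HasExponent k
      (((bif Nat.ble 150 k then 321734 else 322313) * k * k / 100000 : ℕ) : ℝ) := by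
    refine descentCheck_sound (A := 1000000 * k) hk (by omega) (by push_cast; linarith) ?_ h
    have := powBound_self hk
    rwa [show ((1000000 * k : ℕ) : ℝ) / 1000000 = k by push_cast; ring]
  obtain ⟨s, n, A, h1, h2, h3⟩ := hs
  refine ⟨s, n, A, h1, h2.trans (Nat.cast_div_le.trans ?_), h3⟩
  by_cases h : 150 ≤ k
  · rw [if_pos h, show Nat.ble 150 k = true by rwa [Nat.ble_eq]]
    push_cast; simp only [cond_true]; push_cast; nlinarith
  · rw [if_neg h, show Nat.ble 150 k = false by rw [Bool.eq_false_iff]; exact fun h' => h (Nat.le_of_ble_eq_true h')]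
    push_cast; simp only [cond_false]; push_cast; nlinarith

end SmallDegrees

section LargeDegrees

lemma exists_nat_near_sqrt {k : ℕ} {A : ℝ} (hk : 180 ≤ k) (hkA : k ≤ A)
    (hAK : A ≤ (k : ℝ) * (k + 1) / 2) :
    ∃ c : ℕ, 18 ≤ c ∧ c ≤ k ∧ (c : ℝ) ≤ √(2 * A) + 1 / 2 ∧ √(2 * A) ≤ c + 1 / 2 := by
  have hk0 : (180 : ℝ) ≤ k := by exact_mod_cast hk
  have h18 : (18 : ℝ) ≤ √(2 * A) + 1 / 2 := by
    have : (17.5 : ℝ) ≤ √(2 * A) := Real.le_sqrt_of_sq_le (by linarith)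
    linarith
  have hy : √(2 * A) < k + 1 / 2 := by
    rw [Real.sqrt_lt' (by linarith)]
    nlinarith
  refine ⟨⌊√(2 * A) + 1 / 2⌋₊, Nat.le_floor (by exact_mod_cast h18), ?_,
    Nat.floor_le (by linarith), ?_⟩
  · rw [← Nat.lt_succ_iff, Nat.floor_lt (by linarith)]
    push_cast; linarith
  · have := Nat.lt_floor_add_one (√(2 * A) + 1 / 2)
    linarith

lemma first_gain {k c A x w γ H : ℝ} (hk : 180 ≤ k) (hc : 0 < c) (hA0 : 0 ≤ A)
    (hc1 : c ≤ √(2 * A) + 1 / 2) (hc2 : √(2 * A) ≤ c + 1 / 2)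
    (hA : A ≤ k * (k + 1) / 2 - x * k ^ 2) (hw : 0 < w) (hw1 : w ≤ 1) (hH : 1 ≤ 2 * c * H)
    (hγ : γ ≤ 1 + 1 / 360 - ((181 / 180 - 2 * x) / w + w) / 2 - H / 720) :
    A + c * (c - 1) / 2 ≤ c * k * (1 - γ) := by
  have hy0 : 0 ≤ √(2 * A) := Real.sqrt_nonneg _
  have hy2 : √(2 * A) ^ 2 = 2 * A := Real.sq_sqrt (by linarith)
  set y := √(2 * A)
  have hkw : 0 < 2 * k * w := by positivity
  have h1 : y ≤ (k * (1 - 2 * x) / w + 1 / w + k * w) / 2 := by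
    have e : (k * (1 - 2 * x) / w + 1 / w + k * w) / 2 =
        (k ^ 2 * (1 - 2 * x) + k + k ^ 2 * w ^ 2) / (2 * k * w) := by field_simp
    rw [e, le_div_iff₀ hkw]
    nlinarith [sq_nonneg (y - k * w)]
  have hw' : 1 ≤ 1 / w := by rw [le_div_iff₀ hw]; linarith
  have hH0 : 0 < H := by
    by_contra! h
    nlinarith [mul_nonneg hc.le (neg_nonneg.2 h)]
  have e2 : (181 / 180 - 2 * x) / w = (1 - 2 * x) / w + 1 / w / 180 := by field_simp; ring
  have h2 : k * γ + y ≤ k + 1 / 2 - H / 4 := by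
    have h3 : k * γ ≤ k * (1 + 1 / 360 - ((181 / 180 - 2 * x) / w + w) / 2 - H / 720) := by gcongr
    rw [e2] at h3
    have e3 : k * (1 - 2 * x) / w = k * ((1 - 2 * x) / w) := by ring
    rw [e3] at h1
    nlinarith [mul_nonneg (show 0 ≤ k / 180 - 1 by linarith) (sub_nonneg.2 hw'),
      mul_nonneg (show 0 ≤ k / 180 - 1 by linarith) hH0.le]
  have h4 : (c - y) ^ 2 ≤ 1 / 4 := by nlinarith
  nlinarith [mul_le_mul_of_nonneg_left h2 hc.le]

lemma level_gain {k c A γ H e d : ℝ} (hk : 180 ≤ k) (hc : 0 < c) (hd : 0 ≤ d) (hd' : d < 180)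
    (hH : 1 ≤ 2 * c * H) (h0 : A + c * (c - 1) / 2 ≤ c * k * (1 - γ)) (he : 0 ≤ e)
    (hed : (d + 1) * H - γ ≤ e) :
    (A + (c - d) * (c - d - 1) / 2) / c ≤ (k - d) * (1 - γ + d * e / (180 - d)) := by
  rw [div_le_iff₀ hc]
  have h1 : d * e ≤ (k - d) * (d * e / (180 - d)) := by
    have h180 : 0 < 180 - d := by linarith
    rw [mul_div_assoc', le_div_iff₀ h180, mul_comm (d * e)]
    have : 0 ≤ d * e := by positivity
    gcongr
  have h2 : d * ((d + 1) * H - γ) ≤ d * e := mul_le_mul_of_nonneg_left hed hd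
  have h3 : c * (d * ((d + 1) * H - γ)) ≤ c * ((k - d) * (d * e / (180 - d))) :=
    mul_le_mul_of_nonneg_left (h2.trans h1) hc.le
  nlinarith [mul_le_mul_of_nonneg_left hH (show 0 ≤ d * (d + 1) / 2 by positivity)]

lemma last_gain {k r W Δ A T x b R : ℝ} (hr : 0 < r) (hΔ : 0 ≤ Δ) (hW : W = k ^ 2 + 2 * k - Δ)
    (hW0 : 0 < W) (hr1 : W ≤ (k + 2) * r) (hr2 : (k + 2) * r < W + (k + 2)) (hr3 : k + 2 ≤ 2 * r)
    (hA : A = k * (k + 1) / 2 - Δ) (hT : T = (2 * r - k) * (2 * r - k - 1) / 2 + (k - r))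
    (hk : 180 ≤ k) (hx0 : 0 ≤ x) (hx1 : x ≤ 1 / 2) (hx : x * k ^ 2 ≤ Δ) (hb : 0 ≤ b)
    (hR : R ≤ 1 - (1 - 180 * x / (182 - 180 * x)) * b) :
    A + r * R ≤ A + r - b * (A + T) / r := by
  have h1 : A + T = 2 * r ^ 2 - 2 * r * (k + 1) + W := by rw [hA, hT, hW]; ring
  have hsq : (W - (k + 1) * r) ^ 2 ≤ r ^ 2 := by
    apply sq_le_sq'
    · nlinarith
    · nlinarith
  have h2 : 180 * x / (182 - 180 * x) ≤ Δ / W := by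
    rw [div_le_div_iff₀ (by linarith) hW0, hW]
    have : x * (k ^ 2 + 2 * k) * 180 ≤ Δ * 182 := by nlinarith [mul_nonneg hx0 (sub_nonneg.2 hk)]
    nlinarith
  have h3 : (A + T) / r ≤ r * (1 - Δ / W) := by
    rw [div_le_iff₀ hr, h1]
    have e : r * (1 - Δ / W) * r - (2 * r ^ 2 - 2 * r * (k + 1) + W) =
        (r ^ 2 - (W - (k + 1) * r) ^ 2) / W := by
      field_simp
      rw [hW]; ring
    have : 0 ≤ (r ^ 2 - (W - (k + 1) * r) ^ 2) / W := div_nonneg (by linarith) hW0.le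
    linarith
  have h4 : b * (A + T) / r ≤ b * (r * (1 - 180 * x / (182 - 180 * x))) := by
    rw [mul_div_assoc]
    refine mul_le_mul_of_nonneg_left (h3.trans ?_) hb
    gcongr
  nlinarith [mul_le_mul_of_nonneg_left hR hr.le]

lemma inv_le_of_near_sqrt {k c A x' v H : ℝ} (hk : 180 ≤ k) (hc2 : √(2 * A) ≤ c + 1 / 2)
    (hA : k * (k + 1) / 2 - x' * k ^ 2 ≤ A) (hv : 0 < v) (hv2 : v ^ 2 ≤ 1 - 2 * x')
    (hv1 : v ≤ 719 / 720) (hH : 1 ≤ 360 * v * H) : 1 ≤ 2 * c * H := by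
  have h1 : k * v + 1 / 2 ≤ √(2 * A) := by
    apply Real.le_sqrt_of_sq_le
    nlinarith [mul_le_mul_of_nonneg_left hv2 (sq_nonneg k),
      mul_nonneg (show 0 ≤ k - 180 by linarith) (sub_nonneg.2 hv1)]
  have hH0 : 0 < H := by
    by_contra! h
    nlinarith [mul_nonneg hv.le (neg_nonneg.2 h)]
  have h2 : 180 * v ≤ c := by nlinarith
  nlinarith [mul_le_mul_of_nonneg_right h2 hH0.le]

/-- Numerical data certifying that, for all degrees `k ≥ 180` and all exponents whose distance to
the optimal one lies between `x k²` and `x' k²`, a differencing step with `r` new pairs of variables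
increases the exponent by at least `r R`. -/
structure PieceData (x x' R w γ H : ℝ) (b : ℕ → ℝ) : Prop where
  pos : 0 < x
  le_half : x' ≤ 1 / 2
  w_pos : 0 < w
  w_le : w ≤ 1
  γ_nonneg : 0 ≤ γ
  γ_le : γ ≤ 1 + 1 / 360 - ((181 / 180 - 2 * x) / w + w) / 2 - H / 720
  H_ge : 1 / 36 ≤ H ∨ ∃ v : ℝ, 0 < v ∧ v ^ 2 ≤ 1 - 2 * x' ∧ v ≤ 719 / 720 ∧ 1 ≤ 360 * v * H
  b_nonneg : ∀ d, 0 ≤ b d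
  b_le : ∀ d, b d ≤ 1
  b_top : b 12 = 1
  b_ge : ∀ d, 1 ≤ b d * (1 + γ)
  b_step : ∀ d : ℕ, 1 ≤ d → d ≤ 11 → b d = 1 ∨ ∃ e : ℝ, 0 ≤ e ∧ (d + 1) * H - γ ≤ e ∧
    1 + b (d + 1) * (1 - γ + d * e / (180 - d)) ≤ 2 * b d
  b_one_ge : 1 - x ≤ b 1
  b_one_ge' : 1 - x + (4 * x - 1) / 182 ≤ b 1
  R_le : R ≤ 1 - (1 - 180 * x / (182 - 180 * x)) * b 1
  R_pos : 0 < R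
  R_le_one : R ≤ 1
  R_le_mul : R ≤ 180 * x
  le_R : 8 * x' ≤ 5 * R

/-- The data carried along the iteration: after `n` steps the exponent `A` has been reached with
`s` pairs of variables. -/
structure Reached (k s n : ℕ) (A : ℝ) : Prop where
  pos : 0 < s
  le_s : A ≤ s
  ge : k ≤ A
  le : A ≤ (k : ℝ) * (k + 1) / 2
  count : (k : ℝ) * n ≤ s + 5 / 4 * A
  bound : PowBound k s A (iterC k n)

lemma exists_num_vars {k : ℕ} {Δ : ℝ} (hk : 180 ≤ k) (hΔ0 : 0 ≤ Δ)
    (hΔ1 : Δ ≤ (k : ℝ) ^ 2 / 2) :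
    ∃ r : ℕ, r ≤ k ∧ k + 2 ≤ 2 * r ∧ (k : ℝ) ^ 2 + 2 * k - Δ ≤ (k + 2) * r ∧
      (k + 2) * (r : ℝ) < (k : ℝ) ^ 2 + 2 * k - Δ + (k + 2) := by
  have hk0 : (180 : ℝ) ≤ k := by exact_mod_cast hk
  set W := (k : ℝ) ^ 2 + 2 * k - Δ with hW
  have hW0 : 0 < W := by nlinarith
  have hk2 : (0 : ℝ) < k + 2 := by linarith
  have hr1 : W ≤ (k + 2) * ⌈W / (k + 2)⌉₊ := by
    have := Nat.le_ceil (W / (k + 2))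
    rwa [div_le_iff₀' hk2] at this
  refine ⟨⌈W / (k + 2)⌉₊, ?_, ?_, hr1, ?_⟩
  · rw [Nat.ceil_le, div_le_iff₀ hk2]
    nlinarith
  · by_contra! hlt
    have h1 : (2 : ℝ) * ⌈W / (k + 2)⌉₊ + 1 ≤ k + 2 := by exact_mod_cast hlt
    nlinarith
  · have := Nat.ceil_lt_add_one (show 0 ≤ W / (k + 2) by positivity)
    rw [← sub_lt_iff_lt_add, lt_div_iff₀ hk2] at this
    linarith

set_option maxHeartbeats 1000000 in
lemma PieceData.step {x x' R w γ H : ℝ} {b : ℕ → ℝ} (h : PieceData x x' R w γ H b) {k s n : ℕ}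
    {A : ℝ} (hk : 180 ≤ k) (hA : Reached k s n A) (hs : (s : ℝ) ≤ 4 * (k : ℝ) ^ 2)
    (hx : x * (k : ℝ) ^ 2 ≤ (k : ℝ) * (k + 1) / 2 - A)
    (hx' : (k : ℝ) * (k + 1) / 2 - A ≤ x' * (k : ℝ) ^ 2) :
    ∃ r : ℕ, 1 ≤ r ∧ r ≤ k ∧ Reached k (s + r) (n + 1) (A + r * R) := by
  have hk0 : (180 : ℝ) ≤ k := by exact_mod_cast hk
  obtain ⟨c, h18, hck, hc1, hc2⟩ := exists_nat_near_sqrt hk hA.ge hA.le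
  have hA0 : 0 ≤ A := by linarith [hA.ge]
  have hc0 : (18 : ℝ) ≤ c := by exact_mod_cast h18
  have hcpos : (0 : ℝ) < c := by linarith
  have hck' : (c : ℝ) ≤ k := by exact_mod_cast hck
  have hx0 := h.pos
  have hxx' : x ≤ x' := le_of_mul_le_mul_right (hx.trans hx') (by positivity)
  have hx1 : x ≤ 1 / 2 := hxx'.trans h.le_half
  have hH : 1 ≤ 2 * (c : ℝ) * H := by
    rcases h.H_ge with hH | ⟨v, hv, hv2, hv1, hvH⟩
    · nlinarith only [hH, hc0]
    · exact inv_le_of_near_sqrt hk0 hc2 (by linarith) hv hv2 hv1 hvH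
  have hγ := first_gain hk0 hcpos hA0 hc1 hc2 (by linarith) h.w_pos h.w_le hH h.γ_le
  have hAc : (c : ℝ) ^ 2 - c + 1 / 4 ≤ 2 * A := by
    have := Real.sq_sqrt (show 0 ≤ 2 * A by linarith)
    nlinarith only [Real.sqrt_nonneg (2 * A), this, hc1, hc0]
  have hcγ : (c : ℝ) * (1 + γ) ≤ k + 1 := by
    have : (k : ℝ) * (c * (1 + γ)) ≤ k * (k + 1) := by
      nlinarith only [sq_nonneg ((c : ℝ) - k), hγ, hAc, hck']
    exact le_of_mul_le_mul_left this (by linarith)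
  have hγ1 : 0 < 1 + γ := by linarith [h.γ_nonneg]
  have hcb : ∀ d, (c : ℝ) ≤ b d * (k + 2) := by
    intro d
    have h1 := mul_le_mul_of_nonneg_left (h.b_ge d) hcpos.le
    have h2 := mul_le_mul_of_nonneg_left hcγ (h.b_nonneg d)
    nlinarith only [h1, h2, h.b_nonneg d]
  set Δ := (k : ℝ) * (k + 1) / 2 - A with hΔ
  have hΔ0 : 0 ≤ Δ := le_trans (by positivity) hx
  have hΔ1 : Δ ≤ (k : ℝ) ^ 2 / 2 := by nlinarith only [hx', h.le_half, sq_nonneg (k : ℝ)]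
  obtain ⟨r, hrk, hr3, hr1, hr2⟩ := exists_num_vars hk hΔ0 hΔ1
  set W := (k : ℝ) ^ 2 + 2 * k - Δ with hW
  have hW0 : 0 < W := by nlinarith only [hΔ1, hk0, hW]
  have hk2 : (0 : ℝ) < k + 2 := by linarith
  have hrk' : (r : ℝ) ≤ k := by exact_mod_cast hrk
  have hr3' : (k : ℝ) + 2 ≤ 2 * r := by exact_mod_cast hr3
  have hr0 : (0 : ℝ) < r := by linarith
  have hAr := last_gain (A := A) hr0 hΔ0 hW hW0 hr1 hr2 hr3' (by linarith) rfl hk0 hx0.le hx1 hx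
    (h.b_nonneg 1) h.R_le
  have hΔ' : (r : ℝ) * R ≤ Δ := by
    have h1 : (r : ℝ) * R ≤ k * (180 * x) := mul_le_mul hrk' h.R_le_mul h.R_pos.le (by linarith)
    have h2 : (k : ℝ) * (180 * x) ≤ x * k ^ 2 := by
      nlinarith only [mul_nonneg hx0.le (show (0 : ℝ) ≤ (k - 180) * k by
        exact mul_nonneg (by linarith) (by linarith))]
    linarith
  have hrR : (r : ℝ) * R ≤ r := mul_le_of_le_one_right hr0.le h.R_le_one
  have hrR0 : 0 ≤ (r : ℝ) * R := mul_nonneg hr0.le h.R_pos.le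
  refine ⟨r, by omega, hrk, by omega, ?_, by linarith [hA.ge], by linarith, ?_, ?_⟩
  · push_cast; linarith [hA.le_s]
  · push_cast
    have h1 : (k : ℝ) ≤ r + x' * k := by
      have h2 : Δ ≤ x' * k * (k + 2) := by
        have : 0 ≤ x' := hx0.le.trans hxx'
        nlinarith only [hx', mul_nonneg this (show (0 : ℝ) ≤ k by linarith)]
      have h3 : (k + 2) * (k : ℝ) ≤ (k + 2) * (r + x' * k) := by nlinarith only [hr1, hW, h2]
      exact le_of_mul_le_mul_left h3 hk2
    have h2 : x' * k ≤ 5 / 4 * (r * R) := by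
      nlinarith only [mul_le_mul_of_nonneg_right h.le_R (show (0 : ℝ) ≤ k by linarith),
        mul_le_mul_of_nonneg_right hr3' h.R_pos.le, h.R_pos]
    linarith [hA.count]
  · refine powBound_step b (by omega) hA.pos ?_ hA0 hA.le_s (by linarith) (by linarith) hA.bound
      (by omega) hck ?_ h.b_nonneg h.b_le h.b_top (fun d _ _ => hcb d) ?_ hrk (by omega) ?_ ?_ hAr
    · have h1 : (s : ℝ) ≤ (k ^ 4 : ℕ) := by
        push_cast
        have : (4 : ℝ) ≤ (k : ℝ) ^ 2 := by nlinarith only [hk0]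
        calc (s : ℝ) ≤ 4 * (k : ℝ) ^ 2 := hs
          _ ≤ (k : ℝ) ^ 2 * (k : ℝ) ^ 2 := by gcongr
          _ = (k : ℝ) ^ 4 := by ring
      exact_mod_cast h1
    · unfold gExp
      nlinarith only [sq_nonneg ((k : ℝ) + 1 - 2 * c), hAc, hk0, hc0]
    · intro d hd1 hd2
      rcases h.b_step d hd1 hd2 with h1 | ⟨e, he, hed, h2⟩
      · exact Or.inl h1
      · right
        have hd' : (d : ℝ) ≤ 11 := by exact_mod_cast hd2
        have h3 := level_gain hk0 hcpos d.cast_nonneg (by linarith) hH hγ he hed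
        have hkd : (0 : ℝ) ≤ k - d := by linarith
        have h4 := mul_le_mul_of_nonneg_left h3 (h.b_nonneg (d + 1))
        have h5 := mul_le_mul_of_nonneg_left h2 hkd
        rw [mul_div_assoc]
        linarith
    · have h1 := h.b_one_ge
      have h2 := h.b_one_ge'
      have h3 : ((k : ℝ) + 2) * r ≤ (k + 2) * (b 1 * (k + 2)) := by
        have h4 : ((k : ℝ) + 2) * r ≤ (k + 2) * (k + 1) - x * k ^ 2 := by nlinarith only [hr2, hW, hx]
        rcases le_total x (1 / 4) with hx4 | hx4
        · nlinarith only [mul_le_mul_of_nonneg_right h1 (sq_nonneg ((k : ℝ) + 2)), h4, hx4, hk0, hx0,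
            mul_nonneg (sub_nonneg.2 hx4) (show (0 : ℝ) ≤ k by linarith)]
        · nlinarith only [mul_le_mul_of_nonneg_right h2 (sq_nonneg ((k : ℝ) + 2)), h4, hx4, hk0, hx1,
            mul_nonneg (show 0 ≤ 4 * x - 1 by linarith) (show (0 : ℝ) ≤ (k - 180) * (k + 2) by
              apply mul_nonneg <;> linarith)]
      exact le_of_mul_le_mul_left h3 hk2
    · have h1 : Δ ≤ (k + 2) * (k + 1 - r) := by nlinarith only [hr2, hW]
      have h2 : (r : ℝ) * r - A - ((2 * r - k) * (2 * r - k - 1) / 2 + (k - r)) =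
        1 + Δ - (k + 1 - r) ^ 2 := by rw [hΔ]; ring
      rw [h2]
      unfold gExp
      nlinarith only [sq_nonneg (2 * ((k : ℝ) + 1 - r) - (k + 2)), h1]

/-- Every state within `δ k²` of the optimal exponent that satisfies the stated bound on the number
of variables can be completed within the budget `3.21432 k²`. -/
def Completes (k : ℕ) (v δ R : ℝ) : Prop :=
  ∀ (s n : ℕ) (A : ℝ), Reached k s n A → (k : ℝ) * (k + 1) / 2 - A ≤ δ * (k : ℝ) ^ 2 →
    (s : ℝ) ≤ 3.21432 * (k : ℝ) ^ 2 →
    s + v * (k : ℝ) ^ 2 + ((k : ℝ) * (k + 1) / 2 - A - δ * (k : ℝ) ^ 2) / R ≤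
      3.21432 * (k : ℝ) ^ 2 - k →
    HasExponent k (3.21432 * (k : ℝ) ^ 2)

lemma completes_zero {k : ℕ} (hk : 180 ≤ k) (R : ℝ) : Completes k 0 0.001 R := by
  intro s n A hA hδ hs _
  have hk0 : (180 : ℝ) ≤ k := by exact_mod_cast hk
  refine ⟨s, n, A, hA.pos, hs, ?_, hA.bound, hA.le_s, by linarith⟩
  have h1 : (k : ℝ) * n ≤ k * (4 * k) := by nlinarith only [hA.count, hA.le, hs, hk0]
  have h2 : (n : ℝ) ≤ 4 * k := le_of_mul_le_mul_left h1 (by linarith)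
  exact_mod_cast h2

lemma Completes.piece {k : ℕ} {v v' x x' R R' w γ H : ℝ} {b : ℕ → ℝ} (hc : Completes k v x R')
    (h : PieceData x x' R w γ H b) (hk : 180 ≤ k) (hv : 0 ≤ v) (hR' : 0 < R') (hR : R' ≤ R)
    (hv' : v + (x' - x) / R ≤ v') : Completes k v' x' R := by
  have hk0 : (180 : ℝ) ≤ k := by exact_mod_cast hk
  have hR0 := h.R_pos
  have main : ∀ (m s n : ℕ) (A : ℝ), Reached k s n A →
      (k : ℝ) * (k + 1) / 2 - A ≤ x * (k : ℝ) ^ 2 + m * R →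
      (k : ℝ) * (k + 1) / 2 - A ≤ x' * (k : ℝ) ^ 2 → (s : ℝ) ≤ 3.21432 * (k : ℝ) ^ 2 →
      s + v * (k : ℝ) ^ 2 + ((k : ℝ) * (k + 1) / 2 - A - x * (k : ℝ) ^ 2) / R ≤
        3.21432 * (k : ℝ) ^ 2 - k → HasExponent k (3.21432 * (k : ℝ) ^ 2) := by
    intro m
    induction m with
    | zero =>
      intro s n A hA hm _ hs hb
      have hm' : (k : ℝ) * (k + 1) / 2 - A ≤ x * (k : ℝ) ^ 2 := by simpa using hm
      refine hc s n A hA hm' hs (le_trans ?_ hb)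
      gcongr _ + ?_
      rw [div_le_div_iff₀ hR' hR0]
      nlinarith
    | succ m ih =>
      intro s n A hA hm hx hs hb
      rcases le_total ((k : ℝ) * (k + 1) / 2 - A) (x * (k : ℝ) ^ 2) with hlt | hge
      · refine ih s n A hA (hlt.trans ?_) hx hs hb
        have : 0 ≤ (m : ℝ) * R := by positivity
        linarith
      · have hpos : 0 ≤ ((k : ℝ) * (k + 1) / 2 - A - x * (k : ℝ) ^ 2) / R :=
          div_nonneg (by linarith) hR0.le
        have hvk : 0 ≤ v * (k : ℝ) ^ 2 := by positivity
        obtain ⟨r, hr1, hrk, hA'⟩ := h.step hk hA (by nlinarith only [hs, sq_nonneg (k : ℝ)]) hge hx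
        have hr1' : (1 : ℝ) ≤ r := by exact_mod_cast hr1
        have hrk' : (r : ℝ) ≤ k := by exact_mod_cast hrk
        have hrR : R ≤ r * R := le_mul_of_one_le_left hR0.le hr1'
        refine ih (s + r) (n + 1) _ hA' ?_ (by linarith) ?_ ?_
        · push_cast at hm; linarith
        · push_cast; linarith
        · refine le_trans (le_of_eq ?_) hb
          push_cast
          field_simp
          ring
  intro s n A hA hx hs hb
  obtain ⟨m, hm⟩ := exists_nat_ge (((k : ℝ) * (k + 1) / 2 - A - x * (k : ℝ) ^ 2) / R)
  rw [div_le_iff₀ hR0] at hm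
  refine main m s n A hA (by linarith) hx hs (le_trans ?_ hb)
  have h1 := mul_le_mul_of_nonneg_right hv' (sq_nonneg (k : ℝ))
  have h2 : ((k : ℝ) * (k + 1) / 2 - A - x * (k : ℝ) ^ 2) / R =
    ((k : ℝ) * (k + 1) / 2 - A - x' * (k : ℝ) ^ 2) / R + (x' - x) / R * k ^ 2 := by
    field_simp; ring
  rw [h2]
  linarith

/-- Computes the weights at levels `d, …, 1` from the weight `b` at level `d + 1` in units of
`10 ^ (-10)`, uniformly in the degree, and passes the last weight to `f`. -/
def weightCheck (γ H : ℕ) : ℕ → ℕ → (ℕ → Bool) → Bool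
  | 0, b, f => f b
  | d + 1, b, f =>
    force ((10000000000 + (b * (10000000000 - γ + ((d + 1) * ((d + 2) * H - γ) / (180 - (d + 1)) + 1))
      / 10000000000 + 1)) / 2 + 1) fun b' =>
    force (bif Nat.ble b' 10000000000 then b' else 10000000000) fun b' =>
    Nat.ble (10000000000 * 10000000000) (b' * (10000000000 + γ)) && weightCheck γ H d b' f

/-- Checks the pieces of a geometric grid from `x` up to one half, `R` being the rate on the
previous piece and `v` the number of variables used up so far, in units of `10 ^ (-10)`. -/
def gridCheck : ℕ → ℕ → ℕ → ℕ → ℕ → Bool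
  | 0, _, _, _, _ => false
  | m + 1, x, w, R, v =>
    bif Nat.ble 5000000000 x then
      Nat.ble (90 * v + 10000000000) (90 * 32143200000)
    else
      force (bif Nat.ble (x + x / 200) 5000000000 then x + x / 200 else 5000000000) fun x' =>
      force ((w + (1810000000000 - 360 * x) * 10000000000 / (180 * w)) / 2) fun w =>
      force (bif Nat.ble w 10000000000 then w else 10000000000) fun w =>
      force (w - (29411764 + x / 90) * 10000000000 / w) fun u =>
      force (bif Nat.ble 1 u && (Nat.ble (u * u + 20000000000 * x') (10000000000 * 10000000000)
          && Nat.ble (720 * u) 7190000000000) then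
        10000000000 * 10000000000 / (360 * u) + 1 else 277777778) fun H =>
      force ((1810000000000 - 360 * x) * 10000000000 / (360 * w) + 1 + (w / 2 + 1)
        + (H / 720 + 1)) fun t =>
      force (10027777777 - t) fun γ =>
      Nat.ble t 10027777777 && (Nat.ble 1 w &&
      weightCheck γ H 8 10000000000 fun b =>
      force (10000000000 - ((10000000000 - 180 * x * 10000000000 / (1820000000000 - 180 * x)) * b
        / 10000000000 + 1)) fun R' =>
      Nat.ble R R' && (Nat.ble (8 * x') (5 * R') && (Nat.ble R' (180 * x) &&
      (Nat.ble 10000000000 (b + x) && (Nat.ble (1810000000000 + 4 * x) (182 * (b + x)) &&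
      force (v + (x' - x) * 10000000000 / R' + 1) fun v =>
      gridCheck m x' w R' v)))))

set_option maxRecDepth 100000 in
lemma gridCheck_eq_true : gridCheck 1300 10000000 10000000000 1 0 = true := by decide +kernel

lemma weightCheck_sound {γ H d b : ℕ} {f : ℕ → Bool} (h : weightCheck γ H d b f = true) :
    ∃ β : ℕ → ℕ, β (d + 1) = b ∧ f (β 1) = true ∧ ∀ j, 1 ≤ j → j ≤ d →
      β j ≤ 10000000000 ∧ 10000000000 * 10000000000 ≤ β j * (10000000000 + γ) ∧
      (β j = 10000000000 ∨ 10000000000 + β (j + 1) * (10000000000 - γ +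
        (j * ((j + 1) * H - γ) / (180 - j) + 1)) / 10000000000 + 1 ≤ 2 * β j) := by
  induction d generalizing b with
  | zero => exact ⟨fun _ => b, rfl, h, fun j h1 h2 => by omega⟩
  | succ d ih =>
    simp only [weightCheck, force_eq, bif_ble_eq_min, Bool.and_eq_true, Nat.ble_eq] at h
    obtain ⟨h1, h2⟩ := h
    obtain ⟨β, hβ, hf, hj⟩ := ih h2
    refine ⟨Function.update β (d + 2) b, by simp, ?_, fun j hj1 hj2 => ?_⟩
    · rw [Function.update_of_ne (by omega)]; exact hf
    · rcases Nat.lt_or_ge d j with hd | hd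
      · obtain rfl : j = d + 1 := by omega
        rw [Function.update_self, Function.update_of_ne (by omega), hβ]
        refine ⟨min_le_right _ _, h1, ?_⟩
        set X := b * (10000000000 - γ + ((d + 1) * ((d + 1 + 1) * H - γ) / (180 - (d + 1)) + 1)) /
          10000000000 with hX
        rcases le_total ((10000000000 + (X + 1)) / 2 + 1) 10000000000 with hX' | hX'
        · right; rw [min_eq_left hX']; omega
        · left; exact min_eq_right hX'
      · rw [Function.update_of_ne (by omega), Function.update_of_ne (by omega)]
        exact hj j hj1 hd

lemma natCast_sub_ge (a b : ℕ) : (a : ℝ) - b ≤ ((a - b : ℕ) : ℝ) := by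
  have : a ≤ a - b + b := le_tsub_add
  have : (a : ℝ) ≤ ((a - b : ℕ) : ℝ) + b := by exact_mod_cast this
  linarith

lemma div_le_natCast_div_add_one (a b : ℕ) : (a : ℝ) / b ≤ ((a / b : ℕ) : ℝ) + 1 := by
  have := Nat.lt_floor_add_one ((a : ℝ) / b)
  rw [Nat.floor_div_natCast, Nat.floor_natCast] at this
  exact this.le

lemma level_ineq {b b' γ H j : ℕ} (hj : j < 180)
    (h : 10000000000 + b * (10000000000 - γ + (j * ((j + 1) * H - γ) / (180 - j) + 1)) /
      10000000000 + 1 ≤ 2 * b') :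
    ∃ e : ℝ, 0 ≤ e ∧ ((j : ℝ) + 1) * (H / 10000000000) - γ / 10000000000 ≤ e ∧
      1 + (b : ℝ) / 10000000000 * (1 - γ / 10000000000 + j * e / (180 - j)) ≤
        2 * (b' / 10000000000) := by
  have h1 := natCast_sub_ge ((j + 1) * H) γ
  have h2 := div_le_natCast_div_add_one (j * ((j + 1) * H - γ)) (180 - j)
  have h3 := natCast_sub_ge 10000000000 γ
  generalize (j + 1) * H - γ = E at h h1 h2
  generalize j * E / (180 - j) = F at h h2
  generalize 10000000000 - γ = G at h h3
  have h4 := div_le_natCast_div_add_one (b * (G + (F + 1))) 10000000000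
  have h5 : (10000000000 : ℝ) + ((b * (G + (F + 1)) / 10000000000 : ℕ) : ℝ) + 1 ≤ 2 * b' := by
    exact_mod_cast h
  have h6 := h4.trans (show _ ≤ 2 * (b' : ℝ) - 10000000000 by linarith)
  rw [Nat.cast_sub hj.le] at h2
  push_cast at h1 h2 h3 h6
  refine ⟨E / 10000000000, by positivity, ?_, ?_⟩
  · rw [mul_div_assoc', ← sub_div]
    gcongr
  · have hb : (0 : ℝ) ≤ b := b.cast_nonneg
    have h7 : (b : ℝ) * (10000000000 - γ + j * E / (180 - j)) ≤ b * (G + (F + 1)) := by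
      gcongr
    have e : (b : ℝ) / 10000000000 * (1 - γ / 10000000000 + j * (E / 10000000000) / (180 - j)) =
        b * (10000000000 - γ + j * E / (180 - j)) / 10000000000 / 10000000000 := by
      field_simp
    rw [e]
    have h8 : (b : ℝ) * (10000000000 - γ + j * E / (180 - j)) / 10000000000 ≤
      2 * (b' : ℝ) - 10000000000 := le_trans (by gcongr) h6
    linarith

lemma pieceData_of_check {x x' w u H t γ R : ℕ} {β : ℕ → ℕ} (hx : 0 < x) (hx5 : x < 5000000000)
    (hx' : x' ≤ 5000000000) (hw : 1 ≤ w) (hw1 : w ≤ 10000000000)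
    (hH : H = 277777778 ∨ 1 ≤ u ∧ u * u + 20000000000 * x' ≤ 10000000000 * 10000000000 ∧
      720 * u ≤ 7190000000000 ∧ H = 10000000000 * 10000000000 / (360 * u) + 1)
    (ht : t = (1810000000000 - 360 * x) * 10000000000 / (360 * w) + 1 + (w / 2 + 1) + (H / 720 + 1))
    (ht1 : t ≤ 10027777777) (hγ : γ = 10027777777 - t) (hβ9 : β 9 = 10000000000)
    (hβ : ∀ j, 1 ≤ j → j ≤ 8 →
      β j ≤ 10000000000 ∧ 10000000000 * 10000000000 ≤ β j * (10000000000 + γ) ∧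
      (β j = 10000000000 ∨ 10000000000 + β (j + 1) * (10000000000 - γ +
        (j * ((j + 1) * H - γ) / (180 - j) + 1)) / 10000000000 + 1 ≤ 2 * β j))
    (hR : R = 10000000000 - ((10000000000 - 180 * x * 10000000000 / (1820000000000 - 180 * x)) *
      β 1 / 10000000000 + 1))
    (hR1 : 8 * x' ≤ 5 * R) (hxx' : x ≤ x') (hR2 : R ≤ 180 * x) (hb1 : 10000000000 ≤ β 1 + x)
    (hb2 : 1810000000000 + 4 * x ≤ 182 * (β 1 + x)) :
    PieceData (x / 10000000000) (x' / 10000000000) (R / 10000000000) (w / 10000000000)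
      (γ / 10000000000) (H / 10000000000)
      (fun d => if 1 ≤ d ∧ d ≤ 8 then (β d : ℝ) / 10000000000 else 1) := by
  have hR0 : 0 < R := by omega
  have hb1' : (if 1 ≤ 1 ∧ 1 ≤ 8 then (β 1 : ℝ) / 10000000000 else 1) = β 1 / 10000000000 := by
    rw [if_pos (by norm_num)]
  have hβ' : ∀ d, 1 ≤ d → d ≤ 9 →
      (if 1 ≤ d ∧ d ≤ 8 then (β d : ℝ) / 10000000000 else 1) = β d / 10000000000 := by
    intro d hd1 hd2
    split_ifs with h
    · rfl
    · rw [show d = 9 by omega, hβ9]; norm_num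
  have hx0 : (0 : ℝ) < x := by exact_mod_cast hx
  have hw0 : (0 : ℝ) < w := by exact_mod_cast hw
  refine
    { pos := by positivity
      le_half := ?_
      w_pos := by positivity
      w_le := ?_
      γ_nonneg := by positivity
      γ_le := ?_
      H_ge := ?_
      b_nonneg := ?_
      b_le := ?_
      b_top := by norm_num
      b_ge := ?_
      b_step := ?_
      b_one_ge := ?_
      b_one_ge' := ?_
      R_le := ?_
      R_pos := by positivity
      R_le_one := ?_
      R_le_mul := ?_
      le_R := ?_ }
  · have : (x' : ℝ) ≤ 5000000000 := by exact_mod_cast hx'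
    linarith
  · have : (w : ℝ) ≤ 10000000000 := by exact_mod_cast hw1
    linarith
  · have h1 := div_le_natCast_div_add_one ((1810000000000 - 360 * x) * 10000000000) (360 * w)
    have h2 := div_le_natCast_div_add_one w 2
    have h3 := div_le_natCast_div_add_one H 720
    have h5 : (γ : ℝ) = 10027777777 - t := by rw [hγ, Nat.cast_sub ht1]; norm_num
    have h6 : (t : ℝ) = (((1810000000000 - 360 * x) * 10000000000 / (360 * w) : ℕ) : ℝ) + 1 +
      (((w / 2 : ℕ) : ℝ) + 1) + (((H / 720 : ℕ) : ℝ) + 1) := by rw [ht]; push_cast; ring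
    push_cast [Nat.cast_sub (show 360 * x ≤ 1810000000000 by omega)] at h1 h2 h3
    have e : ((181 / 180 - 2 * ((x : ℝ) / 10000000000)) / ((w : ℝ) / 10000000000) +
        w / 10000000000) / 2 =
        ((1810000000000 - 360 * (x : ℝ)) * 10000000000 / (360 * w) + w / 2) / 10000000000 := by
      field_simp; ring
    rw [e]
    linarith
  · rcases hH with hH | ⟨hu, hu1, hu2, hH⟩
    · left; rw [hH]; norm_num
    · right
      have hu0 : (0 : ℝ) < u := by exact_mod_cast hu
      have hu1' : (u : ℝ) * u + 20000000000 * x' ≤ 10000000000 * 10000000000 := by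
        exact_mod_cast hu1
      have hu2' : 720 * (u : ℝ) ≤ 7190000000000 := by exact_mod_cast hu2
      have h1 := div_le_natCast_div_add_one (10000000000 * 10000000000) (360 * u)
      have h2 : (H : ℝ) = ((10000000000 * 10000000000 / (360 * u) : ℕ) : ℝ) + 1 := by
        rw [hH]; push_cast; ring
      rw [← h2] at h1
      push_cast at h1
      rw [div_le_iff₀ (by positivity)] at h1
      refine ⟨u / 10000000000, by positivity, ?_, ?_, ?_⟩
      · linarith
      · linarith
      · linarith
  · intro d; split_ifs <;> positivity
  · intro d; split_ifs with h
    · have : (β d : ℝ) ≤ 10000000000 := by exact_mod_cast (hβ d h.1 h.2).1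
      linarith
    · exact le_rfl
  · intro d; split_ifs with h
    · have : (10000000000 : ℝ) * 10000000000 ≤ β d * (10000000000 + γ) := by
        exact_mod_cast (hβ d h.1 h.2).2.1
      linarith
    · have : (0 : ℝ) ≤ (γ : ℝ) / 10000000000 := by positivity
      linarith
  · intro d hd1 hd2
    rcases Nat.lt_or_ge 8 d with hd | hd
    · left; rw [if_neg (by omega)]
    · rw [hβ' d hd1 (by omega), hβ' (d + 1) (by omega) (by omega)]
      rcases (hβ d hd1 hd).2.2 with h | h
      · left; rw [h]; norm_num
      · right
        exact level_ineq (by omega) h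
  · have : (10000000000 : ℝ) ≤ β 1 + x := by exact_mod_cast hb1
    rw [hb1']; linarith
  · have : (1810000000000 : ℝ) + 4 * x ≤ 182 * (β 1 + x) := by exact_mod_cast hb2
    rw [hb1']; linarith
  · rw [hb1']
    have h1 : (((180 * x * 10000000000 / (1820000000000 - 180 * x) : ℕ)) : ℝ) ≤ _ :=
      Nat.cast_div_le
    have h2 := natCast_sub_ge 10000000000 (180 * x * 10000000000 / (1820000000000 - 180 * x))
    push_cast [Nat.cast_sub (show 180 * x ≤ 1820000000000 by omega)] at h1
    generalize 180 * x * 10000000000 / (1820000000000 - 180 * x) = D at h1 h2 hR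
    generalize 10000000000 - D = G at h2 hR
    have h3 := div_le_natCast_div_add_one (G * β 1) 10000000000
    generalize G * β 1 / 10000000000 = F at h3 hR
    have h4 : (R : ℝ) = 10000000000 - (F + 1) := by
      rw [hR, Nat.cast_sub (by omega)]; norm_num
    have h5 : (180 : ℝ) * (x / 10000000000) / (182 - 180 * (x / 10000000000)) =
        180 * x * 10000000000 / (1820000000000 - 180 * x) / 10000000000 := by
      have h6 : (x : ℝ) < 5000000000 := by exact_mod_cast hx5
      have h7 : (1820000000000 : ℝ) - 180 * x ≠ 0 := by
        apply ne_of_gt; linarith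
      have h8 : (182 : ℝ) - 180 * (x / 10000000000) = (1820000000000 - 180 * x) / 10000000000 := by
        ring
      rw [h8]; field_simp
    rw [h5]
    push_cast at h2 h3
    have h6 : (10000000000 - 180 * (x : ℝ) * 10000000000 / (1820000000000 - 180 * x)) * β 1 ≤
        G * β 1 := by
      gcongr; linarith
    linarith
  · have : (R : ℝ) ≤ 10000000000 := by exact_mod_cast (show R ≤ 10000000000 by omega)
    linarith
  · have : (R : ℝ) ≤ 180 * x := by exact_mod_cast hR2
    linarith
  · have : 8 * (x' : ℝ) ≤ 5 * R := by exact_mod_cast hR1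
    linarith

lemma gridCheck_sound {k m x w R v : ℕ} (hk : 180 ≤ k) (hx : 0 < x) (hR : 0 < R)
    (hx5 : x ≤ 5000000000)
    (hc : Completes k (v / 10000000000) (x / 10000000000) (R / 10000000000))
    (h : gridCheck m x w R v = true) :
    ∃ v R : ℝ, 0 < R ∧ v ≤ 3.21432 - 1 / 90 ∧ Completes k v (1 / 2) R := by
  induction m generalizing x w R v with
  | zero => exact absurd h (by simp [gridCheck])
  | succ m ih =>
    simp only [gridCheck, force_eq, bif_ble_eq_min] at h
    cases hb : Nat.ble 5000000000 x
    · have hx5' : x < 5000000000 := by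
        by_contra! h'
        rw [← Nat.ble_eq, hb] at h'
        exact absurd h' (by simp)
      rw [hb, cond_false] at h
      set x' := min (x + x / 200) 5000000000 with hx'
      have hxx' : x ≤ x' := by omega
      have hx'5 : x' ≤ 5000000000 := by omega
      set w' := min ((w + (1810000000000 - 360 * x) * 10000000000 / (180 * w)) / 2) 10000000000
      have hw' : w' ≤ 10000000000 := min_le_right _ _
      set u := w' - (29411764 + x / 90) * 10000000000 / w'
      set H := bif Nat.ble 1 u && (Nat.ble (u * u + 20000000000 * x') (10000000000 * 10000000000)
          && Nat.ble (720 * u) 7190000000000) then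
        10000000000 * 10000000000 / (360 * u) + 1 else 277777778 with hH
      have hH' : H = 277777778 ∨ 1 ≤ u ∧
          u * u + 20000000000 * x' ≤ 10000000000 * 10000000000 ∧
          720 * u ≤ 7190000000000 ∧ H = 10000000000 * 10000000000 / (360 * u) + 1 := by
        cases hu : (Nat.ble 1 u && (Nat.ble (u * u + 20000000000 * x')
          (10000000000 * 10000000000) && Nat.ble (720 * u) 7190000000000))
        · left; rw [hH, hu, cond_false]
        · right
          rw [hu, cond_true] at hH
          simp only [Bool.and_eq_true, Nat.ble_eq] at hu
          exact ⟨hu.1, hu.2.1, hu.2.2, hH⟩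
      simp only [Bool.and_eq_true, Nat.ble_eq] at h
      obtain ⟨h1, h2, h3⟩ := h
      obtain ⟨β, hβ9, hf, hβ⟩ := weightCheck_sound h3
      simp only [Bool.and_eq_true, Nat.ble_eq] at hf
      obtain ⟨f1, f2, f3, f4, f5, f6⟩ := hf
      have hp := pieceData_of_check hx hx5' hx'5 h2 hw' hH' rfl h1 rfl hβ9 hβ rfl f2 hxx'
        f3 f4 f5
      set R' := 10000000000 - ((10000000000 - 180 * x * 10000000000 / (1820000000000 - 180 * x)) *
        β 1 / 10000000000 + 1) with hR'
      have hR'0 : 0 < R' := by omega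
      have hR'c : (0 : ℝ) < R' := by exact_mod_cast hR'0
      have hRc : (0 : ℝ) < R := by exact_mod_cast hR
      have hRR' : (R : ℝ) ≤ R' := by exact_mod_cast f1
      refine ih (by omega) hR'0 hx'5 (hc.piece hp hk (by positivity) (by positivity) ?_ ?_) f6
      · gcongr
      · have h4 := div_le_natCast_div_add_one ((x' - x) * 10000000000) R'
        push_cast [Nat.cast_sub hxx'] at h4 ⊢
        have e : ((x' : ℝ) / 10000000000 - x / 10000000000) / (R' / 10000000000) =
            ((x' - x) * 10000000000 / R') / 10000000000 := by
          field_simp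
        rw [e]
        linarith
    · rw [hb, cond_true, Nat.ble_eq] at h
      have hx6 : 5000000000 ≤ x := by rwa [← Nat.ble_eq]
      obtain rfl : x = 5000000000 := by omega
      have hRc : (0 : ℝ) < R := by exact_mod_cast hR
      refine ⟨v / 10000000000, R / 10000000000, by positivity, ?_, by convert hc using 1; norm_num⟩
      have h' : (90 : ℝ) * v + 10000000000 ≤ 90 * 32143200000 := by exact_mod_cast h
      linarith

lemma hasExponent_of_ge {k : ℕ} (hk : 180 ≤ k) : HasExponent k (3.21432 * (k : ℝ) ^ 2) := by
  have hk0 : (180 : ℝ) ≤ k := by exact_mod_cast hk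
  obtain ⟨v, R, hR, hv, hc⟩ := gridCheck_sound (k := k) hk (by norm_num) (by norm_num) (by norm_num)
    (by convert completes_zero hk _ using 1 <;> norm_num) gridCheck_eq_true
  refine hc k 0 k ⟨by omega, le_rfl, le_rfl, by nlinarith, by push_cast; linarith,
    powBound_self (by omega)⟩ (by nlinarith) (by nlinarith) ?_
  have h1 : ((k : ℝ) * (k + 1) / 2 - k - 1 / 2 * (k : ℝ) ^ 2) / R ≤ 0 :=
    div_nonpos_of_nonpos_of_nonneg (by nlinarith) hR.le
  have h2 : v * (k : ℝ) ^ 2 ≤ (3.21432 - 1 / 90) * (k : ℝ) ^ 2 := by gcongr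
  nlinarith

end LargeDegrees

end Vino

open Vino in
/-- **Theorem 3 (second part), Ford**: for every integer `k ≥ 129`, with
`(ρ,θ) = (3.21432, 2.3291)` for `k ≥ 200`, `(3.21734, 2.3849)` for `150 ≤ k ≤ 199`, and
`(3.22313, 2.4183)` for `129 ≤ k ≤ 149`, there is a positive integer `s ≤ ρk²` with
`J_{s,k}(P) ≤ k^{θk³} · P^{2s−k(k+1)/2+0.001k²}` for all real `P ≥ 1`. -/
theorem vinogradov_integral_bound' (k : ℕ) (hk : 129 ≤ k) :
    ∃ s : ℕ, 0 < s ∧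
      (s : ℝ) ≤ (if 200 ≤ k then (3.21432 : ℝ) else if 150 ≤ k then 3.21734 else 3.22313)
          * (k : ℝ) ^ 2 ∧
      ∀ P : ℝ, 1 ≤ P →
        (Jv s k P : ℝ) ≤
          (k : ℝ) ^ ((if 200 ≤ k then (2.3291 : ℝ) else if 150 ≤ k then 2.3849 else 2.4183)
              * (k : ℝ) ^ 3) *
            P ^ (2 * (s : ℝ) - (k : ℝ) * (k + 1) / 2 + 0.001 * (k : ℝ) ^ 2) := by
  have h : HasExponent k ((if 200 ≤ k then (3.21432 : ℝ) else if 150 ≤ k then 3.21734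
      else 3.22313) * (k : ℝ) ^ 2) := by
    rcases Nat.lt_or_ge k 180 with h | h
    · rw [if_neg (by omega)]
      exact hasExponent_of_lt hk h
    · obtain ⟨s, n, A, h1, h2, h3⟩ := hasExponent_of_ge h
      refine ⟨s, n, A, h1, h2.trans ?_, h3⟩
      rw [if_pos (show 150 ≤ k by omega)]
      gcongr
      split_ifs <;> norm_num
  obtain ⟨s, n, A, h1, h2, h3, h4, h5, h6⟩ := h
  exact ⟨s, h1, h2, fun P hP => Jv_le_of_powBound hk h3 h4 h6 h5 hP⟩
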